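/- The 2n elements c^{ϖ_i}_{−ϖ_i, w_0ϖ_i} and c^{ϖ_i}_{−w_0ϖ_i, ϖ_i}, for i ∈ {1,…,n}, are nonzero normal elements of O_q(G), and the 2n ideals they individually generate are pairwise distinct completely prime ideals of O_q(G). -/

import Mathlib

open scoped TensorProduct

/-- The `q`-factorial `(q - q⁻¹)(q² - q⁻²)⋯(qᵐ - q⁻ᵐ)`. -/
noncomputable def qfac (t : ℂ) (m : ℕ) : ℂ :=
  ∏ j ∈ Finset.range m, (t ^ (j + 1) - t⁻¹ ^ (j + 1))

/-- The `q`-binomial coefficient `[m k]` at parameter `t`. -/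
noncomputable def qbinom (t : ℂ) (m k : ℕ) : ℂ :=
  qfac t m / (qfac t k * qfac t (m - k))

/-- The defining relations of the quantised enveloping algebra `U_q(𝔤)` associated to a
Cartan matrix `a` with symmetrising integers `d`, on elements `E i`, `F i`, `K i` of a
`ℂ`-algebra `B`: the `K i` are commuting units, conjugation by `K i` rescales `E j` and
`F j` by `q_i^{±a i j}` (where `q_i = q^{d i}`), the commutator `[E i, F j]` is
`δ_{ij} (K_i - K_i⁻¹)/(q_i - q_i⁻¹)`, and the quantum Serre relations hold. -/
def UqRels (q : ℂ) {n : ℕ} (a : Fin n → Fin n → ℤ) (d : Fin n → ℕ)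
    (B : Type) [Ring B] [Algebra ℂ B] (E F : Fin n → B) (K : Fin n → Bˣ) : Prop :=
  (∀ i j, (K i : B) * (K j : B) = (K j : B) * (K i : B)) ∧
  (∀ i j, (K i : B) * E j = (q ^ ((d i : ℤ) * a i j)) • (E j * (K i : B))) ∧
  (∀ i j, (K i : B) * F j = (q ^ (-((d i : ℤ) * a i j))) • (F j * (K i : B))) ∧
  (∀ i j, E i * F j - F j * E i =
    if i = j then (q ^ (d i : ℤ) - q ^ (-(d i : ℤ)))⁻¹ • ((K i : B) - (((K i)⁻¹ : Bˣ) : B))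
    else 0) ∧
  (∀ i j, i ≠ j → ∑ k ∈ Finset.range ((1 - a i j).toNat + 1),
      ((-1 : ℂ) ^ k * qbinom (q ^ (d i : ℤ)) ((1 - a i j).toNat) k) •
        (E i ^ ((1 - a i j).toNat - k) * E j * E i ^ k) = 0) ∧
  (∀ i j, i ≠ j → ∑ k ∈ Finset.range ((1 - a i j).toNat + 1),
      ((-1 : ℂ) ^ k * qbinom (q ^ (d i : ℤ)) ((1 - a i j).toNat) k) •
        (F i ^ ((1 - a i j).toNat - k) * F j * F i ^ k) = 0)

/-- The weight space of weight `μ = ∑ μ i ϖ i` in a `U_q(𝔤)`-module: the set of vectors on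
which each `K i` acts by the scalar `q^{(μ, α_i)} = q^{μ i * d i}`. -/
noncomputable def wtSp (q : ℂ) {n : ℕ} (d : Fin n → ℕ)
    {U : Type} [Ring U] [Algebra ℂ U] (K : Fin n → Uˣ)
    {Vc : Type} [AddCommGroup Vc] [Module ℂ Vc] (ρ : U →ₐ[ℂ] Module.End ℂ Vc)
    (μ : Fin n → ℤ) : Submodule ℂ Vc :=
  ⨅ i : Fin n, LinearMap.ker (ρ (K i : U) - (q ^ (μ i * (d i : ℤ))) • (1 : Module.End ℂ Vc))

/-- `ξ` is a dual vector of weight `μ`:  equivalently (via the antipode-twisted action on the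
dual module), `ξ` vanishes on every weight space of weight `ν ≠ -μ`. -/
noncomputable def inDualWt (q : ℂ) {n : ℕ} (d : Fin n → ℕ)
    {U : Type} [Ring U] [Algebra ℂ U] (K : Fin n → Uˣ)
    {Vc : Type} [AddCommGroup Vc] [Module ℂ Vc] (ρ : U →ₐ[ℂ] Module.End ℂ Vc)
    (μ : Fin n → ℤ) (ξ : Module.Dual ℂ Vc) : Prop :=
  ∀ ν : Fin n → ℤ, ν ≠ -μ → ∀ x ∈ wtSp q d K ρ ν, ξ x = 0

/-- The Demazure-type submodule generated by the weight space of weight `ν` under the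
subalgebra of `U` generated by `gens` (take `gens = Set.range E` for `V⁺_w(λ)` with
`ν = wλ`, and `gens = Set.range F` for `V⁻_w(λ)`). -/
noncomputable def demazure (q : ℂ) {n : ℕ} (d : Fin n → ℕ)
    {U : Type} [Ring U] [Algebra ℂ U] (gens : Set U) (K : Fin n → Uˣ)
    {Vc : Type} [AddCommGroup Vc] [Module ℂ Vc] (ρ : U →ₐ[ℂ] Module.End ℂ Vc)
    (ν : Fin n → ℤ) : Submodule ℂ Vc :=
  Submodule.span ℂ
    {x | ∃ y ∈ Algebra.adjoin ℂ gens, ∃ u ∈ wtSp q d K ρ ν, x = ρ y u}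

/-- A two-sided ideal of a (possibly noncommutative) ring is prime if it is proper and
`x R y ⊆ P` implies `x ∈ P` or `y ∈ P`. -/
def IsPrimeTwoSided {R : Type*} [Ring R] (P : TwoSidedIdeal R) : Prop :=
  P ≠ ⊤ ∧ ∀ x y : R, (∀ r : R, x * r * y ∈ P) → x ∈ P ∨ y ∈ P

/-- An element `r` of a ring is normal if `rR = Rr`. -/
def IsNormalElem {R : Type*} [Ring R] (r : R) : Prop :=
  (∀ x, ∃ y, r * x = y * r) ∧ ∀ x, ∃ y, x * r = r * y

/-- The ideal `Q⁺_{w}` of `O_q(G)`: generated by the coordinate functions `c^{ϖ_j}_{ξ,v}` with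
`v` a highest weight vector of `V(ϖ_j)` and `ξ` orthogonal to the Demazure module
`V⁺_w(ϖ_j)`. -/
noncomputable def Qplus (q : ℂ) {n : ℕ} (d : Fin n → ℕ)
    {U : Type} [Ring U] [Algebra ℂ U] (E : Fin n → U) (K : Fin n → Uˣ)
    {V : (Fin n → ℕ) → Type} [∀ c, AddCommGroup (V c)] [∀ c, Module ℂ (V c)]
    (ρ : ∀ c, U →ₐ[ℂ] Module.End ℂ (V c))
    {W : Type} [Group W] (σ : W →* Multiplicative (AddAut (Fin n → ℤ)))
    {A : Type} [Ring A]
    (cf : ∀ c : Fin n → ℕ, Module.Dual ℂ (V c) → V c → A)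
    (w : W) : TwoSidedIdeal A :=
  TwoSidedIdeal.span
    {x | ∃ j : Fin n, ∃ ξ : Module.Dual ℂ (V (Pi.single j 1)),
      ∃ v ∈ wtSp q d K (ρ (Pi.single j 1)) (fun k => ((Pi.single j 1 : Fin n → ℕ) k : ℤ)),
        (∀ y ∈ demazure q d (Set.range E) K (ρ (Pi.single j 1))
            (σ w (fun k => ((Pi.single j 1 : Fin n → ℕ) k : ℤ))), ξ y = 0) ∧
        x = cf (Pi.single j 1) ξ v}

/-- The ideal `Q⁻_{w}` of `O_q(G)`: generated by the coordinate functions `c^{ϖ_j}_{ξ,v}` with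
`v` a lowest weight vector of `V(ϖ_j)` and `ξ` orthogonal to the Demazure module
`V⁻_{w w₀}(ϖ_j)`. -/
noncomputable def Qminus (q : ℂ) {n : ℕ} (d : Fin n → ℕ)
    {U : Type} [Ring U] [Algebra ℂ U] (F : Fin n → U) (K : Fin n → Uˣ)
    {V : (Fin n → ℕ) → Type} [∀ c, AddCommGroup (V c)] [∀ c, Module ℂ (V c)]
    (ρ : ∀ c, U →ₐ[ℂ] Module.End ℂ (V c))
    {W : Type} [Group W] (σ : W →* Multiplicative (AddAut (Fin n → ℤ))) (w₀ : W)
    {A : Type} [Ring A]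
    (cf : ∀ c : Fin n → ℕ, Module.Dual ℂ (V c) → V c → A)
    (w : W) : TwoSidedIdeal A :=
  TwoSidedIdeal.span
    {x | ∃ j : Fin n, ∃ ξ : Module.Dual ℂ (V (Pi.single j 1)),
      ∃ v ∈ wtSp q d K (ρ (Pi.single j 1)) (σ w₀ (fun k => ((Pi.single j 1 : Fin n → ℕ) k : ℤ))),
        (∀ y ∈ demazure q d (Set.range F) K (ρ (Pi.single j 1))
            (σ (w * w₀) (fun k => ((Pi.single j 1 : Fin n → ℕ) k : ℤ))), ξ y = 0) ∧
        x = cf (Pi.single j 1) ξ v}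


open scoped TensorProduct

/-- Cartan and Weyl group data, in the form used by the proof. -/
structure CD (n : ℕ) where
  q : ℂ
  q_ne : q ≠ 0
  q_root : ∀ m : ℤ, q ^ m = 1 → m = 0
  a : Fin n → Fin n → ℤ
  d : Fin n → ℕ
  d_pos : ∀ i, 0 < d i
  a_diag : ∀ i, a i i = 2
  a_symm : ∀ i j, (d i : ℤ) * a i j = (d j : ℤ) * a j i
  W : Type
  [grp : Group W]
  [fin : Fintype W]
  act : W → (Fin n → ℤ) →+ (Fin n → ℤ)
  act_one : ∀ μ, act 1 μ = μ
  act_mul : ∀ v w μ, act (v * w) μ = act v (act w μ)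
  s : Fin n → W
  s_gen : Subgroup.closure (Set.range s) = ⊤
  s_act : ∀ i (μ : Fin n → ℤ), act (s i) μ = fun k => μ k - μ i * a k i
  w0 : W
  w0_act : ∀ μ : Fin n → ℤ, (∀ i, 0 ≤ μ i) → ∀ i, act w0 μ i ≤ 0

attribute [instance] CD.grp CD.fin

namespace CD
variable {n : ℕ} (C : CD n)

/-- simple root -/
def al (j : Fin n) : Fin n → ℤ := fun k => C.a k j

/-- invariant form -/
def B (μ ν : Fin n → ℤ) : ℤ := ∑ w : C.W, ∑ k, C.act w μ k * C.act w ν k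

/-- height functional -/
def ph (μ : Fin n → ℤ) : ℤ := C.B μ 1

theorem B_add (μ μ' ν) : C.B (μ + μ') ν = C.B μ ν + C.B μ' ν := by
  simp [B, add_mul, Finset.sum_add_distrib]

theorem B_comm (μ ν) : C.B μ ν = C.B ν μ := by
  simp [B, mul_comm]

theorem B_neg (μ ν) : C.B (-μ) ν = - C.B μ ν := by
  simp [B]

theorem B_smul (m : ℤ) (μ ν) : C.B (m • μ) ν = m * C.B μ ν := by
  simp only [B, map_zsmul, Pi.smul_apply, smul_eq_mul, Finset.mul_sum, mul_assoc]

theorem B_inv (w : C.W) (μ ν) : C.B (C.act w μ) (C.act w ν) = C.B μ ν := by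
  unfold B
  simp only [← C.act_mul]
  exact Fintype.sum_equiv (Equiv.mulRight w) _ _ (fun x => rfl)

theorem B_pos (μ) (h : μ ≠ 0) : 0 < C.B μ μ := by
  unfold B
  apply Finset.sum_pos'
  · intro w _
    exact Finset.sum_nonneg fun k _ => mul_self_nonneg _
  · refine ⟨1, Finset.mem_univ _, ?_⟩
    simp only [C.act_one]
    obtain ⟨k, hk⟩ := Function.ne_iff.1 h
    exact Finset.sum_pos' (fun k _ => mul_self_nonneg _) ⟨k, Finset.mem_univ _, mul_self_pos.2 hk⟩

theorem s_act' (i) (μ : Fin n → ℤ) : C.act (C.s i) μ = μ - μ i • C.al i := by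
  rw [C.s_act]; ext k; simp [al]

theorem al_ne (j) : C.al j ≠ 0 := by
  intro h
  have := congrFun h j
  simp [al, C.a_diag] at this

theorem two_B_al (j) (μ) : 2 * C.B (C.al j) μ = μ j * C.B (C.al j) (C.al j) := by
  have h := C.B_inv (C.s j) (C.al j) μ
  have h1 : C.act (C.s j) (C.al j) = - C.al j := by
    rw [s_act']; simp [al, C.a_diag]; ext k; simp [al]; ring
  rw [h1, s_act', B_neg, B_comm, sub_eq_add_neg, B_add, B_neg, B_smul, C.B_comm μ] at h
  linarith

theorem ph_add (μ ν) : C.ph (μ + ν) = C.ph μ + C.ph ν := C.B_add _ _ _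
theorem ph_neg (μ) : C.ph (-μ) = - C.ph μ := C.B_neg _ _
theorem ph_sub (μ ν) : C.ph (μ - ν) = C.ph μ - C.ph ν := by
  rw [sub_eq_add_neg, ph_add, ph_neg]; ring

theorem ph_al (j) : 0 < C.ph (C.al j) := by
  have := C.two_B_al j 1
  have h2 := C.B_pos _ (C.al_ne j)
  simp at this
  unfold ph; linarith

theorem sum_act (μ) : ∑ w : C.W, C.act w μ = 0 := by
  set S := ∑ w : C.W, C.act w μ with hS
  have h : ∀ j, C.act (C.s j) S = S := by
    intro j
    rw [hS, map_sum]
    simp only [← C.act_mul]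
    exact Fintype.sum_equiv (Equiv.mulLeft (C.s j)) _ _ (fun x => rfl)
  ext j
  have h1 := congrFun (h j) j
  rw [C.s_act] at h1
  simp [C.a_diag] at h1
  simpa using h1

theorem sum_ph (μ) : ∑ w : C.W, C.ph (C.act w μ) = 0 := by
  have h : C.ph (∑ w : C.W, C.act w μ) = ∑ w : C.W, C.ph (C.act w μ) := by
    exact map_sum (AddMonoidHom.mk' C.ph C.ph_add) (fun w => C.act w μ) Finset.univ
  rw [← h, sum_act]
  have := C.ph_add 0 0
  simp at this; exact this

theorem al_indep (m : Fin n → ℤ) (h : ∑ j, m j • C.al j = 0) : m = 0 := by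
  ext i
  have h1 : 2 * C.B (∑ j, m j • C.al j) (Pi.single i 1) = m i * C.B (C.al i) (C.al i) := by
    have := map_sum (AddMonoidHom.mk' (fun μ => C.B μ (Pi.single i 1)) (fun x y => C.B_add x y _))
      (fun j => m j • C.al j) Finset.univ
    simp only [AddMonoidHom.mk'_apply] at this
    rw [this, Finset.mul_sum, Finset.sum_eq_single i]
    · rw [B_smul]
      have := C.two_B_al i (Pi.single i 1)
      simp at this
      linear_combination m i * this
    · intro b _ hb
      rw [B_smul]
      have := C.two_B_al b (Pi.single i 1)
      simp [hb] at this
      simp [this]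
    · simp
  rw [h] at h1
  have h0 : C.B 0 (Pi.single i 1) = 0 := by simp [B]
  rw [h0] at h1
  have := C.B_pos _ (C.al_ne i)
  simp at h1
  rcases h1 with h1 | h1
  · exact h1
  · omega

theorem act_inv_act (w : C.W) (μ) : C.act w⁻¹ (C.act w μ) = μ := by
  rw [← C.act_mul]; simp [C.act_one]
theorem act_act_inv (w : C.W) (μ) : C.act w (C.act w⁻¹ μ) = μ := by
  rw [← C.act_mul]; simp [C.act_one]

theorem w0_pow (k : ℕ) (μ : Fin n → ℤ) (h : ∀ i, 0 ≤ μ i) :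
    ∀ i, 0 ≤ (-1) ^ k * C.act (C.w0 ^ k) μ i := by
  induction k with
  | zero => simpa [C.act_one] using h
  | succ k ih =>
    intro i
    have := C.w0_act (fun i => (-1) ^ k * C.act (C.w0 ^ k) μ i) ih i
    have e : (fun i => (-1) ^ k * C.act (C.w0 ^ k) μ i) = ((-1 : ℤ) ^ k) • C.act (C.w0 ^ k) μ := by
      ext; simp
    rw [e, map_zsmul, ← C.act_mul, ← pow_succ'] at this
    simp at this
    rw [pow_succ]; linarith

theorem w0_inv_act (μ : Fin n → ℤ) (h : ∀ i, 0 ≤ μ i) (i) : C.act C.w0⁻¹ μ i ≤ 0 := by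
  have hN : 0 < orderOf C.w0 := orderOf_pos _
  have h1 : C.w0 ^ (2 * orderOf C.w0 - 1) = C.w0⁻¹ := by
    rw [eq_inv_iff_mul_eq_one, ← pow_succ]
    have : 2 * orderOf C.w0 - 1 + 1 = orderOf C.w0 * 2 := by omega
    rw [this, pow_mul]; simp
  have h2 := C.w0_pow (2 * orderOf C.w0 - 1) μ h i
  rw [h1] at h2
  have : (-1 : ℤ) ^ (2 * orderOf C.w0 - 1) = -1 := by
    apply Odd.neg_one_pow
    exact ⟨orderOf C.w0 - 1, by omega⟩
  rw [this] at h2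
  linarith

/-- `-w₀` permutes the fundamental weights. -/
theorem w0_fund (i : Fin n) : ∃ p, C.act C.w0 (Pi.single i 1) = - Pi.single p 1 := by
  have hn : ∀ k : Fin n, ∀ l, (0 : ℤ) ≤ (Pi.single k (1 : ℤ) : Fin n → ℤ) l := by
    intro k l; by_cases h : l = k
    · subst h; simp
    · simp [h]
  set c : Fin n → ℤ := - C.act C.w0 (Pi.single i 1) with hc
  have hc0 : ∀ k, 0 ≤ c k := fun k => by
    have := C.w0_act _ (hn i) k; simp [hc]; exact this
  have hdec : c = ∑ k, c k • (Pi.single k 1 : Fin n → ℤ) := by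
    ext l; simp [Pi.single_apply]
  have h1 : C.act C.w0⁻¹ c = - Pi.single i 1 := by
    rw [hc, map_neg, act_inv_act]
  set t : Fin n → ℤ := fun k => - ∑ l, C.act C.w0⁻¹ (Pi.single k 1) l with ht
  have ht1 : ∀ k, 1 ≤ t k := by
    intro k
    by_contra hlt
    have h0 : ∀ l ∈ Finset.univ, 0 ≤ - C.act C.w0⁻¹ (Pi.single k 1) l := fun l _ => by
      have := C.w0_inv_act _ (hn k) l; linarith
    have h2 : ∑ l, - C.act C.w0⁻¹ (Pi.single k 1) l = 0 := by
      have := Finset.sum_nonneg h0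
      simp only [ht] at hlt
      rw [Finset.sum_neg_distrib] at *
      omega
    have h3 : C.act C.w0⁻¹ (Pi.single k 1) = 0 := by
      ext l
      have := (Finset.sum_eq_zero_iff_of_nonneg h0).1 h2 l (Finset.mem_univ _)
      simpa using this
    have h4 := C.act_act_inv C.w0 (Pi.single k 1)
    rw [h3, map_zero] at h4
    have := congrFun h4 k
    simp at this
  have hsum : ∑ k, c k * t k = 1 := by
    have := congrArg (fun μ : Fin n → ℤ => ∑ l, μ l) h1
    beta_reduce at this
    conv_lhs at this => rw [hdec]
    rw [map_sum] at this
    simp only [map_zsmul, Finset.sum_apply, Pi.smul_apply, smul_eq_mul, Pi.neg_apply] at this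
    rw [Finset.sum_comm] at this
    simp only [← Finset.mul_sum] at this
    simp only [ht, mul_neg, Finset.sum_neg_distrib, this]
    simp
  -- exactly one c p nonzero
  have hex : ∃ p, c p ≠ 0 := by
    by_contra hh; push Not at hh
    simp [hh] at hsum
  obtain ⟨p, hp⟩ := hex
  have hnn : ∀ k, 0 ≤ c k * t k := fun k => mul_nonneg (hc0 k) (by linarith [ht1 k])
  have hp1 : 1 ≤ c p := by have := hc0 p; omega
  have hsplit := Finset.add_sum_erase Finset.univ (fun k => c k * t k) (Finset.mem_univ p)
  beta_reduce at hsplit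
  rw [hsum] at hsplit
  have hpp : c p ≤ c p * t p := by nlinarith [ht1 p]
  have hrest : 0 ≤ ∑ k ∈ Finset.univ.erase p, c k * t k := Finset.sum_nonneg fun k _ => hnn k
  have hr0 : ∑ k ∈ Finset.univ.erase p, c k * t k = 0 := by omega
  refine ⟨p, ?_⟩
  have : c = Pi.single p 1 := by
    ext k
    by_cases hk : k = p
    · subst hk; simp; omega
    · have := (Finset.sum_eq_zero_iff_of_nonneg (fun k _ => hnn k)).1 hr0 k (by simp [hk])
      simp [hk]
      rcases mul_eq_zero.1 this with h | h
      · exact h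
      · have := ht1 k; omega
  rw [← this, hc]; simp

theorem w0_rho (j : Fin n) : C.act C.w0 1 j < 0 := by
  have h1 : ∀ i, (0 : ℤ) ≤ (1 : Fin n → ℤ) i := fun i => by simp
  rcases lt_or_eq_of_le (C.w0_act 1 h1 j) with h | h
  · exact h
  exfalso
  have hn : ∀ k : Fin n, ∀ l, (0 : ℤ) ≤ (Pi.single k (1 : ℤ) : Fin n → ℤ) l := by
    intro k l; by_cases h : l = k
    · subst h; simp
    · simp [h]
  have hdec : ∀ c : Fin n → ℤ, c = ∑ k, c k • (Pi.single k 1 : Fin n → ℤ) := by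
    intro c; ext l; simp [Pi.single_apply]
  rw [hdec 1, map_sum] at h
  simp only [Pi.one_apply, one_smul, Finset.sum_apply] at h
  have h2 : ∀ k ∈ Finset.univ, C.act C.w0 (Pi.single k 1) j = 0 := by
    have hh : ∑ k, - C.act C.w0 (Pi.single k 1) j = 0 := by rw [Finset.sum_neg_distrib, h]; simp
    intro k hk
    have := (Finset.sum_eq_zero_iff_of_nonneg (fun k _ => by
      have := C.w0_act _ (hn k) j; linarith)).1 hh k hk
    linarith
  have h3 := C.act_act_inv C.w0 (Pi.single j 1)
  rw [hdec (C.act C.w0⁻¹ (Pi.single j 1)), map_sum] at h3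
  have h4 := congrFun h3 j
  simp only [map_zsmul, Finset.sum_apply, Pi.smul_apply, smul_eq_mul] at h4
  rw [Finset.sum_eq_zero (fun k hk => by rw [h2 k hk, mul_zero])] at h4
  simp at h4

theorem ph_w0_inv_al (j : Fin n) : C.ph (C.act C.w0⁻¹ (C.al j)) < 0 := by
  have h : C.ph (C.act C.w0⁻¹ (C.al j)) = C.B (C.al j) (C.act C.w0 1) := by
    unfold ph
    rw [← C.B_inv C.w0, act_act_inv]
  have h2 := C.two_B_al j (C.act C.w0 1)
  have h3 := C.w0_rho j
  have h4 := C.B_pos _ (C.al_ne j)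
  rw [h]; nlinarith

theorem qpow_inj {x y : ℤ} (h : C.q ^ x = C.q ^ y) : x = y := by
  have : C.q ^ (x - y) = 1 := by
    rw [zpow_sub₀ C.q_ne, h, div_self (zpow_ne_zero _ C.q_ne)]
  have := C.q_root _ this
  omega

end CD
open scoped TensorProduct

inductive G4 | E | F | K | Ki

def G4.sw : G4 → G4
  | .E => .F | .F => .E | .K => .Ki | .Ki => .K

def G4.tw : G4 → G4
  | .E => .F | .F => .E | .K => .K | .Ki => .Ki

/-- operators satisfying the (non-Serre) relations -/
structure Tri {n : ℕ} (C : CD n) {M : Type} [AddCommGroup M] [Module ℂ M]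
    (X : G4 → Fin n → Module.End ℂ M) : Prop where
  kki : ∀ i m, X .K i (X .Ki i m) = m
  kik : ∀ i m, X .Ki i (X .K i m) = m
  kk : ∀ i j m, X .K i (X .K j m) = X .K j (X .K i m)
  ke : ∀ i j m, X .K i (X .E j m) = C.q ^ ((C.d i : ℤ) * C.a i j) • X .E j (X .K i m)
  kf : ∀ i j m, X .K i (X .F j m) = C.q ^ (-((C.d i : ℤ) * C.a i j)) • X .F j (X .K i m)
  ef : ∀ i j m, X .E i (X .F j m) - X .F j (X .E i m) =
    if i = j then (C.q ^ (C.d i : ℤ) - C.q ^ (-(C.d i : ℤ)))⁻¹ • (X .K i m - X .Ki i m) else 0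

namespace CD
variable {n : ℕ} (C : CD n) {M : Type} [AddCommGroup M] [Module ℂ M]

/-- weight spaces -/
def wt (k : Fin n → Module.End ℂ M) (μ : Fin n → ℤ) : Submodule ℂ M where
  carrier := {m | ∀ i, k i m = C.q ^ (μ i * (C.d i : ℤ)) • m}
  add_mem' := by intro x y hx hy i; simp [hx i, hy i]
  zero_mem' := by intro i; simp
  smul_mem' := by intro c x hx i; simp [hx i, smul_comm c]

variable {C} in
theorem mem_wt {k : Fin n → Module.End ℂ M} {μ : Fin n → ℤ} {m : M} :
    m ∈ C.wt k μ ↔ ∀ i, k i m = C.q ^ (μ i * (C.d i : ℤ)) • m := Iff.rfl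

theorem wt_ch_inj : Function.Injective
    (fun (μ : Fin n → ℤ) (i : Fin n) => C.q ^ (μ i * (C.d i : ℤ))) := by
  intro μ ν h
  ext i
  have h1 := C.qpow_inj (congrFun h i)
  have := C.d_pos i
  exact mul_right_cancel₀ (by positivity) h1

theorem wt_indep (k : Fin n → Module.End ℂ M) (hk : ∀ i j m, k i (k j m) = k j (k i m)) :
    iSupIndep (C.wt k) := by
  have h := Module.End.independent_iInf_maxGenEigenspace_of_forall_mapsTo k (fun i j φ => by
    apply Module.End.mapsTo_maxGenEigenspace_of_comm
    ext m; exact hk j i m)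
  have h2 := h.comp C.wt_ch_inj
  refine h2.mono ?_
  intro μ m hm
  simp only [Function.comp, Submodule.mem_iInf]
  intro i
  apply Module.End.mem_maxGenEigenspace _ _ _ |>.2
  refine ⟨1, ?_⟩
  simp [hm i]

/-- Sums of weight spaces. -/
theorem wt_mem_of_iSup (k : Fin n → Module.End ℂ M) (hk : ∀ i j m, k i (k j m) = k j (k i m))
    (P : (Fin n → ℤ) → Prop) {η : Fin n → ℤ} {m : M} (hm : m ∈ C.wt k η) (h0 : m ≠ 0)
    (hP : m ∈ ⨆ μ : {μ // P μ}, C.wt k μ.1) : P η := by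
  by_contra hη
  have h := C.wt_indep k hk η
  apply h0
  have hle : (⨆ μ : {μ // P μ}, C.wt k μ.1) ≤ ⨆ (j : Fin n → ℤ) (_ : j ≠ η), C.wt k j := by
    apply iSup_le
    rintro ⟨μ, hμ⟩
    refine le_iSup₂_of_le μ ?_ le_rfl
    rintro rfl; exact hη hμ
  exact (Submodule.mem_bot ℂ).1 (h.le_bot ⟨hm, hle hP⟩)

/-- Weights of a finite dimensional subspace are bounded. -/
theorem wt_bdd (k : Fin n → Module.End ℂ M) (hk : ∀ i j m, k i (k j m) = k j (k i m))
    (Z : Submodule ℂ M) [FiniteDimensional ℂ Z] (χ : (Fin n → ℤ) → ℤ) :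
    ∃ H, ∀ η, ∀ z ∈ Z, z ∈ C.wt k η → z ≠ 0 → χ η ≤ H := by
  have hind : iSupIndep (fun η => Submodule.comap Z.subtype (C.wt k η)) := by
    have h := (C.wt_indep k hk)
    intro η
    rw [disjoint_iff_inf_le]
    rintro ⟨z, hz⟩ ⟨h1, h2⟩
    have h3 : z ∈ ⨆ j, ⨆ (_ : j ≠ η), C.wt k j := by
      have : Submodule.map Z.subtype (⨆ j, ⨆ (_ : j ≠ η), Submodule.comap Z.subtype (C.wt k j)) ≤
          ⨆ j, ⨆ (_ : j ≠ η), C.wt k j := by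
        rw [Submodule.map_iSup]
        refine iSup_mono fun j => ?_
        rw [Submodule.map_iSup]
        refine iSup_mono fun _ => ?_
        exact Submodule.map_comap_le _ _
      exact this ⟨_, h2, rfl⟩
    have := (h η).le_bot ⟨h1, h3⟩
    simpa using this
  have hfin := WellFoundedGT.finite_ne_bot_of_iSupIndep hind
  have hb := (hfin.image χ).bddAbove
  obtain ⟨H, hH⟩ := hb
  refine ⟨H, fun η z hz hzη h0 => hH ⟨η, ?_, rfl⟩⟩
  intro hbot
  have : (⟨z, hz⟩ : Z) ∈ Submodule.comap Z.subtype (C.wt k η) := hzη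
  rw [hbot] at this
  apply h0
  simpa using this

/-- weight of a word -/
def wal (w : List (Fin n)) : Fin n → ℤ := (w.map C.al).sum

@[simp] theorem wal_nil : C.wal [] = 0 := by simp [wal]
@[simp] theorem wal_cons (i w) : C.wal (i :: w) = C.al i + C.wal w := by simp [wal]

theorem ph_zero : C.ph 0 = 0 := by
  have := C.ph_add 0 0
  simp at this; exact this

theorem ph_wal (w : List (Fin n)) : (w.length : ℤ) ≤ C.ph (C.wal w) := by
  induction w with
  | nil => simp [ph_zero]
  | cons i w ih => 
    rw [wal_cons, ph_add]
    have := C.ph_al i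
    simp; linarith

end CD

/-- word in operators -/
def wd {n : ℕ} {M : Type} [AddCommGroup M] [Module ℂ M] (D : Fin n → Module.End ℂ M)
    (w : List (Fin n)) : Module.End ℂ M := (w.map D).prod

section wd
variable {n : ℕ} {M : Type} [AddCommGroup M] [Module ℂ M] (D : Fin n → Module.End ℂ M)
@[simp] theorem wd_nil (m : M) : wd D [] m = m := by simp [wd]
@[simp] theorem wd_cons (i w) (m : M) : wd D (i :: w) m = D i (wd D w m) := by simp [wd]
theorem wd_append (w w') (m : M) : wd D (w ++ w') m = wd D w (wd D w' m) := by simp [wd]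
theorem wd_replicate (j : Fin n) (r : ℕ) : wd D (List.replicate r j) = D j ^ r := by simp [wd]
theorem wd_mem {D : Fin n → Module.End ℂ M} (N : Submodule ℂ M) (h : ∀ j, ∀ m ∈ N, D j m ∈ N)
    (w) {m : M} (hm : m ∈ N) : wd D w m ∈ N := by
  induction w with
  | nil => simpa
  | cons i w ih => rw [wd_cons]; exact h _ _ ih

/-- span of all words applied to a subspace -/
def spanW (G : Submodule ℂ M) : Submodule ℂ M := ⨆ w : List (Fin n), G.map (wd D w)

theorem wd_mem_spanW {G : Submodule ℂ M} (w) {g : M} (hg : g ∈ G) : wd D w g ∈ spanW D G :=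
  (le_iSup (fun w : List (Fin n) => G.map (wd D w)) w) ⟨g, hg, rfl⟩

theorem le_spanW (G : Submodule ℂ M) : G ≤ spanW D G := fun g hg => by
  simpa using wd_mem_spanW D [] hg

theorem spanW_le {D : Fin n → Module.End ℂ M} {G N : Submodule ℂ M} (h : ∀ w, ∀ g ∈ G, wd D w g ∈ N) : spanW D G ≤ N := by
  apply iSup_le
  rintro w _ ⟨g, hg, rfl⟩
  exact h w g hg

theorem spanW_stable (G : Submodule ℂ M) (j) : ∀ m ∈ spanW D G, D j m ∈ spanW D G := by
  have : spanW D G ≤ (spanW D G).comap (D j) := spanW_le fun w g hg => by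
    have := wd_mem_spanW D (j :: w) hg
    simpa using this
  exact this
end wd

namespace Tri
variable {n : ℕ} {C : CD n} {M : Type} [AddCommGroup M] [Module ℂ M]
  {X : G4 → Fin n → Module.End ℂ M} (T : Tri C X)
include T

theorem ki_wt {μ : Fin n → ℤ} {m : M} (hm : m ∈ C.wt (X .K) μ) (i) :
    X .Ki i m = C.q ^ (-(μ i * (C.d i : ℤ))) • m := by
  have h := T.kik i m
  rw [hm i, map_smul] at h
  rw [zpow_neg]
  rw [← h, smul_smul, inv_mul_cancel₀ (zpow_ne_zero _ C.q_ne), one_smul]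
  simpa using congrArg (X .Ki i) h

theorem kiki (i j m) : X .Ki i (X .Ki j m) = X .Ki j (X .Ki i m) := by
  have h : X .K j (X .K i (X .Ki i (X .Ki j m))) = X .K j (X .K i (X .Ki j (X .Ki i m))) := by
    rw [T.kki, T.kki, T.kk, T.kki, T.kki]
  have := congrArg (fun x => X .Ki i (X .Ki j x)) h
  simpa only [T.kik] using this

theorem kie (i j m) : X .Ki i (X .E j m) = C.q ^ (-((C.d i : ℤ) * C.a i j)) • X .E j (X .Ki i m) := by
  have h := T.ke i j (X .Ki i m)
  rw [T.kki] at h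
  have h2 := congrArg (X .Ki i) h
  rw [T.kik, map_smul] at h2
  rw [h2, smul_smul, ← zpow_add₀ C.q_ne]; simp

theorem kif (i j m) : X .Ki i (X .F j m) = C.q ^ ((C.d i : ℤ) * C.a i j) • X .F j (X .Ki i m) := by
  have h := T.kf i j (X .Ki i m)
  rw [T.kki] at h
  have h2 := congrArg (X .Ki i) h
  rw [T.kik, map_smul] at h2
  rw [h2, smul_smul, ← zpow_add₀ C.q_ne]; simp

theorem sw : Tri C (fun x => X x.sw) where
  kki := T.kik
  kik := T.kki
  kk := T.kiki
  ke := T.kif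
  kf := T.kie
  ef := by
    intro i j m
    simp only [G4.sw]
    have h := T.ef j i m
    rw [← neg_sub, h]
    by_cases hij : i = j
    · subst hij; simp [← smul_neg]
    · simp [hij, Ne.symm hij]

theorem mem_wt_ki {μ : Fin n → ℤ} {m : M} : m ∈ C.wt (X .Ki) μ ↔ m ∈ C.wt (X .K) (-μ) := by
  constructor
  · intro h i
    have := (T.sw).ki_wt (μ := μ) (m := m) h i
    simp only [G4.sw] at this
    rw [this]; simp
  · intro h i
    rw [T.ki_wt h]; simp

theorem wt_e {μ : Fin n → ℤ} {m : M} (hm : m ∈ C.wt (X .K) μ) (j) :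
    X .E j m ∈ C.wt (X .K) (μ + C.al j) := by
  intro i
  rw [T.ke, hm i, map_smul, smul_smul, ← zpow_add₀ C.q_ne]
  congr 2; simp [CD.al]; ring

theorem wt_f {μ : Fin n → ℤ} {m : M} (hm : m ∈ C.wt (X .K) μ) (j) :
    X .F j m ∈ C.wt (X .K) (μ - C.al j) := by
  intro i
  rw [T.kf, hm i, map_smul, smul_smul, ← zpow_add₀ C.q_ne]
  congr 2; simp [CD.al]; ring

theorem wt_we {μ : Fin n → ℤ} {m : M} (hm : m ∈ C.wt (X .K) μ) (w) :
    wd (X .E) w m ∈ C.wt (X .K) (μ + C.wal w) := by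
  induction w with
  | nil => simpa
  | cons i w ih =>
    rw [wd_cons, CD.wal_cons]
    have := T.wt_e ih i
    rwa [add_assoc, add_comm (C.wal w)] at this

theorem wt_wf {μ : Fin n → ℤ} {m : M} (hm : m ∈ C.wt (X .K) μ) (w) :
    wd (X .F) w m ∈ C.wt (X .K) (μ - C.wal w) := by
  induction w with
  | nil => simpa
  | cons i w ih =>
    rw [wd_cons, CD.wal_cons]
    have := T.wt_f ih i
    rwa [sub_sub, add_comm (C.wal w)] at this

theorem wt_epow {μ : Fin n → ℤ} {m : M} (hm : m ∈ C.wt (X .K) μ) (j) (r : ℕ) :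
    (X .E j ^ r) m ∈ C.wt (X .K) (μ + r • C.al j) := by
  have := T.wt_we hm (List.replicate r j)
  rw [wd_replicate] at this
  have h2 : C.wal (List.replicate r j) = r • C.al j := by simp [CD.wal]
  rwa [h2] at this

theorem wt_fpow {μ : Fin n → ℤ} {m : M} (hm : m ∈ C.wt (X .K) μ) (j) (r : ℕ) :
    (X .F j ^ r) m ∈ C.wt (X .K) (μ - r • C.al j) := by
  have := T.wt_wf hm (List.replicate r j)
  rw [wd_replicate] at this
  have h2 : C.wal (List.replicate r j) = r • C.al j := by simp [CD.wal]
  rwa [h2] at this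

/-- span of `f`-words over a `k,e`-stable subspace is stable -/
theorem spanW_f {G : Submodule ℂ M} (hk : ∀ i, ∀ g ∈ G, X .K i g ∈ G)
    (hki : ∀ i, ∀ g ∈ G, X .Ki i g ∈ G) (he : ∀ i, ∀ g ∈ G, X .E i g ∈ G) :
    ∀ x i, ∀ m ∈ spanW (X .F) G, X x i m ∈ spanW (X .F) G := by
  have hk' : ∀ w i, ∀ g ∈ G, X .K i (wd (X .F) w g) ∈ spanW (X .F) G := by
    intro w i g hg
    induction w with
    | nil => simpa using le_spanW _ _ (hk i g hg)
    | cons j w ih =>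
      rw [wd_cons, T.kf]
      exact Submodule.smul_mem _ _ (spanW_stable _ _ _ _ ih)
  have hki' : ∀ w i, ∀ g ∈ G, X .Ki i (wd (X .F) w g) ∈ spanW (X .F) G := by
    intro w i g hg
    induction w with
    | nil => simpa using le_spanW _ _ (hki i g hg)
    | cons j w ih =>
      rw [wd_cons, T.kif]
      exact Submodule.smul_mem _ _ (spanW_stable _ _ _ _ ih)
  have he' : ∀ w i, ∀ g ∈ G, X .E i (wd (X .F) w g) ∈ spanW (X .F) G := by
    intro w i g hg
    induction w with
    | nil => simpa using le_spanW _ _ (he i g hg)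
    | cons j w ih =>
      rw [wd_cons]
      have h := T.ef i j (wd (X .F) w g)
      rw [sub_eq_iff_eq_add] at h
      rw [h]
      refine Submodule.add_mem _ ?_ (spanW_stable _ _ _ _ ih)
      split_ifs
      · exact Submodule.smul_mem _ _ (Submodule.sub_mem _ (hk' _ _ _ hg) (hki' _ _ _ hg))
      · simp
  intro x i
  cases x
  · exact fun m hm => (spanW_le (N := (spanW (X .F) G).comap (X .E i)) fun w g hg => he' w i g hg) hm
  · exact spanW_stable _ _ _
  · exact fun m hm => (spanW_le (N := (spanW (X .F) G).comap (X .K i)) fun w g hg => hk' w i g hg) hm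
  · exact fun m hm => (spanW_le (N := (spanW (X .F) G).comap (X .Ki i)) fun w g hg => hki' w i g hg) hm

theorem spanW_e {G : Submodule ℂ M} (hk : ∀ i, ∀ g ∈ G, X .K i g ∈ G)
    (hki : ∀ i, ∀ g ∈ G, X .Ki i g ∈ G) (hf : ∀ i, ∀ g ∈ G, X .F i g ∈ G) :
    ∀ x i, ∀ m ∈ spanW (X .E) G, X x i m ∈ spanW (X .E) G := by
  intro x i
  have := T.sw.spanW_f (G := G) hki hk hf
  simp only [G4.sw] at this
  cases x
  · exact this .F i
  · exact this .E i
  · exact this .Ki i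
  · exact this .K i

/-- commutation formula on a highest weight vector -/
theorem e_fpow {μ : Fin n → ℤ} {u : M} (hu : u ∈ C.wt (X .K) μ) (j) (h0 : X .E j u = 0) (m : ℕ) :
    X .E j ((X .F j ^ (m + 1)) u) =
     (((C.q ^ (C.d j : ℤ)) ^ ((m : ℤ) + 1) - (C.q ^ (C.d j : ℤ)) ^ (-((m : ℤ) + 1))) *
      ((C.q ^ (C.d j : ℤ)) ^ (μ j - m) - (C.q ^ (C.d j : ℤ)) ^ (-(μ j - m))) *
      (C.q ^ (C.d j : ℤ) - C.q ^ (-(C.d j : ℤ)))⁻¹ ^ 2) • (X .F j ^ m) u := by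
  set Q := C.q ^ (C.d j : ℤ) with hQ
  have hQ0 : Q ≠ 0 := zpow_ne_zero _ C.q_ne
  have hQQ : C.q ^ (-(C.d j : ℤ)) = Q⁻¹ := by rw [zpow_neg]
  have hne : Q - Q⁻¹ ≠ 0 := by
    intro h
    have h1 : C.q ^ (C.d j : ℤ) = C.q ^ (-(C.d j : ℤ)) := by rw [hQQ]; exact sub_eq_zero.1 h
    have := C.qpow_inj h1
    have := C.d_pos j
    omega
  have key : ∀ m : ℕ, X .K j ((X .F j ^ m) u) - X .Ki j ((X .F j ^ m) u) =
      (Q ^ (μ j - 2 * m) - Q ^ (-(μ j - 2 * m))) • (X .F j ^ m) u := by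
    intro m
    have hw := T.wt_fpow hu j m
    rw [hw j, T.ki_wt hw j, ← sub_smul, hQ]
    simp only [← zpow_mul]
    have e1 : (μ - m • C.al j) j * (C.d j : ℤ) = (C.d j : ℤ) * (μ j - 2 * m) := by
      simp [CD.al, C.a_diag]; ring
    rw [e1, mul_neg]
  rw [hQQ]
  induction m with
  | zero =>
    have h := T.ef j j u
    rw [h0, map_zero, sub_zero, if_pos rfl] at h
    have := key 0
    simp only [pow_zero, Module.End.one_apply] at this
    simp only [zero_add, pow_one]
    rw [h, this, smul_smul, hQQ, ← hQ]
    simp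
    congr 1
    rw [pow_two]
    field_simp
  | succ m ih =>
    have h := T.ef j j ((X .F j ^ (m + 1)) u)
    rw [if_pos rfl, key, sub_eq_iff_eq_add, ih, hQQ, map_smul, ← hQ] at h
    rw [pow_succ' (X .F j) (m + 1), Module.End.mul_apply, h, ← Module.End.mul_apply (X .F j),
      ← pow_succ', smul_smul, ← add_smul]
    congr 1
    have e1 : Q ^ (μ j - 2 * ((m + 1 : ℕ) : ℤ)) = Q ^ μ j * (Q ^ (m : ℤ))⁻¹ * (Q ^ (m : ℤ))⁻¹ * Q⁻¹ * Q⁻¹ := by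
      rw [← zpow_neg, ← zpow_neg_one, ← zpow_add₀ hQ0, ← zpow_add₀ hQ0, ← zpow_add₀ hQ0, ← zpow_add₀ hQ0]
      congr 1; push_cast; ring
    have e2 : Q ^ (μ j - (m : ℤ)) = Q ^ μ j * (Q ^ (m : ℤ))⁻¹ := by
      rw [zpow_sub₀ hQ0]; rfl
    have e3 : Q ^ (μ j - ((m + 1 : ℕ) : ℤ)) = Q ^ μ j * (Q ^ (m : ℤ))⁻¹ * Q⁻¹ := by
      rw [← zpow_neg, ← zpow_neg_one, ← zpow_add₀ hQ0, ← zpow_add₀ hQ0]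
      congr 1; push_cast; ring
    have e4 : Q ^ ((m : ℤ) + 1) = Q ^ (m : ℤ) * Q := by rw [zpow_add_one₀ hQ0]
    have e5 : Q ^ (((m + 1 : ℕ) : ℤ) + 1) = Q ^ (m : ℤ) * Q * Q := by
      rw [zpow_add_one₀ hQ0]; push_cast; rw [zpow_add_one₀ hQ0]
    rw [zpow_neg, zpow_neg, zpow_neg, zpow_neg, zpow_neg, e1, e2, e3, e4, e5]
    have hm : Q ^ (m : ℤ) ≠ 0 := zpow_ne_zero _ hQ0
    have hμ : Q ^ μ j ≠ 0 := zpow_ne_zero _ hQ0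
    generalize Q ^ (m : ℤ) = Y at *
    generalize Q ^ μ j = Z at *
    have hne2 : Q ^ 2 - 1 ≠ 0 := by
      intro h; apply hne; field_simp; rw [h]; simp
    field_simp
    ring

omit T in
theorem qint_ne (C : CD n) (j) {x : ℤ} (hx : x ≠ 0) :
    (C.q ^ (C.d j : ℤ)) ^ x - (C.q ^ (C.d j : ℤ)) ^ (-x) ≠ 0 := by
  intro h
  rw [← zpow_mul, ← zpow_mul] at h
  have := C.qpow_inj (sub_eq_zero.1 h)
  have h2 := C.d_pos j
  have : (C.d j : ℤ) * x = 0 := by linarith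
  rcases mul_eq_zero.1 this with h | h
  · omega
  · exact hx h

omit T in
theorem fpow_coef_ne (C : CD n) (μ : Fin n → ℤ) (j) (m : ℕ) (h : μ j ≠ m) :
    (((C.q ^ (C.d j : ℤ)) ^ ((m : ℤ) + 1) - (C.q ^ (C.d j : ℤ)) ^ (-((m : ℤ) + 1))) *
      ((C.q ^ (C.d j : ℤ)) ^ (μ j - m) - (C.q ^ (C.d j : ℤ)) ^ (-(μ j - m))) *
      (C.q ^ (C.d j : ℤ) - C.q ^ (-(C.d j : ℤ)))⁻¹ ^ 2) ≠ 0 := by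
  refine mul_ne_zero (mul_ne_zero (qint_ne C j (by omega)) (qint_ne C j (sub_ne_zero.2 h))) ?_
  apply pow_ne_zero
  apply inv_ne_zero
  have := qint_ne C j (x := 1) one_ne_zero
  simpa using this

omit T in
/-- extract the last nonzero power -/
theorem exists_top (D : Module.End ℂ M) {m : M} (h0 : m ≠ 0) (hN : ∃ N, (D ^ N) m = 0) :
    ∃ r, (D ^ r) m ≠ 0 ∧ D ((D ^ r) m) = 0 := by
  classical
  have hpos : Nat.find hN ≠ 0 := by
    intro h
    have := Nat.find_spec hN
    rw [h] at this
    exact h0 (by simpa using this)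
  obtain ⟨r, hr⟩ := Nat.exists_eq_succ_of_ne_zero hpos
  refine ⟨r, Nat.find_min hN (by omega), ?_⟩
  have := Nat.find_spec hN
  rw [hr, Nat.succ_eq_add_one, pow_succ', Module.End.mul_apply] at this
  exact this

/-- highest weight vector with nilpotent `f` : weight dominant and exact string length. -/
theorem hw_dom {μ : Fin n → ℤ} {u : M} (hu : u ∈ C.wt (X .K) μ) (j) (h0 : X .E j u = 0)
    (hne : u ≠ 0) (hN : ∃ N, (X .F j ^ N) u = 0) :
    0 ≤ μ j ∧ ∀ r : ℕ, μ j < r → (X .F j ^ r) u = 0 := by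
  obtain ⟨r, hr1, hr2⟩ := exists_top (X .F j) hne hN
  have h := T.e_fpow hu j h0 r
  rw [pow_succ', Module.End.mul_apply, hr2, map_zero] at h
  have hh : μ j = r := by
    by_contra hc
    exact (smul_ne_zero (fpow_coef_ne C μ j r hc) hr1) h.symm
  refine ⟨by omega, fun k hk => ?_⟩
  obtain ⟨t, rfl⟩ : ∃ t, k = t + (r + 1) := ⟨k - (r + 1), by omega⟩
  rw [pow_add, Module.End.mul_apply, pow_succ' _ r, Module.End.mul_apply, hr2, map_zero]

/-- reflecting weights, positive case -/
theorem refl_pos {μ : Fin n → ℤ} {m : M} (hm : m ∈ C.wt (X .K) μ) (h0 : m ≠ 0) (j)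
    (hμ : 0 ≤ μ j) (hN : ∃ N, (X .E j ^ N) m = 0) :
    ∃ r t : ℕ, (X .F j ^ t) ((X .E j ^ r) m) ≠ 0 ∧
      (X .F j ^ t) ((X .E j ^ r) m) ∈ C.wt (X .K) (C.act (C.s j) μ) := by
  obtain ⟨r, hr1, hr2⟩ := exists_top (X .E j) h0 hN
  have hw := T.wt_epow hm j r
  have hs : ∀ t : ℕ, (t : ℤ) ≤ μ j + 2 * r → (X .F j ^ t) ((X .E j ^ r) m) ≠ 0 := by
    intro t
    induction t with
    | zero => intro _; simpa using hr1
    | succ t ih =>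
      intro ht hz
      have h := T.e_fpow hw j hr2 t
      rw [hz, map_zero] at h
      refine (smul_ne_zero (fpow_coef_ne C _ j t ?_) (ih (by push_cast at ht; omega))) h.symm
      simp [CD.al, C.a_diag]; push_cast at ht; omega
  refine ⟨r, (μ j).toNat + r, hs _ (by push_cast; omega), ?_⟩
  have := T.wt_fpow hw j ((μ j).toNat + r)
  have e : C.act (C.s j) μ = μ + r • C.al j - ((μ j).toNat + r) • C.al j := by
    rw [C.s_act']
    ext k
    have : ((μ j).toNat : ℤ) = μ j := Int.toNat_of_nonneg hμ
    simp only [Pi.sub_apply, Pi.add_apply, Pi.smul_apply, smul_eq_mul]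
    rw [nsmul_eq_mul, nsmul_eq_mul]
    push_cast [this]; ring
  rw [e]; exact this

theorem refl_neg {μ : Fin n → ℤ} {m : M} (hm : m ∈ C.wt (X .K) μ) (h0 : m ≠ 0) (j)
    (hμ : μ j ≤ 0) (hN : ∃ N, (X .F j ^ N) m = 0) :
    ∃ r t : ℕ, (X .E j ^ t) ((X .F j ^ r) m) ≠ 0 ∧
      (X .E j ^ t) ((X .F j ^ r) m) ∈ C.wt (X .K) (C.act (C.s j) μ) := by
  have hm' : m ∈ C.wt (X .Ki) (-μ) := T.mem_wt_ki.2 (by simpa using hm)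
  obtain ⟨r, t, h1, h2⟩ := T.sw.refl_pos (μ := -μ) hm' h0 j (by simpa using hμ) hN
  simp only [G4.sw] at h1 h2
  refine ⟨r, t, h1, ?_⟩
  have := T.mem_wt_ki.1 h2
  simpa using this

/-- A stable subspace with locally nilpotent operators has Weyl-invariant weights. -/
theorem wt_inv (L : Submodule ℂ M) (hL : ∀ x i, ∀ m ∈ L, X x i m ∈ L)
    (he : ∀ m ∈ L, ∀ j, ∃ N, (X .E j ^ N) m = 0) (hf : ∀ m ∈ L, ∀ j, ∃ N, (X .F j ^ N) m = 0)
    (w : C.W) (μ : Fin n → ℤ) (h : ∃ m ∈ L, m ≠ 0 ∧ m ∈ C.wt (X .K) μ) :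
    ∃ m ∈ L, m ≠ 0 ∧ m ∈ C.wt (X .K) (C.act w μ) := by
  have hpow : ∀ x i (r : ℕ), ∀ m ∈ L, (X x i ^ r) m ∈ L := by
    intro x i r m hm
    induction r with
    | zero => simpa
    | succ r ih => rw [pow_succ', Module.End.mul_apply]; exact hL _ _ _ ih
  have hstep : ∀ j μ, (∃ m ∈ L, m ≠ 0 ∧ m ∈ C.wt (X .K) μ) →
      ∃ m ∈ L, m ≠ 0 ∧ m ∈ C.wt (X .K) (C.act (C.s j) μ) := by
    rintro j μ ⟨m, hm, h0, hw⟩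
    rcases le_total 0 (μ j) with hμ | hμ
    · obtain ⟨r, t, h1, h2⟩ := T.refl_pos hw h0 j hμ (he m hm j)
      exact ⟨_, hpow _ _ _ _ (hpow _ _ _ _ hm), h1, h2⟩
    · obtain ⟨r, t, h1, h2⟩ := T.refl_neg hw h0 j hμ (hf m hm j)
      exact ⟨_, hpow _ _ _ _ (hpow _ _ _ _ hm), h1, h2⟩
  have hinv : ∀ j μ, (∃ m ∈ L, m ≠ 0 ∧ m ∈ C.wt (X .K) μ) →
      ∃ m ∈ L, m ≠ 0 ∧ m ∈ C.wt (X .K) (C.act (C.s j)⁻¹ μ) := by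
    intro j μ hh
    have : C.act (C.s j)⁻¹ μ = C.act (C.s j) μ := by
      have h2 : C.act (C.s j) (C.act (C.s j) μ) = μ := by
        rw [C.s_act', C.s_act']; ext k; simp [CD.al, C.a_diag]; ring
      conv_lhs => rw [← h2]
      rw [C.act_inv_act]
    rw [this]; exact hstep j μ hh
  have hw : w ∈ Subgroup.closure (Set.range C.s) := by rw [C.s_gen]; trivial
  revert μ
  induction hw using Subgroup.closure_induction with
  | mem x hx => obtain ⟨j, rfl⟩ := hx; exact hstep j
  | one => intro μ h; simpa [C.act_one] using h
  | mul x y _ _ hx hy => intro μ h; rw [C.act_mul]; exact hx _ (hy _ h)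
  | inv x _ hx =>
    intro μ h
    have hN : 0 < orderOf x := orderOf_pos _
    have hp : ∀ k : ℕ, ∃ m ∈ L, m ≠ 0 ∧ m ∈ C.wt (X .K) (C.act (x ^ k) μ) := by
      intro k
      induction k with
      | zero => simpa [C.act_one] using h
      | succ k ih => rw [pow_succ', C.act_mul]; exact hx _ ih
    have h1 : x ^ (orderOf x - 1) = x⁻¹ := by
      rw [eq_inv_iff_mul_eq_one, ← pow_succ]
      have : orderOf x - 1 + 1 = orderOf x := by omega
      rw [this, pow_orderOf_eq_one]
    rw [← h1]; exact hp _

/-- words in `e` are nilpotent on weight vectors of finite dimensional stable subspaces -/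
theorem we_nil (Z : Submodule ℂ M) [FiniteDimensional ℂ Z] (hZ : ∀ j, ∀ m ∈ Z, X .E j m ∈ Z)
    {μ : Fin n → ℤ} {m : M} (hm : m ∈ Z) (hw : m ∈ C.wt (X .K) μ) :
    ∃ N : ℕ, ∀ w : List (Fin n), N ≤ w.length → wd (X .E) w m = 0 := by
  obtain ⟨H, hH⟩ := C.wt_bdd (X .K) T.kk Z C.ph
  refine ⟨(H - C.ph μ + 1).toNat, fun w hl => ?_⟩
  by_contra h0
  have h1 := hH _ _ (wd_mem Z hZ w hm) (T.wt_we hw w) h0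
  rw [C.ph_add] at h1
  have := C.ph_wal w
  omega

theorem wf_nil (Z : Submodule ℂ M) [FiniteDimensional ℂ Z] (hZ : ∀ j, ∀ m ∈ Z, X .F j m ∈ Z)
    {μ : Fin n → ℤ} {m : M} (hm : m ∈ Z) (hw : m ∈ C.wt (X .K) μ) :
    ∃ N : ℕ, ∀ w : List (Fin n), N ≤ w.length → wd (X .F) w m = 0 := by
  have hm' : m ∈ C.wt (X .Ki) (-μ) := T.mem_wt_ki.2 (by simpa using hw)
  exact T.sw.we_nil Z hZ hm hm'

end Tri
open scoped TensorProduct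

structure QD (n : ℕ) (A : Type) [Ring A] [Algebra ℂ A] extends CD n where
  I : Type
  V : I → Type
  [vacg : ∀ i, AddCommGroup (V i)]
  [vmod : ∀ i, Module ℂ (V i)]
  [vfd : ∀ i, FiniteDimensional ℂ (V i)]
  hw : I → Fin n → ℤ
  hw_nonneg : ∀ i j, 0 ≤ hw i j
  hw_surj : ∀ μ : Fin n → ℤ, (∀ i, 0 ≤ μ i) → ∃ i, hw i = μ
  X : ∀ i, G4 → Fin n → Module.End ℂ (V i)
  X_tri : ∀ i, Tri toCD (X i)
  X_simple : ∀ i (N : Submodule ℂ (V i)), (∀ x j, ∀ v ∈ N, X i x j v ∈ N) → N = ⊥ ∨ N = ⊤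
  X_hw : ∀ i, ∃ v : V i, v ≠ 0 ∧ v ∈ toCD.wt (X i .K) (hw i) ∧ ∀ j, X i .E j v = 0
  l : G4 → Fin n → Module.End ℂ A
  r : G4 → Fin n → Module.End ℂ A
  l_tri : Tri toCD l
  r_tri : Tri toCD (fun x => r x.tw)
  lr : ∀ x y i j m, l x i (r y j m) = r y j (l x i m)
  lE_mul : ∀ i x y, l .E i (x * y) = l .E i x * y + l .K i x * l .E i y
  lF_mul : ∀ i x y, l .F i (x * y) = l .F i x * l .Ki i y + x * l .F i y
  lK_mul : ∀ i x y, l .K i (x * y) = l .K i x * l .K i y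
  rE_mul : ∀ i x y, r .E i (x * y) = r .E i x * y + r .K i x * r .E i y
  rF_mul : ∀ i x y, r .F i (x * y) = r .F i x * r .Ki i y + x * r .F i y
  rK_mul : ∀ i x y, r .K i (x * y) = r .K i x * r .K i y
  lE_one : ∀ i, l .E i 1 = 0
  lF_one : ∀ i, l .F i 1 = 0
  lK_one : ∀ i, l .K i 1 = 1
  rE_one : ∀ i, r .E i 1 = 0
  rF_one : ∀ i, r .F i 1 = 0
  rK_one : ∀ i, r .K i 1 = 1
  cf : ∀ i, Module.Dual ℂ (V i) →ₗ[ℂ] V i →ₗ[ℂ] A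
  l_cf : ∀ i x j ξ v, l x j (cf i ξ v) = cf i ξ (X i x j v)
  r_cf : ∀ i x j ξ v, r x j (cf i ξ v) = cf i (ξ ∘ₗ X i x j) v
  eps : A →ₐ[ℂ] ℂ
  eps_cf : ∀ i ξ v, eps (cf i ξ v) = ξ v
  eps_lr : ∀ x j m, eps (l x j m) = eps (r x j m)
  sep : ∀ N : Submodule ℂ A, (∀ x j, ∀ m ∈ N, l x j m ∈ N) → (∀ m ∈ N, eps m = 0) → N = ⊥
  gen : Algebra.adjoin ℂ {x : A | ∃ i ξ v, x = cf i ξ v} = ⊤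

attribute [instance] QD.vacg QD.vmod QD.vfd

/-- dual operators -/
def dualOp {n : ℕ} {M : Type} [AddCommGroup M] [Module ℂ M] (X : G4 → Fin n → Module.End ℂ M) :
    G4 → Fin n → Module.End ℂ (Module.Dual ℂ M) := fun x i => (X x i).dualMap

theorem Tri.dual {n : ℕ} {C : CD n} {M : Type} [AddCommGroup M] [Module ℂ M]
    {X : G4 → Fin n → Module.End ℂ M} (T : Tri C X) : Tri C (fun x => dualOp X x.tw) where
  kki := by intro i m; ext v; simp [dualOp, G4.tw, T.kik]
  kik := by intro i m; ext v; simp [dualOp, G4.tw, T.kki]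
  kk := by intro i j m; ext v; simp [dualOp, G4.tw, T.kk i j]
  ke := by
    intro i j m; ext v
    simp only [dualOp, G4.tw, LinearMap.dualMap_apply, LinearMap.smul_apply]
    rw [T.kf i j, map_smul, smul_smul, ← zpow_add₀ C.q_ne]; simp
  kf := by
    intro i j m; ext v
    simp only [dualOp, G4.tw, LinearMap.dualMap_apply, LinearMap.smul_apply]
    rw [T.ke i j, map_smul, smul_smul, ← zpow_add₀ C.q_ne]; simp
  ef := by
    intro i j m; ext v
    simp only [dualOp, G4.tw, LinearMap.dualMap_apply, LinearMap.sub_apply]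
    rw [← map_sub, T.ef j i]
    by_cases h : i = j
    · subst h; simp [LinearMap.dualMap_apply]
    · simp [h, Ne.symm h]

namespace QD
variable {n : ℕ} {A : Type} [Ring A] [Algebra ℂ A] (D : QD n A) (i : D.I)

/-- a functional supported on the weight `μ` -/
def supp (μ : Fin n → ℤ) (ξ : Module.Dual ℂ (D.V i)) : Prop :=
  ∀ ν, ν ≠ μ → ∀ x ∈ D.wt (D.X i .K) ν, ξ x = 0

noncomputable def vhi : D.V i := (D.X_hw i).choose
theorem vhi_ne : D.vhi i ≠ 0 := (D.X_hw i).choose_spec.1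
theorem vhi_wt : D.vhi i ∈ D.wt (D.X i .K) (D.hw i) := (D.X_hw i).choose_spec.2.1
theorem vhi_e (j) : D.X i .E j (D.vhi i) = 0 := (D.X_hw i).choose_spec.2.2 j

omit [Ring A] [Algebra ℂ A] in
theorem _root_.span_wt_stable {C : CD n} {M : Type} [AddCommGroup M] [Module ℂ M]
    {k : Fin n → Module.End ℂ M} {μ : Fin n → ℤ} {m : M} (hm : m ∈ C.wt k μ) (j : Fin n) :
    ∀ g ∈ Submodule.span ℂ {m}, k j g ∈ Submodule.span ℂ {m} := by
  intro g hg
  obtain ⟨c, rfl⟩ := Submodule.mem_span_singleton.1 hg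
  rw [map_smul, hm j, smul_smul]
  exact Submodule.smul_mem _ _ (Submodule.mem_span_singleton_self _)

omit [Ring A] [Algebra ℂ A] in
theorem _root_.span_zero_stable {M : Type} [AddCommGroup M] [Module ℂ M]
    {e : Module.End ℂ M} {m : M} (hm : e m = 0) :
    ∀ g ∈ Submodule.span ℂ {m}, e g ∈ Submodule.span ℂ {m} := by
  intro g hg
  obtain ⟨c, rfl⟩ := Submodule.mem_span_singleton.1 hg
  rw [map_smul, hm]; simp

/-- the span of `f`-words on a singular vector is everything -/
theorem spanF_top {μ : Fin n → ℤ} {v : D.V i} (h0 : v ≠ 0) (hw : v ∈ D.wt (D.X i .K) μ)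
    (he : ∀ j, D.X i .E j v = 0) : spanW (D.X i .F) (Submodule.span ℂ {v}) = ⊤ := by
  have T := D.X_tri i
  have hst := T.spanW_f (G := Submodule.span ℂ {v}) (span_wt_stable hw)
    (span_wt_stable (μ := -μ) (T.mem_wt_ki.2 (by simpa using hw))) (fun j => span_zero_stable (he j))
  rcases D.X_simple i _ hst with h | h
  · exfalso
    have := le_spanW (D.X i .F) _ (Submodule.mem_span_singleton_self v)
    rw [h] at this
    exact h0 (by simpa using this)
  · exact h

theorem spanE_top {μ : Fin n → ℤ} {v : D.V i} (h0 : v ≠ 0) (hw : v ∈ D.wt (D.X i .K) μ)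
    (he : ∀ j, D.X i .F j v = 0) : spanW (D.X i .E) (Submodule.span ℂ {v}) = ⊤ := by
  have T := D.X_tri i
  have hst := T.spanW_e (G := Submodule.span ℂ {v}) (span_wt_stable hw)
    (span_wt_stable (μ := -μ) (T.mem_wt_ki.2 (by simpa using hw))) (fun j => span_zero_stable (he j))
  rcases D.X_simple i _ hst with h | h
  · exfalso
    have := le_spanW (D.X i .E) _ (Submodule.mem_span_singleton_self v)
    rw [h] at this
    exact h0 (by simpa using this)
  · exact h

/-- a property closed under linear combination holding on `f`-words of `vhi` holds everywhere -/
theorem V_le_P : (⨆ μ : {μ : Fin n → ℤ // D.ph μ ≤ D.ph (D.hw i)}, D.wt (D.X i .K) μ.1) = ⊤ := by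
  rw [eq_top_iff, ← D.spanF_top i (D.vhi_ne i) (D.vhi_wt i) (D.vhi_e i)]
  refine spanW_le fun w g hg => ?_
  obtain ⟨c, rfl⟩ := Submodule.mem_span_singleton.1 hg
  have := (D.X_tri i).wt_wf (Submodule.smul_mem _ c (D.vhi_wt i)) w
  refine (le_iSup (fun μ : {μ : Fin n → ℤ // D.ph μ ≤ D.ph (D.hw i)} => D.wt (D.X i .K) μ.1)
    ⟨_, ?_⟩) this
  rw [D.ph_sub]
  have := D.ph_wal w
  omega

theorem V_wt_top : (⨆ μ : Fin n → ℤ, D.wt (D.X i .K) μ) = ⊤ := by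
  rw [eq_top_iff, ← D.V_le_P i]
  exact iSup_le fun μ => le_iSup (fun μ => D.wt (D.X i .K) μ) μ.1

theorem V_ph_le {μ : Fin n → ℤ} {v : D.V i} (h0 : v ≠ 0) (hw : v ∈ D.wt (D.X i .K) μ) :
    D.ph μ ≤ D.ph (D.hw i) :=
  D.wt_mem_of_iSup (D.X i .K) (D.X_tri i).kk (fun μ => D.ph μ ≤ D.ph (D.hw i)) hw h0
    (by rw [D.V_le_P i]; trivial)

theorem V_nil_aux (Y : G4 → Fin n → Module.End ℂ (D.V i)) (T : Tri D.toCD Y)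
    (htop : (⨆ μ : Fin n → ℤ, D.wt (Y .K) μ) = ⊤) (v : D.V i) (j) :
    ∃ N, (Y .E j ^ N) v = 0 := by
  have hv : v ∈ (⨆ μ : Fin n → ℤ, D.wt (Y .K) μ) := by rw [htop]; trivial
  induction hv using Submodule.iSup_induction' with
  | mem μ x hx =>
    obtain ⟨N, hN⟩ := T.we_nil ⊤ (fun _ _ _ => trivial) (m := x) trivial hx
    refine ⟨N, ?_⟩
    rw [← wd_replicate]; exact hN _ (by simp)
  | zero => exact ⟨0, by simp⟩
  | add x y _ _ hx hy =>
    obtain ⟨N, hN⟩ := hx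
    obtain ⟨M, hM⟩ := hy
    refine ⟨N + M, ?_⟩
    rw [map_add]
    have h1 : (Y .E j ^ (N + M)) x = 0 := by
      rw [add_comm, pow_add, Module.End.mul_apply, hN, map_zero]
    have h2 : (Y .E j ^ (N + M)) y = 0 := by
      rw [pow_add, Module.End.mul_apply, hM, map_zero]
    rw [h1, h2, add_zero]

theorem V_nilE (v : D.V i) (j) : ∃ N, (D.X i .E j ^ N) v = 0 :=
  D.V_nil_aux i (D.X i) (D.X_tri i) (D.V_wt_top i) v j

theorem V_nilF (v : D.V i) (j) : ∃ N, (D.X i .F j ^ N) v = 0 := by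
  refine D.V_nil_aux i _ (D.X_tri i).sw ?_ v j
  rw [eq_top_iff, ← D.V_wt_top i]
  refine iSup_le fun μ x hx => ?_
  refine (le_iSup (fun μ => D.wt (D.X i .Ki) μ) (-μ)) ?_
  exact (D.X_tri i).mem_wt_ki.2 (by simpa using hx)

theorem V_wt_inv (w : D.W) (μ : Fin n → ℤ) (h : ∃ v : D.V i, v ≠ 0 ∧ v ∈ D.wt (D.X i .K) μ) :
    ∃ v : D.V i, v ≠ 0 ∧ v ∈ D.wt (D.X i .K) (D.act w μ) := by
  have := (D.X_tri i).wt_inv ⊤ (fun _ _ _ _ => trivial) (fun m _ j => D.V_nilE i m j)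
    (fun m _ j => D.V_nilF i m j) w μ (by obtain ⟨v, h⟩ := h; exact ⟨v, trivial, h⟩)
  obtain ⟨v, _, h⟩ := this
  exact ⟨v, h⟩

theorem wt_hw_add {v : D.V i} (j) (h : v ∈ D.wt (D.X i .K) (D.hw i + D.al j)) : v = 0 := by
  by_contra h0
  have := D.V_ph_le i h0 h
  rw [D.ph_add] at this
  have := D.ph_al j
  omega

theorem wt_low_sub {v : D.V i} (j) (h : v ∈ D.wt (D.X i .K) (D.act D.w0 (D.hw i) - D.al j)) : v = 0 := by
  by_contra h0
  obtain ⟨u, hu0, hu⟩ := D.V_wt_inv i D.w0⁻¹ _ ⟨v, h0, h⟩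
  have := D.V_ph_le i hu0 hu
  rw [map_sub, D.act_inv_act, D.ph_sub] at this
  have := D.ph_w0_inv_al j
  omega

theorem hi_e {v : D.V i} (h : v ∈ D.wt (D.X i .K) (D.hw i)) (j) : D.X i .E j v = 0 :=
  D.wt_hw_add i j ((D.X_tri i).wt_e h j)

theorem low_f {v : D.V i} (h : v ∈ D.wt (D.X i .K) (D.act D.w0 (D.hw i))) (j) : D.X i .F j v = 0 :=
  D.wt_low_sub i j ((D.X_tri i).wt_f h j)

theorem exists_low : ∃ v : D.V i, v ≠ 0 ∧ v ∈ D.wt (D.X i .K) (D.act D.w0 (D.hw i)) ∧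
    ∀ j, D.X i .F j v = 0 := by
  obtain ⟨v, h0, h⟩ := D.V_wt_inv i D.w0 _ ⟨_, D.vhi_ne i, D.vhi_wt i⟩
  exact ⟨v, h0, h, D.low_f i h⟩

noncomputable def vlo : D.V i := (D.exists_low i).choose
theorem vlo_ne : D.vlo i ≠ 0 := (D.exists_low i).choose_spec.1
theorem vlo_wt : D.vlo i ∈ D.wt (D.X i .K) (D.act D.w0 (D.hw i)) := (D.exists_low i).choose_spec.2.1
theorem vlo_f (j) : D.X i .F j (D.vlo i) = 0 := (D.exists_low i).choose_spec.2.2 j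

theorem dual_ext {ξ ζ : Module.Dual ℂ (D.V i)}
    (h : ∀ μ, ∀ x ∈ D.wt (D.X i .K) μ, ξ x = ζ x) : ξ = ζ := by
  ext v
  have hv : v ∈ (⨆ μ : Fin n → ℤ, D.wt (D.X i .K) μ) := by rw [D.V_wt_top]; trivial
  induction hv using Submodule.iSup_induction' with
  | mem μ x hx => exact h μ x hx
  | zero => simp
  | add x y _ _ hx hy => simp [hx, hy]

theorem supp_low_e {ξ : Module.Dual ℂ (D.V i)} (h : D.supp i (D.act D.w0 (D.hw i)) ξ) (j) :
    ξ ∘ₗ D.X i .E j = 0 := by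
  refine D.dual_ext i fun μ x hx => ?_
  have hx' := (D.X_tri i).wt_e hx j
  simp only [LinearMap.comp_apply, LinearMap.zero_apply]
  by_cases hμ : μ + D.al j = D.act D.w0 (D.hw i)
  · have : x = 0 := D.wt_low_sub i j (by rw [← hμ]; simpa using hx)
    simp [this]
  · exact h _ hμ _ hx'

theorem supp_hi_f {ξ : Module.Dual ℂ (D.V i)} (h : D.supp i (D.hw i) ξ) (j) :
    ξ ∘ₗ D.X i .F j = 0 := by
  refine D.dual_ext i fun μ x hx => ?_
  have hx' := (D.X_tri i).wt_f hx j
  simp only [LinearMap.comp_apply, LinearMap.zero_apply]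
  by_cases hμ : μ - D.al j = D.hw i
  · have : x = 0 := D.wt_hw_add i j (by rw [← hμ]; simpa using hx)
    simp [this]
  · exact h _ hμ _ hx'

/-- weight of a functional for the dual operators -/
theorem supp_iff {μ : Fin n → ℤ} {ξ : Module.Dual ℂ (D.V i)} :
    D.supp i μ ξ ↔ ξ ∈ D.wt (dualOp (D.X i) .K) μ := by
  constructor
  · intro h j
    refine D.dual_ext i fun ν x hx => ?_
    simp only [dualOp, LinearMap.dualMap_apply, LinearMap.smul_apply, hx j, map_smul]
    by_cases hν : ν = μ
    · rw [hν]
    · rw [h ν hν x hx]; simp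
  · intro h ν hν x hx
    by_contra h0
    apply hν
    apply D.wt_ch_inj
    ext j
    have := congrArg (fun ζ => ζ x) (h j)
    simp only [dualOp, LinearMap.dualMap_apply, LinearMap.smul_apply, hx j, map_smul, smul_eq_mul] at this
    exact mul_right_cancel₀ h0 this

theorem exists_dual {μ : Fin n → ℤ} {v : D.V i} (h0 : v ≠ 0) (hw : v ∈ D.wt (D.X i .K) μ) :
    ∃ ξ, D.supp i μ ξ ∧ ξ v = 1 := by
  have hnot : v ∉ ⨆ (j : Fin n → ℤ) (_ : j ≠ μ), D.wt (D.X i .K) j := by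
    intro h
    have hi := D.wt_indep (D.X i .K) (D.X_tri i).kk μ
    exact h0 ((Submodule.mem_bot ℂ).1 (hi.le_bot ⟨hw, h⟩))
  obtain ⟨f, hf1, hf2⟩ := Submodule.exists_le_ker_of_notMem hnot
  refine ⟨(f v)⁻¹ • f, ?_, ?_⟩
  · intro ν hν x hx
    have : x ∈ LinearMap.ker f := hf2 (le_iSup₂ (f := fun (j : Fin n → ℤ) (_ : j ≠ μ) => D.wt (D.X i .K) j) ν hν hx)
    have : f x = 0 := this
    simp [this]
  · simp [hf1]

noncomputable def xhi : Module.Dual ℂ (D.V i) := (D.exists_dual i (D.vhi_ne i) (D.vhi_wt i)).choose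
theorem xhi_supp : D.supp i (D.hw i) (D.xhi i) :=
  (D.exists_dual i (D.vhi_ne i) (D.vhi_wt i)).choose_spec.1
theorem xhi_vhi : D.xhi i (D.vhi i) = 1 :=
  (D.exists_dual i (D.vhi_ne i) (D.vhi_wt i)).choose_spec.2
theorem xhi_ne : D.xhi i ≠ 0 := by
  intro h; have := D.xhi_vhi i; rw [h] at this; simp at this

noncomputable def xlo : Module.Dual ℂ (D.V i) := (D.exists_dual i (D.vlo_ne i) (D.vlo_wt i)).choose
theorem xlo_supp : D.supp i (D.act D.w0 (D.hw i)) (D.xlo i) :=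
  (D.exists_dual i (D.vlo_ne i) (D.vlo_wt i)).choose_spec.1
theorem xlo_vlo : D.xlo i (D.vlo i) = 1 :=
  (D.exists_dual i (D.vlo_ne i) (D.vlo_wt i)).choose_spec.2
theorem xlo_ne : D.xlo i ≠ 0 := by
  intro h; have := D.xlo_vlo i; rw [h] at this; simp at this

/-- the dual is simple -/
theorem dual_simple (N : Submodule ℂ (Module.Dual ℂ (D.V i)))
    (hN : ∀ x j, ∀ ξ ∈ N, dualOp (D.X i) x j ξ ∈ N) (h : ∃ ξ ∈ N, ξ ≠ 0) : N = ⊤ := by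
  rcases D.X_simple i N.dualCoannihilator (by
    intro x j v hv
    rw [Submodule.mem_dualCoannihilator] at hv ⊢
    intro φ hφ
    exact hv _ (hN x j φ hφ)) with h1 | h1
  · have := Subspace.dualCoannihilator_dualAnnihilator_eq (W := N)
    rw [← this, h1]; simp
  · obtain ⟨ξ, hξ, h0⟩ := h
    exfalso; apply h0
    ext v
    have : v ∈ N.dualCoannihilator := by rw [h1]; trivial
    rw [Submodule.mem_dualCoannihilator] at this
    exact this ξ hξ

/-- `E`-words span the dual over a highest functional -/
theorem dual_spanE_top {μ : Fin n → ℤ} {ξ : Module.Dual ℂ (D.V i)} (h0 : ξ ≠ 0)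
    (hw : D.supp i μ ξ) (hf : ∀ j, ξ ∘ₗ D.X i .F j = 0) :
    spanW (dualOp (D.X i) .E) (Submodule.span ℂ {ξ}) = ⊤ := by
  have T := (D.X_tri i).dual
  have hw' := (D.supp_iff i).1 hw
  have hst := T.spanW_f (G := Submodule.span ℂ {ξ}) (span_wt_stable hw')
    (span_wt_stable (μ := -μ) (T.mem_wt_ki.2 (by rw [neg_neg]; exact hw')))
    (fun j => span_zero_stable (hf j))
  simp only [G4.tw] at hst
  refine D.dual_simple i _ ?_ ⟨ξ, le_spanW _ _ (Submodule.mem_span_singleton_self ξ), h0⟩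
  intro x
  cases x
  · exact hst .F
  · exact hst .E
  · exact hst .K
  · exact hst .Ki

end QD
open scoped TensorProduct

namespace QD
variable {n : ℕ} {A : Type} [Ring A] [Algebra ℂ A] (D : QD n A)

theorem lKi_mul (i x y) : D.l .Ki i (x * y) = D.l .Ki i x * D.l .Ki i y := by
  have h := D.lK_mul i (D.l .Ki i x) (D.l .Ki i y)
  rw [D.l_tri.kki, D.l_tri.kki] at h
  rw [← h, D.l_tri.kik]

theorem rkki (i m) : D.r .K i (D.r .Ki i m) = m := D.r_tri.kki i m
theorem rkik (i m) : D.r .Ki i (D.r .K i m) = m := D.r_tri.kik i m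

theorem rKi_mul (i x y) : D.r .Ki i (x * y) = D.r .Ki i x * D.r .Ki i y := by
  have h := D.rK_mul i (D.r .Ki i x) (D.r .Ki i y)
  rw [D.rkki, D.rkki] at h
  rw [← h, D.rkik]

theorem lKi_one (i) : D.l .Ki i 1 = 1 := by
  have := D.l_tri.kik i 1
  rwa [D.lK_one] at this
theorem rKi_one (i) : D.r .Ki i 1 = 1 := by
  have := D.rkik i 1
  rwa [D.rK_one] at this

/-- left and right weight spaces -/
def lw (ν : Fin n → ℤ) : Submodule ℂ A := D.wt (D.l .K) ν
def rw' (η : Fin n → ℤ) : Submodule ℂ A := D.wt (D.r .K) η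

variable {D}

theorem mem_lw {ν : Fin n → ℤ} {x : A} : x ∈ D.lw ν ↔ ∀ i, D.l .K i x = D.q ^ (ν i * (D.d i : ℤ)) • x := Iff.rfl
theorem mem_rw {ν : Fin n → ℤ} {x : A} : x ∈ D.rw' ν ↔ ∀ i, D.r .K i x = D.q ^ (ν i * (D.d i : ℤ)) • x := Iff.rfl

theorem lw_ki {ν : Fin n → ℤ} {x : A} (h : x ∈ D.lw ν) (i) :
    D.l .Ki i x = D.q ^ (-(ν i * (D.d i : ℤ))) • x := D.l_tri.ki_wt h i
theorem rw_ki {ν : Fin n → ℤ} {x : A} (h : x ∈ D.rw' ν) (i) :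
    D.r .Ki i x = D.q ^ (-(ν i * (D.d i : ℤ))) • x := D.r_tri.ki_wt h i

theorem lw_mul {ν ν' : Fin n → ℤ} {x y : A} (hx : x ∈ D.lw ν) (hy : y ∈ D.lw ν') :
    x * y ∈ D.lw (ν + ν') := by
  intro i
  rw [D.lK_mul, hx i, hy i, smul_mul_smul_comm, ← zpow_add₀ D.q_ne]
  congr 2; simp; ring
theorem rw_mul {ν ν' : Fin n → ℤ} {x y : A} (hx : x ∈ D.rw' ν) (hy : y ∈ D.rw' ν') :
    x * y ∈ D.rw' (ν + ν') := by
  intro i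
  rw [D.rK_mul, hx i, hy i, smul_mul_smul_comm, ← zpow_add₀ D.q_ne]
  congr 2; simp; ring
theorem lw_one : (1 : A) ∈ D.lw 0 := by intro i; simp [D.lK_one]
theorem rw_one : (1 : A) ∈ D.rw' 0 := by intro i; simp [D.rK_one]

theorem lw_pow {ν : Fin n → ℤ} {x : A} (hx : x ∈ D.lw ν) (m : ℕ) : x ^ m ∈ D.lw (m • ν) := by
  induction m with
  | zero => simpa using lw_one
  | succ m ih => rw [pow_succ, succ_nsmul]; exact lw_mul ih hx
theorem rw_pow {ν : Fin n → ℤ} {x : A} (hx : x ∈ D.rw' ν) (m : ℕ) : x ^ m ∈ D.rw' (m • ν) := by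
  induction m with
  | zero => simpa using rw_one
  | succ m ih => rw [pow_succ, succ_nsmul]; exact rw_mul ih hx

theorem lw_lE {ν : Fin n → ℤ} {x : A} (hx : x ∈ D.lw ν) (j) : D.l .E j x ∈ D.lw (ν + D.al j) :=
  D.l_tri.wt_e hx j
theorem lw_lF {ν : Fin n → ℤ} {x : A} (hx : x ∈ D.lw ν) (j) : D.l .F j x ∈ D.lw (ν - D.al j) :=
  D.l_tri.wt_f hx j
theorem rw_rF {ν : Fin n → ℤ} {x : A} (hx : x ∈ D.rw' ν) (j) : D.r .F j x ∈ D.rw' (ν + D.al j) :=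
  D.r_tri.wt_e hx j
theorem rw_rE {ν : Fin n → ℤ} {x : A} (hx : x ∈ D.rw' ν) (j) : D.r .E j x ∈ D.rw' (ν - D.al j) :=
  D.r_tri.wt_f hx j
theorem lw_r {ν : Fin n → ℤ} {x : A} (hx : x ∈ D.lw ν) (y j) : D.r y j x ∈ D.lw ν := by
  intro i; rw [D.lr, hx i, map_smul]
theorem rw_l {ν : Fin n → ℤ} {x : A} (hx : x ∈ D.rw' ν) (y j) : D.l y j x ∈ D.rw' ν := by
  intro i; rw [← D.lr, hx i, map_smul]

theorem lw_cf {i : D.I} {ξ : Module.Dual ℂ (D.V i)} {v : D.V i} {ν : Fin n → ℤ}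
    (h : v ∈ D.wt (D.X i .K) ν) : D.cf i ξ v ∈ D.lw ν := by
  intro j; rw [D.l_cf, h j, map_smul]
theorem rw_cf {i : D.I} {ξ : Module.Dual ℂ (D.V i)} {v : D.V i} {ν : Fin n → ℤ}
    (h : D.supp i ν ξ) : D.cf i ξ v ∈ D.rw' ν := by
  have := (D.supp_iff i).1 h
  intro j
  have h2 := this j
  rw [D.r_cf]
  have h3 : ξ ∘ₗ D.X i .K j = D.q ^ (ν j * (D.d j : ℤ)) • ξ := h2
  rw [h3, map_smul, LinearMap.smul_apply]

/-- weight of `eps` -/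
theorem eps_wt {ν η : Fin n → ℤ} {x : A} (h1 : x ∈ D.lw ν) (h2 : x ∈ D.rw' η)
    (h0 : D.eps x ≠ 0) : ν = η := by
  apply D.wt_ch_inj
  ext j
  have h := D.eps_lr .K j x
  rw [h1 j, h2 j, map_smul, map_smul] at h
  exact smul_left_injective ℂ h0 h

theorem eps_wd (x : G4) (w : List (Fin n)) (a : A) :
    D.eps (wd (D.l x) w a) = D.eps (wd (D.r x) w.reverse a) := by
  have hc : ∀ (w : List (Fin n)) i a, wd (D.l x) w (D.r x i a) = D.r x i (wd (D.l x) w a) := by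
    intro w i a
    induction w with
    | nil => simp
    | cons j w ih => rw [wd_cons, wd_cons, ih, D.lr]
  induction w generalizing a with
  | nil => simp
  | cons i w ih =>
    rw [wd_cons, D.eps_lr, ← hc, ih, List.reverse_cons, wd_append]; simp

theorem lr_wd (x y : G4) (w w' : List (Fin n)) (a : A) :
    wd (D.l x) w (wd (D.r y) w' a) = wd (D.r y) w' (wd (D.l x) w a) := by
  have hc : ∀ (w : List (Fin n)) i a, wd (D.l x) w (D.r y i a) = D.r y i (wd (D.l x) w a) := by
    intro w i a
    induction w with
    | nil => simp
    | cons j w ih => rw [wd_cons, wd_cons, ih, D.lr]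
  induction w' with
  | nil => simp
  | cons i w' ih => rw [wd_cons, wd_cons, hc, ih]

/-- separation by `F`-words times `E`-words -/
theorem sep_FE {ν : Fin n → ℤ} {z : A} (hz : z ∈ D.lw ν)
    (h : ∀ w w', D.eps (wd (D.l .F) w (wd (D.l .E) w' z)) = 0) : z = 0 := by
  set G := spanW (D.l .E) (Submodule.span ℂ {z}) with hG
  have hGk : ∀ i, ∀ g ∈ G, D.l .K i g ∈ G := by
    intro i
    suffices G ≤ G.comap (D.l .K i) from fun g hg => this hg
    refine spanW_le fun w g hg => ?_
    obtain ⟨c, rfl⟩ := Submodule.mem_span_singleton.1 hg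
    have := D.l_tri.wt_we (Submodule.smul_mem _ c hz) w i
    rw [Submodule.mem_comap, this]
    exact Submodule.smul_mem _ _ (wd_mem_spanW _ _ hg)
  have hGki : ∀ i, ∀ g ∈ G, D.l .Ki i g ∈ G := by
    intro i
    suffices G ≤ G.comap (D.l .Ki i) from fun g hg => this hg
    refine spanW_le fun w g hg => ?_
    obtain ⟨c, rfl⟩ := Submodule.mem_span_singleton.1 hg
    have := D.l_tri.ki_wt (D.l_tri.wt_we (Submodule.smul_mem _ c hz) w) i
    rw [Submodule.mem_comap, this]
    exact Submodule.smul_mem _ _ (wd_mem_spanW _ _ hg)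
  have hst := D.l_tri.spanW_f hGk hGki (fun i => spanW_stable _ _ i)
  have hbot := D.sep _ hst (by
    suffices spanW (D.l .F) G ≤ LinearMap.ker D.eps.toLinearMap from fun m hm => this hm
    refine spanW_le fun w => ?_
    suffices G ≤ (LinearMap.ker D.eps.toLinearMap).comap (wd (D.l .F) w) from fun m hm => this hm
    refine spanW_le fun w' g hg => ?_
    obtain ⟨c, rfl⟩ := Submodule.mem_span_singleton.1 hg
    simp only [map_smul]
    apply Submodule.smul_mem
    exact h w w')
  have : z ∈ spanW (D.l .F) G := le_spanW _ _ (le_spanW _ _ (Submodule.mem_span_singleton_self z))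
  rw [hbot] at this
  simpa using this

/-- doubly singular elements are determined by the counit -/
theorem sing {ν : Fin n → ℤ} {z : A} (hz : z ∈ D.lw ν) (hE : ∀ j, D.l .E j z = 0)
    (hF : ∀ j, D.r .F j z = 0) (h0 : D.eps z = 0) : z = 0 := by
  refine sep_FE hz fun w w' => ?_
  rcases List.eq_nil_or_concat w' with rfl | ⟨w'', j, rfl⟩
  · rw [wd_nil, eps_wd]
    rcases List.eq_nil_or_concat w.reverse with h | ⟨w'', j, h⟩
    · rw [h]; simpa
    · rw [h, List.concat_eq_append, wd_append]; simp [hF]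
  · rw [List.concat_eq_append, wd_append]; simp [hE]

/-- local finiteness -/
theorem loc_fin (a : A) : ∃ Z : Submodule ℂ A, FiniteDimensional ℂ Z ∧ a ∈ Z ∧
    (∀ x i, ∀ z ∈ Z, D.l x i z ∈ Z) ∧ (∀ x i, ∀ z ∈ Z, D.r x i z ∈ Z) := by
  have ha : a ∈ Algebra.adjoin ℂ {x : A | ∃ i ξ v, x = D.cf i ξ v} := by rw [D.gen]; trivial
  induction ha using Algebra.adjoin_induction with
  | mem x hx =>
    obtain ⟨i, ξ, v, rfl⟩ := hx
    refine ⟨LinearMap.range (TensorProduct.lift (D.cf i)), inferInstance,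
      ⟨ξ ⊗ₜ v, by simp⟩, ?_, ?_⟩
    · rintro x j _ ⟨t, rfl⟩
      induction t with
      | zero => simp
      | tmul ξ v => rw [TensorProduct.lift.tmul, D.l_cf]; exact ⟨_ ⊗ₜ _, TensorProduct.lift.tmul _ _⟩
      | add s t hs ht => rw [map_add, map_add]; exact Submodule.add_mem _ hs ht
    · rintro x j _ ⟨t, rfl⟩
      induction t with
      | zero => simp
      | tmul ξ v => rw [TensorProduct.lift.tmul, D.r_cf]; exact ⟨_ ⊗ₜ _, TensorProduct.lift.tmul _ _⟩
      | add s t hs ht => rw [map_add, map_add]; exact Submodule.add_mem _ hs ht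
  | algebraMap c =>
    refine ⟨Submodule.span ℂ {1}, inferInstance, ?_, ?_, ?_⟩
    · rw [Algebra.algebraMap_eq_smul_one]
      exact Submodule.smul_mem _ _ (Submodule.mem_span_singleton_self _)
    · intro x i z hz
      obtain ⟨c, rfl⟩ := Submodule.mem_span_singleton.1 hz
      rw [map_smul]
      apply Submodule.smul_mem
      cases x <;> simp [D.lE_one, D.lF_one, D.lK_one, D.lKi_one, Submodule.mem_span_singleton_self]
    · intro x i z hz
      obtain ⟨c, rfl⟩ := Submodule.mem_span_singleton.1 hz
      rw [map_smul]
      apply Submodule.smul_mem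
      cases x <;> simp [D.rE_one, D.rF_one, D.rK_one, D.rKi_one, Submodule.mem_span_singleton_self]
  | add x y _ _ hx hy =>
    obtain ⟨Z, hZ, hxZ, h1, h2⟩ := hx
    obtain ⟨Z', hZ', hyZ, h1', h2'⟩ := hy
    have gen : ∀ (f : Module.End ℂ A), (∀ z ∈ Z, f z ∈ Z) → (∀ z ∈ Z', f z ∈ Z') →
        ∀ z ∈ Z ⊔ Z', f z ∈ Z ⊔ Z' := by
      intro f hf hf' z hz
      obtain ⟨u, hu, v, hv, rfl⟩ := Submodule.mem_sup.1 hz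
      rw [map_add]
      exact Submodule.add_mem_sup (hf _ hu) (hf' _ hv)
    exact ⟨Z ⊔ Z', inferInstance, Submodule.add_mem_sup hxZ hyZ,
      fun x i => gen _ (h1 x i) (h1' x i), fun x i => gen _ (h2 x i) (h2' x i)⟩
  | mul x y _ _ hx hy =>
    obtain ⟨Z, hZ, hxZ, h1, h2⟩ := hx
    obtain ⟨Z', hZ', hyZ, h1', h2'⟩ := hy
    have gen : ∀ (f : Module.End ℂ A), (∀ u ∈ Z, ∀ v ∈ Z', f (u * v) ∈ Z * Z') →
        ∀ z ∈ Z * Z', f z ∈ Z * Z' := by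
      intro f hf z hz
      induction hz using Submodule.mul_induction_on' with
      | mem_mul_mem u hu v hv => exact hf u hu v hv
      | add u _ v _ hu hv => rw [map_add]; exact Submodule.add_mem _ hu hv
    have hfd : FiniteDimensional ℂ (Z * Z' : Submodule ℂ A) := by
      have a1 : Z.FG := Module.Finite.iff_fg.1 hZ
      have a2 : Z'.FG := Module.Finite.iff_fg.1 hZ'
      exact Module.Finite.iff_fg.2 (a1.mul a2)
    refine ⟨Z * Z', hfd, Submodule.mul_mem_mul hxZ hyZ,
      fun x i => gen _ ?_, fun x i => gen _ ?_⟩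
    · intro u hu v hv
      cases x
      · rw [D.lE_mul]
        exact Submodule.add_mem _ (Submodule.mul_mem_mul (h1 _ _ _ hu) hv)
          (Submodule.mul_mem_mul (h1 _ _ _ hu) (h1' _ _ _ hv))
      · rw [D.lF_mul]
        exact Submodule.add_mem _ (Submodule.mul_mem_mul (h1 _ _ _ hu) (h1' _ _ _ hv))
          (Submodule.mul_mem_mul hu (h1' _ _ _ hv))
      · rw [D.lK_mul]; exact Submodule.mul_mem_mul (h1 _ _ _ hu) (h1' _ _ _ hv)
      · rw [D.lKi_mul]; exact Submodule.mul_mem_mul (h1 _ _ _ hu) (h1' _ _ _ hv)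
    · intro u hu v hv
      cases x
      · rw [D.rE_mul]
        exact Submodule.add_mem _ (Submodule.mul_mem_mul (h2 _ _ _ hu) hv)
          (Submodule.mul_mem_mul (h2 _ _ _ hu) (h2' _ _ _ hv))
      · rw [D.rF_mul]
        exact Submodule.add_mem _ (Submodule.mul_mem_mul (h2 _ _ _ hu) (h2' _ _ _ hv))
          (Submodule.mul_mem_mul hu (h2' _ _ _ hv))
      · rw [D.rK_mul]; exact Submodule.mul_mem_mul (h2 _ _ _ hu) (h2' _ _ _ hv)
      · rw [D.rKi_mul]; exact Submodule.mul_mem_mul (h2 _ _ _ hu) (h2' _ _ _ hv)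

theorem nil_lE {ν : Fin n → ℤ} {x : A} (hx : x ∈ D.lw ν) :
    ∃ N : ℕ, ∀ w : List (Fin n), N ≤ w.length → wd (D.l .E) w x = 0 := by
  obtain ⟨Z, hZ, hxZ, h1, h2⟩ := loc_fin (D := D) x
  exact D.l_tri.we_nil Z (h1 .E) hxZ hx
theorem nil_lF {ν : Fin n → ℤ} {x : A} (hx : x ∈ D.lw ν) :
    ∃ N : ℕ, ∀ w : List (Fin n), N ≤ w.length → wd (D.l .F) w x = 0 := by
  obtain ⟨Z, hZ, hxZ, h1, h2⟩ := loc_fin (D := D) x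
  exact D.l_tri.wf_nil Z (h1 .F) hxZ hx
theorem nil_rF {ν : Fin n → ℤ} {x : A} (hx : x ∈ D.rw' ν) :
    ∃ N : ℕ, ∀ w : List (Fin n), N ≤ w.length → wd (D.r .F) w x = 0 := by
  obtain ⟨Z, hZ, hxZ, h1, h2⟩ := loc_fin (D := D) x
  exact D.r_tri.we_nil Z (h2 .F) hxZ hx
theorem nil_rE {ν : Fin n → ℤ} {x : A} (hx : x ∈ D.rw' ν) :
    ∃ N : ℕ, ∀ w : List (Fin n), N ≤ w.length → wd (D.r .E) w x = 0 := by
  obtain ⟨Z, hZ, hxZ, h1, h2⟩ := loc_fin (D := D) x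
  exact D.r_tri.wf_nil Z (h2 .E) hxZ hx

theorem pow_of_nil {M : Type} [AddCommGroup M] [Module ℂ M] {Y : Fin n → Module.End ℂ M} {x : M}
    (h : ∃ N : ℕ, ∀ w : List (Fin n), N ≤ w.length → wd Y w x = 0) (j : Fin n) :
    ∃ N, (Y j ^ N) x = 0 := by
  obtain ⟨N, hN⟩ := h
  exact ⟨N, by rw [← wd_replicate]; exact hN _ (by simp)⟩

variable (D) in
/-- the algebra is the sum of its biweight spaces -/
def bw (g : (Fin n → ℤ) × (Fin n → ℤ)) : Submodule ℂ A := D.lw g.1 ⊓ D.rw' g.2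

theorem bw_mul {g h : (Fin n → ℤ) × (Fin n → ℤ)} {x y : A} (hx : x ∈ D.bw g) (hy : y ∈ D.bw h) :
    x * y ∈ D.bw (g + h) := ⟨lw_mul hx.1 hy.1, rw_mul hx.2 hy.2⟩

theorem bw_one : (1 : A) ∈ D.bw 0 := ⟨lw_one, rw_one⟩

theorem bw_top : (⨆ g, D.bw g) = ⊤ := by
  rw [eq_top_iff]
  rintro a -
  have ha : a ∈ Algebra.adjoin ℂ {x : A | ∃ i ξ v, x = D.cf i ξ v} := by rw [D.gen]; trivial
  induction ha using Algebra.adjoin_induction with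
  | mem x hx =>
    obtain ⟨i, ξ, v, rfl⟩ := hx
    have hv : v ∈ (⨆ μ : Fin n → ℤ, D.wt (D.X i .K) μ) := by rw [D.V_wt_top]; trivial
    induction hv using Submodule.iSup_induction' with
    | mem μ v hv =>
      have hξ : ξ ∈ spanW (dualOp (D.X i) .E) (Submodule.span ℂ {D.xhi i}) := by
        rw [D.dual_spanE_top i (D.xhi_ne i) (D.xhi_supp i) (D.supp_hi_f i (D.xhi_supp i))]; trivial
      suffices spanW (dualOp (D.X i) .E) (Submodule.span ℂ {D.xhi i}) ≤
        (⨆ g, D.bw g).comap ((D.cf i).flip v) from this hξ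
      refine spanW_le fun w g hg => ?_
      obtain ⟨c, rfl⟩ := Submodule.mem_span_singleton.1 hg
      have h1 := (D.X_tri i).dual.wt_wf (Submodule.smul_mem _ c ((D.supp_iff i).1 (D.xhi_supp i))) w
      refine (le_iSup D.bw (μ, _)) ⟨lw_cf hv, rw_cf ((D.supp_iff i).2 h1)⟩
    | zero => simp
    | add x y _ _ hx hy => rw [map_add]; exact Submodule.add_mem _ hx hy
  | algebraMap c =>
    rw [Algebra.algebraMap_eq_smul_one]
    exact Submodule.smul_mem _ _ (le_iSup D.bw 0 bw_one)
  | add x y _ _ hx hy => exact Submodule.add_mem _ hx hy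
  | mul x y hx0 hy0 hx hy =>
    clear hx0 hy0
    induction hx using Submodule.iSup_induction' with
    | mem g x hx =>
      induction hy using Submodule.iSup_induction' with
      | mem h y hy => exact le_iSup D.bw (g + h) (bw_mul hx hy)
      | zero => simp
      | add x y _ _ hx hy => rw [mul_add]; exact Submodule.add_mem _ hx hy
    | zero => simp
    | add x y _ _ hx hy => rw [add_mul]; exact Submodule.add_mem _ hx hy

end QD
open scoped TensorProduct

namespace QD
variable {n : ℕ} {A : Type} [Ring A] [Algebra ℂ A] {D : QD n A}

theorem lkk (D : QD n A) (i j m) : D.l .K i (D.l .K j m) = D.l .K j (D.l .K i m) := D.l_tri.kk i j m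
theorem rkk (D : QD n A) (i j m) : D.r .K i (D.r .K j m) = D.r .K j (D.r .K i m) := D.r_tri.kk i j m

theorem bw_indep : iSupIndep D.bw := by
  set k : Fin n ⊕ Fin n → Module.End ℂ A := Sum.elim (D.l .K) (D.r .K) with hk
  have hcomm : ∀ i j m, k i (k j m) = k j (k i m) := by
    rintro (i | i) (j | j) m
    · exact D.lkk i j m
    · exact D.lr _ _ _ _ m
    · exact (D.lr _ _ _ _ m).symm
    · exact D.rkk i j m
  have h := Module.End.independent_iInf_maxGenEigenspace_of_forall_mapsTo k (fun i j φ => by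
    apply Module.End.mapsTo_maxGenEigenspace_of_comm
    ext m; exact hcomm j i m)
  have hinj : Function.Injective (fun (g : (Fin n → ℤ) × (Fin n → ℤ)) (i : Fin n ⊕ Fin n) =>
      Sum.elim (fun i => D.q ^ (g.1 i * (D.d i : ℤ))) (fun i => D.q ^ (g.2 i * (D.d i : ℤ))) i) := by
    intro g g' hg
    refine Prod.ext (D.wt_ch_inj ?_) (D.wt_ch_inj ?_)
    · funext i; exact congrFun hg (Sum.inl i)
    · funext i; exact congrFun hg (Sum.inr i)
  have h2 := h.comp hinj
  refine h2.mono ?_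
  intro μ m hm
  simp only [Function.comp, Submodule.mem_iInf]
  intro i
  apply Module.End.mem_maxGenEigenspace _ _ _ |>.2
  refine ⟨1, ?_⟩
  rcases i with i | i
  · have := hm.1 i
    simp [hk, this]
  · have := hm.2 i
    simp [hk, this]

theorem exists_comp (D : QD n A) : ∃ p : (Fin n → ℤ) × (Fin n → ℤ) → A →ₗ[ℂ] A,
    (∀ g x, p g x ∈ D.bw g) ∧ (∀ g, ∀ x ∈ D.bw g, p g x = x) ∧
    (∀ g h, g ≠ h → ∀ x ∈ D.bw g, p h x = 0) ∧
    (∀ x, ∃ s : Finset ((Fin n → ℤ) × (Fin n → ℤ)), (∀ g, g ∉ s → p g x = 0) ∧ x = ∑ g ∈ s, p g x) := by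
  classical
  have hIntern := DirectSum.isInternal_submodule_of_iSupIndep_of_iSup_eq_top D.bw_indep bw_top
  letI := hIntern.chooseDecomposition
  refine ⟨fun g => (D.bw g).subtype ∘ₗ (DirectSum.component ℂ _ _ g) ∘ₗ
    (DirectSum.decomposeLinearEquiv D.bw).toLinearMap, ?_, ?_, ?_, ?_⟩
  · intro g x; exact Subtype.mem _
  · intro g x hx; exact DirectSum.decompose_of_mem_same D.bw hx
  · intro g h hgh x hx; exact DirectSum.decompose_of_mem_ne D.bw hx hgh
  · intro x
    refine ⟨(DirectSum.decompose D.bw x).support, ?_, (DirectSum.sum_support_decompose D.bw x).symm⟩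
    intro g hg
    have := DFinsupp.notMem_support_iff.1 hg
    show ((DirectSum.decompose D.bw x g : D.bw g) : A) = 0
    rw [this]; rfl

variable (D) in
noncomputable def comp : (Fin n → ℤ) × (Fin n → ℤ) → A →ₗ[ℂ] A := D.exists_comp.choose
theorem comp_mem (g x) : D.comp g x ∈ D.bw g := D.exists_comp.choose_spec.1 g x
theorem comp_self {g x} (h : x ∈ D.bw g) : D.comp g x = x := D.exists_comp.choose_spec.2.1 g x h
theorem comp_ne {g h x} (hgh : g ≠ h) (hx : x ∈ D.bw g) : D.comp h x = 0 :=
  D.exists_comp.choose_spec.2.2.1 g h hgh x hx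
theorem comp_sum (x) : ∃ s : Finset ((Fin n → ℤ) × (Fin n → ℤ)), (∀ g, g ∉ s → D.comp g x = 0) ∧
    x = ∑ g ∈ s, D.comp g x :=  D.exists_comp.choose_spec.2.2.2 x

theorem bw_ind {P : A → Prop} (hm : ∀ g, ∀ x ∈ D.bw g, P x) (h0 : P 0)
    (ha : ∀ x y, P x → P y → P (x + y)) (x : A) : P x := by
  have hx : x ∈ ⨆ g, D.bw g := by rw [bw_top]; trivial
  induction hx using Submodule.iSup_induction' with
  | mem g x hx => exact hm g x hx
  | zero => exact h0
  | add x y _ _ hx hy => exact ha x y hx hy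

theorem comp_mul {g h c} (hc : c ∈ D.bw g) (x : A) : D.comp (g + h) (c * x) = c * D.comp h x := by
  refine bw_ind (D := D) (P := fun x => D.comp (g + h) (c * x) = c * D.comp h x) ?_ (by simp) ?_ x
  · intro k x hx
    by_cases hk : k = h
    · subst hk; rw [comp_self (bw_mul hc hx), comp_self hx]
    · rw [comp_ne hk hx, comp_ne _ (bw_mul hc hx), mul_zero]
      simpa using hk
  · intro x y hx hy; rw [mul_add, map_add, hx, hy, map_add, mul_add]

/-- primality of graded ideals can be checked on homogeneous elements -/
theorem graded_prime (P : Submodule ℂ A) (hl : ∀ a, ∀ p ∈ P, a * p ∈ P) (hr : ∀ a, ∀ p ∈ P, p * a ∈ P)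
    (hom : ∀ g, ∀ p ∈ P, D.comp g p ∈ P)
    (hh : ∀ g h, ∀ y ∈ D.bw g, ∀ z ∈ D.bw h, y * z ∈ P → y ∈ P ∨ z ∈ P) (y z : A)
    (hyz : y * z ∈ P) : y ∈ P ∨ z ∈ P := by
  classical
  by_contra hcon
  push Not at hcon
  obtain ⟨hy, hz⟩ := hcon
  have key : ∀ y, y ∉ P → ∃ S : Finset ((Fin n → ℤ) × (Fin n → ℤ)), S.Nonempty ∧
      (∀ g ∈ S, D.comp g y ∉ P) ∧ y - ∑ g ∈ S, D.comp g y ∈ P := by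
    intro y hy
    obtain ⟨s, hs, hsum⟩ := comp_sum (D := D) y
    have h1 : y - ∑ g ∈ s.filter (fun g => D.comp g y ∉ P), D.comp g y ∈ P := by
      have := Finset.sum_filter_add_sum_filter_not s (fun g => D.comp g y ∉ P) (fun g => D.comp g y)
      have h2 : y - ∑ g ∈ s.filter (fun g => D.comp g y ∉ P), D.comp g y =
          ∑ g ∈ s.filter (fun g => ¬ D.comp g y ∉ P), D.comp g y := by
        rw [sub_eq_iff_eq_add, add_comm, this]; exact hsum
      rw [h2]
      apply Submodule.sum_mem
      intro g hg
      simpa using (Finset.mem_filter.1 hg).2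
    refine ⟨_, ?_, fun g hg => (Finset.mem_filter.1 hg).2, h1⟩
    rw [Finset.nonempty_iff_ne_empty]
    intro he
    rw [he] at h1
    simp at h1
    exact hy h1
  obtain ⟨S, hS, hSP, hSy⟩ := key y hy
  obtain ⟨T, hT, hTP, hTz⟩ := key z hz
  obtain ⟨g0, hg0, h0, hh0, huniq⟩ := UniqueSums.uniqueAdd_of_nonempty (G := (Fin n → ℤ) × (Fin n → ℤ)) hS hT
  have h1 : (∑ g ∈ S, D.comp g y) * (∑ g ∈ T, D.comp g z) ∈ P := by
    have e : (∑ g ∈ S, D.comp g y) * (∑ g ∈ T, D.comp g z) = y * z -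
      ((y - ∑ g ∈ S, D.comp g y) * z + (∑ g ∈ S, D.comp g y) * (z - ∑ g ∈ T, D.comp g z)) := by
      noncomm_ring
    rw [e]
    exact P.sub_mem hyz (P.add_mem (hr _ _ hSy) (hl _ _ hTz))
  have h2 := hom (g0 + h0) _ h1
  have h3 : D.comp (g0 + h0) ((∑ g ∈ S, D.comp g y) * (∑ g ∈ T, D.comp g z)) =
      D.comp g0 y * D.comp h0 z := by
    rw [Finset.sum_mul_sum, map_sum, Finset.sum_eq_single g0, map_sum, Finset.sum_eq_single h0]
    · exact comp_self (bw_mul (comp_mem _ _) (comp_mem _ _))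
    · intro b hb hbh
      refine comp_ne ?_ (bw_mul (comp_mem g0 y) (comp_mem b z))
      simpa using hbh
    · intro h; exact absurd hh0 h
    · intro b hb hbg
      rw [map_sum]
      refine Finset.sum_eq_zero fun c hc => ?_
      refine comp_ne ?_ (bw_mul (comp_mem b y) (comp_mem c z))
      intro he
      exact hbg (huniq hb hc he).1
    · intro h; exact absurd hg0 h
  rw [h3] at h2
  rcases hh g0 h0 _ (comp_mem _ _) _ (comp_mem _ _) h2 with h | h
  · exact hSP _ hg0 h
  · exact hTP _ hh0 h

end QD
open scoped TensorProduct

/-- `q`-Pascal numbers -/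
noncomputable def bq (t : ℂ) : ℕ → ℕ → ℂ
  | 0, _ => 1
  | _ + 1, 0 => 1
  | m + 1, k + 1 => t ^ (k + 1) * bq t m (k + 1) + bq t (m + 1) k

noncomputable def qn (t : ℂ) (m : ℕ) : ℂ := ∏ i ∈ Finset.range m, (1 - t ^ (i + 1))

theorem qn_succ (t : ℂ) (m : ℕ) : qn t (m + 1) = qn t m * (1 - t ^ (m + 1)) :=
  Finset.prod_range_succ _ _

theorem bq_mul (t : ℂ) (m k : ℕ) : bq t m k * (qn t m * qn t k) = qn t (m + k) := by
  induction m generalizing k with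
  | zero => simp [bq, qn]
  | succ m ihm =>
    induction k with
    | zero => simp [bq, qn]
    | succ k ihk =>
      have h1 := ihm (k + 1)
      rw [show m + 1 + (k + 1) = (m + 1 + k) + 1 by ring, qn_succ t (m + 1 + k)]
      have h1' : bq t m (k + 1) * (qn t m * qn t (k + 1)) = qn t (m + 1 + k) := by
        rw [h1]; congr 1; ring
      rw [bq]
      calc _ = t ^ (k + 1) * (1 - t ^ (m + 1)) * (bq t m (k + 1) * (qn t m * qn t (k + 1))) +
            (1 - t ^ (k + 1)) * (bq t (m + 1) k * (qn t (m + 1) * qn t k)) := by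
              rw [qn_succ t m, qn_succ t k]; ring
        _ = _ := by rw [h1', ihk]; ring

theorem bq_ne {t : ℂ} (ht : ∀ m : ℕ, t ^ (m + 1) ≠ 1) (m k : ℕ) : bq t m k ≠ 0 := by
  intro h
  have h1 := bq_mul t m k
  rw [h, zero_mul] at h1
  have : qn t (m + k) ≠ 0 := Finset.prod_ne_zero_iff.2 fun i _ => sub_ne_zero.2 (ht i).symm
  exact this h1.symm

theorem top_lemma {A : Type} [AddCommGroup A] [Module ℂ A] (M : A →ₗ[ℂ] A →ₗ[ℂ] A)
    (D κ : Module.End ℂ A) (hD : ∀ a b, D (M a b) = M (D a) b + M (κ a) (D b)) (t : ℂ) (m k : ℕ) :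
    ∀ (y z : A) (τ : ℂ), (∀ i : ℕ, κ ((D ^ i) y) = (τ * t ^ i) • (D ^ i) y) → (D ^ (m + 1)) y = 0 →
      (D ^ (k + 1)) z = 0 → (D ^ (m + k)) (M y z) = (τ ^ k * bq t m k) • M ((D ^ m) y) ((D ^ k) z) := by
  have step : ∀ (N : ℕ) (y z : A) (τ : ℂ), κ y = τ • y → (D ^ (N + 1)) (M y z) =
      (D ^ N) (M (D y) z) + τ • (D ^ N) (M y (D z)) := by
    intro N y z τ h
    rw [pow_succ, Module.End.mul_apply, hD, h, map_add, map_smul, LinearMap.smul_apply, map_smul]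
  have sh : ∀ N y, (D ^ (N + 1)) y = (D ^ N) (D y) := by
    intro N y; rw [pow_succ, Module.End.mul_apply]
  have hk : ∀ (y : A) (τ : ℂ), (∀ i : ℕ, κ ((D ^ i) y) = (τ * t ^ i) • (D ^ i) y) → κ y = τ • y := by
    intro y τ h; simpa using h 0
  have hk' : ∀ (y : A) (τ : ℂ), (∀ i : ℕ, κ ((D ^ i) y) = (τ * t ^ i) • (D ^ i) y) →
      ∀ i : ℕ, κ ((D ^ i) (D y)) = ((τ * t) * t ^ i) • (D ^ i) (D y) := by
    intro y τ h i
    have := h (i + 1)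
    rw [sh] at this
    rw [this, pow_succ']; congr 1; ring
  induction m generalizing k with
  | zero =>
    induction k with
    | zero => intro y z τ _ _ _; simp [bq]
    | succ k ih =>
      intro y z τ hy h1 h2
      have hy0 : D y = 0 := by simpa using h1
      rw [show 0 + (k + 1) = (0 + k) + 1 by ring, step _ _ _ τ (hk y τ hy), hy0, map_zero,
        LinearMap.zero_apply, map_zero, zero_add, ih y (D z) τ hy h1 (by rw [← sh]; exact h2),
        smul_smul, ← sh]
      simp [bq, pow_succ']
  | succ m ihm =>
    induction k with
    | zero =>
      intro y z τ hy h1 h2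
      have hz0 : D z = 0 := by simpa using h2
      have := ihm 0 (D y) z (τ * t) (hk' y τ hy) (by rw [← sh]; exact h1) h2
      rw [show m + 1 + 0 = (m + 0) + 1 by ring, step _ _ _ τ (hk y τ hy), hz0, map_zero, map_zero,
        smul_zero, add_zero]; erw [this]
      cases m <;> simp [bq, sh]
    | succ k ih =>
      intro y z τ hy h1 h2
      have e1 := ihm (k + 1) (D y) z (τ * t) (hk' y τ hy) (by rw [← sh]; exact h1) h2
      have e2 := ih y (D z) τ hy h1 (by rw [← sh]; exact h2)
      rw [show m + 1 + (k + 1) = (m + (k + 1)) + 1 by ring, step _ _ _ τ (hk y τ hy), e1,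
        show m + (k + 1) = m + 1 + k by ring, e2, smul_smul, ← sh, ← sh, ← add_smul, bq]
      congr 1; ring

namespace QD
variable {n : ℕ} {A : Type} [Ring A] [Algebra ℂ A] {D : QD n A}

theorem qd_ne (D : QD n A) (j : Fin n) (s : ℤ) (hs : s ≠ 0) (m : ℕ) :
    (D.q ^ (s * (D.d j : ℤ))) ^ (m + 1) ≠ 1 := by
  rw [← zpow_natCast, ← zpow_mul]
  intro h
  have := D.q_root _ h
  have h2 := D.d_pos j
  have h3 : (s * (D.d j : ℤ)) * ((m + 1 : ℕ) : ℤ) ≠ 0 := by positivity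
  exact h3 this

theorem top_lE {g : Fin n → ℤ} {y z : A} (hy : y ∈ D.lw g) (j) {m k : ℕ}
    (h1 : (D.l .E j ^ (m + 1)) y = 0) (h2 : (D.l .E j ^ (k + 1)) z = 0) :
    ∃ c : ℂ, c ≠ 0 ∧ (D.l .E j ^ (m + k)) (y * z) = c • ((D.l .E j ^ m) y * (D.l .E j ^ k) z) := by
  refine ⟨_, ?_, top_lemma (LinearMap.mul ℂ A) (D.l .E j) (D.l .K j) (D.lE_mul j)
    (D.q ^ (2 * (D.d j : ℤ))) m k y z (D.q ^ (g j * (D.d j : ℤ))) ?_ h1 h2⟩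
  · exact mul_ne_zero (pow_ne_zero _ (zpow_ne_zero _ D.q_ne)) (bq_ne (D.qd_ne j 2 (by norm_num)) _ _)
  · intro i
    rw [D.l_tri.wt_epow hy j i j, ← zpow_natCast, ← zpow_mul, ← zpow_add₀ D.q_ne]
    congr 2
    simp [CD.al, D.a_diag]; ring

theorem top_rF {g : Fin n → ℤ} {y z : A} (hy : y ∈ D.rw' g) (j) {m k : ℕ}
    (h1 : (D.r .F j ^ (m + 1)) y = 0) (h2 : (D.r .F j ^ (k + 1)) z = 0) :
    ∃ c : ℂ, c ≠ 0 ∧ (D.r .F j ^ (m + k)) (z * y) = c • ((D.r .F j ^ k) z * (D.r .F j ^ m) y) := by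
  refine ⟨_, ?_, top_lemma (LinearMap.mul ℂ A).flip (D.r .F j) (D.r .Ki j)
    (fun a b => by simp only [LinearMap.flip_apply, LinearMap.mul_apply']; rw [D.rF_mul, add_comm])
    (D.q ^ (-2 * (D.d j : ℤ))) m k y z (D.q ^ (-(g j * (D.d j : ℤ)))) ?_ h1 h2⟩
  · exact mul_ne_zero (pow_ne_zero _ (zpow_ne_zero _ D.q_ne)) (bq_ne (D.qd_ne j (-2) (by norm_num)) _ _)
  · intro i
    have := D.r_tri.wt_epow hy j i
    rw [show D.r .F j ^ i = (D.r (G4.tw .E) j) ^ i from rfl, rw_ki this j, ← zpow_natCast, ← zpow_mul,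
      ← zpow_add₀ D.q_ne]
    congr 2
    simp [CD.al, D.a_diag]; ring

theorem lw_lEpow {ν : Fin n → ℤ} {x : A} (hx : x ∈ D.lw ν) (j) (r : ℕ) :
    (D.l .E j ^ r) x ∈ D.lw (ν + r • D.al j) := D.l_tri.wt_epow hx j r
theorem rw_rFpow {ν : Fin n → ℤ} {x : A} (hx : x ∈ D.rw' ν) (j) (r : ℕ) :
    (D.r .F j ^ r) x ∈ D.rw' (ν + r • D.al j) := D.r_tri.wt_epow hx j r
theorem rw_lpow {ν : Fin n → ℤ} {x : A} (hx : x ∈ D.rw' ν) (y j) (r : ℕ) :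
    (D.l y j ^ r) x ∈ D.rw' ν := by
  induction r with
  | zero => simpa
  | succ r ih => rw [pow_succ', Module.End.mul_apply]; exact rw_l ih _ _
theorem lw_rpow {ν : Fin n → ℤ} {x : A} (hx : x ∈ D.lw ν) (y j) (r : ℕ) :
    (D.r y j ^ r) x ∈ D.lw ν := by
  induction r with
  | zero => simpa
  | succ r ih => rw [pow_succ', Module.End.mul_apply]; exact lw_r ih _ _

theorem pow_stable {M : Type} [AddCommGroup M] [Module ℂ M] {Z : Submodule ℂ M} {f : Module.End ℂ M}
    (h : ∀ z ∈ Z, f z ∈ Z) (r : ℕ) : ∀ z ∈ Z, (f ^ r) z ∈ Z := by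
  induction r with
  | zero => simp
  | succ r ih => intro z hz; rw [pow_succ', Module.End.mul_apply]; exact h _ (ih z hz)

theorem bdd_ph (x : A) : ∃ Z : Submodule ℂ A, x ∈ Z ∧
    (∀ x i, ∀ z ∈ Z, D.l x i z ∈ Z) ∧ (∀ x i, ∀ z ∈ Z, D.r x i z ∈ Z) ∧
    ∃ H : ℤ, ∀ g : (Fin n → ℤ) × (Fin n → ℤ), ∀ z ∈ Z, z ∈ D.bw g → z ≠ 0 →
      D.ph g.1 + D.ph g.2 ≤ H := by
  obtain ⟨Z, hZ, hxZ, h1, h2⟩ := loc_fin (D := D) x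
  obtain ⟨H1, hH1⟩ := D.wt_bdd (D.l .K) D.lkk Z D.ph
  obtain ⟨H2, hH2⟩ := D.wt_bdd (D.r .K) D.rkk Z D.ph
  exact ⟨Z, hxZ, h1, h2, H1 + H2, fun g z hz hg h0 =>
    add_le_add (hH1 _ z hz hg.1 h0) (hH2 _ z hz hg.2 h0)⟩

theorem ph_nsmul (D : QD n A) (r : ℕ) (μ : Fin n → ℤ) : D.ph (r • μ) = r * D.ph μ := by
  induction r with
  | zero => simp [D.ph_zero]
  | succ r ih => rw [succ_nsmul, D.ph_add, ih]; push_cast; ring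

theorem dom_bw {g h : (Fin n → ℤ) × (Fin n → ℤ)} {y z : A} (hy : y ∈ D.bw g) (hz : z ∈ D.bw h)
    (hy0 : y ≠ 0) (hz0 : z ≠ 0) : y * z ≠ 0 := by
  obtain ⟨Y, hyY, l1, r1, H1, hH1⟩ := bdd_ph (D := D) y
  obtain ⟨Z, hzZ, l2, r2, H2, hH2⟩ := bdd_ph (D := D) z
  obtain ⟨N, hN⟩ : ∃ N : ℕ, H1 + H2 - (D.ph g.1 + D.ph g.2) - (D.ph h.1 + D.ph h.2) ≤ N :=
    ⟨_, Int.self_le_toNat _⟩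
  induction N using Nat.strong_induction_on generalizing g h y z with
  | _ N ih =>
  by_cases hE : ∃ j, D.l .E j y ≠ 0 ∨ D.l .E j z ≠ 0
  · obtain ⟨j, hj⟩ := hE
    obtain ⟨r, hr, hr1⟩ := Tri.exists_top (D.l .E j) hy0 (pow_of_nil (nil_lE hy.1) j)
    obtain ⟨s, hs, hs1⟩ := Tri.exists_top (D.l .E j) hz0 (pow_of_nil (nil_lE hz.1) j)
    obtain ⟨c, hc, hcc⟩ := top_lE (D := D) hy.1 j (m := r) (k := s) (z := z)
      (by rw [pow_succ', Module.End.mul_apply, hr1]) (by rw [pow_succ', Module.End.mul_apply, hs1])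
    have hrs : 0 < r + s := by
      by_contra h0
      have : r = 0 ∧ s = 0 := by omega
      obtain ⟨rfl, rfl⟩ := this
      simp at hr1 hs1
      rcases hj with h | h
      · exact h hr1
      · exact h hs1
    have hal := D.ph_al j
    have b1 : (D.l .E j ^ r) y ∈ D.bw (g.1 + r • D.al j, g.2) := ⟨lw_lEpow hy.1 j r, rw_lpow hy.2 _ _ _⟩
    have b2 : (D.l .E j ^ s) z ∈ D.bw (h.1 + s • D.al j, h.2) := ⟨lw_lEpow hz.1 j s, rw_lpow hz.2 _ _ _⟩
    have m1 := pow_stable (l1 .E j) r _ hyY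
    have m2 := pow_stable (l2 .E j) s _ hzZ
    have q1 := hH1 _ _ m1 b1 hr
    have q2 := hH2 _ _ m2 b2 hs
    simp only [D.ph_add, D.ph_nsmul] at q1 q2
    have hmain := ih ((H1 + H2 - (D.ph g.1 + D.ph g.2) - (D.ph h.1 + D.ph h.2) - (r + s)).toNat)
      (by
        have : ((r : ℤ) + s) ≤ (r + s) * D.ph (D.al j) := by nlinarith
        have h3 : (0 : ℤ) < r + s := by exact_mod_cast hrs
        have : 0 ≤ H1 + H2 - (D.ph g.1 + D.ph g.2) - (D.ph h.1 + D.ph h.2) - (r + s) := by linarith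
        omega) b1 b2 hr hs m1 m2 (by
        simp only [D.ph_add, D.ph_nsmul]
        refine le_trans ?_ (Int.self_le_toNat _)
        have : ((r : ℤ) + s) ≤ (r + s) * D.ph (D.al j) := by nlinarith
        linarith)
    intro h0
    rw [h0, map_zero] at hcc
    exact hmain ((smul_eq_zero.1 hcc.symm).resolve_left hc)
  by_cases hF : ∃ j, D.r .F j y ≠ 0 ∨ D.r .F j z ≠ 0
  · obtain ⟨j, hj⟩ := hF
    obtain ⟨r, hr, hr1⟩ := Tri.exists_top (D.r .F j) hy0 (pow_of_nil (nil_rF hy.2) j)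
    obtain ⟨s, hs, hs1⟩ := Tri.exists_top (D.r .F j) hz0 (pow_of_nil (nil_rF hz.2) j)
    obtain ⟨c, hc, hcc⟩ := top_rF (D := D) hz.2 j (m := s) (k := r) (z := y)
      (by rw [pow_succ', Module.End.mul_apply, hs1]) (by rw [pow_succ', Module.End.mul_apply, hr1])
    have hrs : 0 < r + s := by
      by_contra h0
      have : r = 0 ∧ s = 0 := by omega
      obtain ⟨rfl, rfl⟩ := this
      simp at hr1 hs1
      rcases hj with h | h
      · exact h hr1
      · exact h hs1
    have hal := D.ph_al j
    have b1 : (D.r .F j ^ r) y ∈ D.bw (g.1, g.2 + r • D.al j) := ⟨lw_rpow hy.1 _ _ _, rw_rFpow hy.2 j r⟩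
    have b2 : (D.r .F j ^ s) z ∈ D.bw (h.1, h.2 + s • D.al j) := ⟨lw_rpow hz.1 _ _ _, rw_rFpow hz.2 j s⟩
    have m1 := pow_stable (r1 .F j) r _ hyY
    have m2 := pow_stable (r2 .F j) s _ hzZ
    have q1 := hH1 _ _ m1 b1 hr
    have q2 := hH2 _ _ m2 b2 hs
    simp only [D.ph_add, D.ph_nsmul] at q1 q2
    have hmain := ih ((H1 + H2 - (D.ph g.1 + D.ph g.2) - (D.ph h.1 + D.ph h.2) - (r + s)).toNat)
      (by
        have : ((r : ℤ) + s) ≤ (r + s) * D.ph (D.al j) := by nlinarith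
        have h3 : (0 : ℤ) < r + s := by exact_mod_cast hrs
        have : 0 ≤ H1 + H2 - (D.ph g.1 + D.ph g.2) - (D.ph h.1 + D.ph h.2) - (r + s) := by linarith
        omega) b1 b2 hr hs m1 m2 (by
        simp only [D.ph_add, D.ph_nsmul]
        refine le_trans ?_ (Int.self_le_toNat _)
        have : ((r : ℤ) + s) ≤ (r + s) * D.ph (D.al j) := by nlinarith
        linarith)
    intro h0
    rw [h0, map_zero] at hcc
    exact hmain ((smul_eq_zero.1 hcc.symm).resolve_left hc)
  push Not at hE hF
  intro h0
  have := congrArg D.eps h0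
  rw [map_mul, map_zero, mul_eq_zero] at this
  rcases this with h | h
  · exact hy0 (sing hy.1 (fun j => (hE j).1) (fun j => (hF j).1) h)
  · exact hz0 (sing hz.1 (fun j => (hE j).2) (fun j => (hF j).2) h)

theorem nzd (D : QD n A) : NoZeroDivisors A where
  eq_zero_or_eq_zero_of_mul_eq_zero := by
    intro y z hyz
    have := graded_prime (D := D) (⊥ : Submodule ℂ A) (by simp) (by simp) (by simp) (by
      intro g h y hy z hz hm
      simp only [Submodule.mem_bot] at hm ⊢
      by_contra hc
      push Not at hc
      exact dom_bw hy hz hc.1 hc.2 hm) y z (by simpa using hyz)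
    simpa using this

end QD
open scoped TensorProduct

namespace CD
variable {n : ℕ} (C : CD n)

def ws (μ : Fin n → ℤ) (w : List (Fin n)) : ℤ := (w.map (fun j => μ j * (C.d j : ℤ))).sum
@[simp] theorem ws_nil (μ) : C.ws μ [] = 0 := by simp [ws]
@[simp] theorem ws_cons (μ j w) : C.ws μ (j :: w) = μ j * (C.d j : ℤ) + C.ws μ w := by simp [ws]

theorem wal_count (w : List (Fin n)) : C.wal w = ∑ j, (w.count j : ℤ) • C.al j := by
  induction w with
  | nil => simp
  | cons i w ih =>
    rw [wal_cons, ih]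
    simp only [List.count_cons]
    push_cast
    simp only [add_smul, Finset.sum_add_distrib]
    rw [add_comm]
    congr 1
    rw [Finset.sum_eq_single i]
    · simp
    · intro b _ hb; simp [Ne.symm hb]
    · simp

theorem ws_eq {w w' : List (Fin n)} (h : C.wal w = C.wal w') (μ) : C.ws μ w = C.ws μ w' := by
  have hp : w.Perm w' := by
    rw [List.perm_iff_count]
    intro j
    have h1 := C.al_indep (fun j => (w.count j : ℤ) - (w'.count j : ℤ)) (by
      simp only [sub_smul, Finset.sum_sub_distrib]
      rw [← wal_count, ← wal_count, h, sub_self])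
    have := congrFun h1 j
    simp at this
    omega
  exact (hp.map _).sum_eq
end CD

namespace QD
variable {n : ℕ} {A : Type} [Ring A] [Algebra ℂ A] {D : QD n A}

/-- elements annihilated by the `E`'s on both sides -/
structure IsM (D : QD n A) (ϖ η : Fin n → ℤ) (c : A) : Prop where
  lE : ∀ j, D.l .E j c = 0
  rE : ∀ j, D.r .E j c = 0
  lw : c ∈ D.lw ϖ
  rw : c ∈ D.rw' η

theorem l_wd_cf (i : D.I) (x w) (ξ : Module.Dual ℂ (D.V i)) (v : D.V i) :
    wd (D.l x) w (D.cf i ξ v) = D.cf i ξ (wd (D.X i x) w v) := by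
  induction w with
  | nil => simp
  | cons j w ih => rw [wd_cons, wd_cons, ih, D.l_cf]
theorem r_wd_cf (i : D.I) (x w) (ξ : Module.Dual ℂ (D.V i)) (v : D.V i) :
    wd (D.r x) w (D.cf i ξ v) = D.cf i (wd (dualOp (D.X i) x) w ξ) v := by
  induction w with
  | nil => simp
  | cons j w ih => rw [wd_cons, wd_cons, ih, D.r_cf]; rfl

variable {ϖ η : Fin n → ℤ} {c : A}

theorem IsM.lE_right (hc : D.IsM ϖ η c) (j y) : D.l .E j (y * c) = D.l .E j y * c := by
  rw [D.lE_mul, hc.lE]; simp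
theorem IsM.lE_left (hc : D.IsM ϖ η c) (j y) :
    D.l .E j (c * y) = D.q ^ (ϖ j * (D.d j : ℤ)) • (c * D.l .E j y) := by
  rw [D.lE_mul, hc.lE, hc.lw j]; simp
theorem IsM.rE_right (hc : D.IsM ϖ η c) (j y) : D.r .E j (y * c) = D.r .E j y * c := by
  rw [D.rE_mul, hc.rE]; simp
theorem IsM.rE_left (hc : D.IsM ϖ η c) (j y) :
    D.r .E j (c * y) = D.q ^ (η j * (D.d j : ℤ)) • (c * D.r .E j y) := by
  rw [D.rE_mul, hc.rE, hc.rw j]; simp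

theorem IsM.wlE_right (hc : D.IsM ϖ η c) (w y) : wd (D.l .E) w (y * c) = wd (D.l .E) w y * c := by
  induction w with
  | nil => simp
  | cons j w ih => rw [wd_cons, wd_cons, ih, hc.lE_right]
theorem IsM.wlE_left (hc : D.IsM ϖ η c) (w y) :
    wd (D.l .E) w (c * y) = D.q ^ (D.ws ϖ w) • (c * wd (D.l .E) w y) := by
  induction w with
  | nil => simp
  | cons j w ih =>
    rw [wd_cons, wd_cons, ih, map_smul, hc.lE_left, smul_smul, D.ws_cons, zpow_add₀ D.q_ne, mul_comm]

theorem wrF_right {y : A} (hy : ∀ j, D.r .F j y = 0) {μ} (hμ : y ∈ D.rw' μ) (w x) :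
    wd (D.r .F) w (x * y) = D.q ^ (- D.ws μ w) • (wd (D.r .F) w x * y) := by
  induction w with
  | nil => simp
  | cons j w ih =>
    rw [wd_cons, wd_cons, ih, map_smul, D.rF_mul, hy, rw_ki hμ, mul_zero, add_zero, mul_smul_comm,
      smul_smul, D.ws_cons, neg_add, zpow_add₀ D.q_ne, mul_comm]
theorem wrF_left {y : A} (hy : ∀ j, D.r .F j y = 0) (w x) :
    wd (D.r .F) w (y * x) = y * wd (D.r .F) w x := by
  induction w with
  | nil => simp
  | cons j w ih => rw [wd_cons, wd_cons, ih, D.rF_mul, hy]; simp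

theorem rw_wlE {ν : Fin n → ℤ} {x : A} (hx : x ∈ D.rw' ν) (y) (w) : wd (D.l y) w x ∈ D.rw' ν := by
  induction w with
  | nil => simpa
  | cons j w ih => rw [wd_cons]; exact rw_l ih _ _
theorem lw_wr {ν : Fin n → ℤ} {x : A} (hx : x ∈ D.lw ν) (y) (w) : wd (D.r y) w x ∈ D.lw ν := by
  induction w with
  | nil => simpa
  | cons j w ih => rw [wd_cons]; exact lw_r ih _ _

theorem r_wl (x y : G4) (w j) (a : A) : D.r y j (wd (D.l x) w a) = wd (D.l x) w (D.r y j a) := by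
  have := lr_wd (D := D) x y w [j] a
  simpa [wd_cons] using this.symm

theorem IsM.qc0 (hc : D.IsM ϖ η c) {μ μ' : Fin n → ℤ} {f : A} (hf : ∀ j, D.r .F j f = 0)
    (hl : f ∈ D.lw μ) (hr : f ∈ D.rw' μ') : ∃ s : ℂ, s ≠ 0 ∧ f * c = s • (c * f) := by
  have rF0 : ∀ w j, D.r .F j (wd (D.l .E) w f) = 0 := by
    intro w j; rw [r_wl, hf, map_zero]
  have e1 : ∀ w w', D.eps (wd (D.l .F) w (wd (D.l .E) w' (f * c))) =
      D.eps (wd (D.l .E) w' f) * D.eps (wd (D.r .F) w.reverse c) := by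
    intro w w'
    rw [eps_wd, hc.wlE_right, wrF_left (rF0 w'), map_mul]
  have e2 : ∀ w w', D.eps (wd (D.l .F) w (wd (D.l .E) w' (c * f))) =
      D.q ^ (D.ws ϖ w') * D.q ^ (- D.ws μ' w.reverse) *
      (D.eps (wd (D.l .E) w' f) * D.eps (wd (D.r .F) w.reverse c)) := by
    intro w w'
    rw [eps_wd, hc.wlE_left, map_smul, wrF_right (rF0 w') (rw_wlE hr _ w'), map_smul, map_smul, map_mul]
    simp only [smul_eq_mul]; ring
  have hz : ∀ s : ℂ, f * c - s • (c * f) ∈ D.lw (μ + ϖ) := fun s =>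
    Submodule.sub_mem _ (lw_mul hl hc.lw) (Submodule.smul_mem _ _ (by rw [add_comm]; exact lw_mul hc.lw hl))
  have hs : ∀ s : ℂ, (∀ (w w' : List (Fin n)), D.eps (wd (D.l .E) w' f) * D.eps (wd (D.r .F) w.reverse c) ≠ 0 →
      s * (D.q ^ (D.ws ϖ w') * D.q ^ (- D.ws μ' w.reverse)) = 1) → f * c = s • (c * f) := by
    intro s h
    rw [← sub_eq_zero]
    refine sep_FE (hz s) fun w w' => ?_
    rw [map_sub, map_sub, map_sub, map_smul, map_smul, map_smul, e1, e2, smul_eq_mul]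
    by_cases h0 : D.eps (wd (D.l .E) w' f) * D.eps (wd (D.r .F) w.reverse c) = 0
    · rw [h0]; simp
    · rw [← mul_assoc, h w w' h0]; simp
  by_cases hex : ∃ w w' : List (Fin n), D.eps (wd (D.l .E) w' f) * D.eps (wd (D.r .F) w.reverse c) ≠ 0
  · obtain ⟨w, w', h0⟩ := hex
    have hne : D.q ^ (D.ws ϖ w') * D.q ^ (- D.ws μ' w.reverse) ≠ 0 :=
      mul_ne_zero (zpow_ne_zero _ D.q_ne) (zpow_ne_zero _ D.q_ne)
    refine ⟨(D.q ^ (D.ws ϖ w') * D.q ^ (- D.ws μ' w.reverse))⁻¹, inv_ne_zero hne, hs _ ?_⟩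
    intro u u' h1
    have a1 := eps_wt (D.l_tri.wt_we hl w') (rw_wlE hr _ w') (left_ne_zero_of_mul h0)
    have a2 := eps_wt (D.l_tri.wt_we hl u') (rw_wlE hr _ u') (left_ne_zero_of_mul h1)
    have b1 := eps_wt (lw_wr hc.lw _ w.reverse) (D.r_tri.wt_we hc.rw w.reverse) (right_ne_zero_of_mul h0)
    have b2 := eps_wt (lw_wr hc.lw _ u.reverse) (D.r_tri.wt_we hc.rw u.reverse) (right_ne_zero_of_mul h1)
    rw [D.ws_eq (add_left_cancel (a2.trans a1.symm)) ϖ, D.ws_eq (add_left_cancel (b2.symm.trans b1)) μ',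
      inv_mul_cancel₀ hne]
  · push Not at hex
    exact ⟨1, one_ne_zero, hs 1 fun w w' h => absurd (hex w w') h⟩

theorem IsM.qcE (hc : D.IsM ϖ η c) {f : A} (h : ∃ s : ℂ, s ≠ 0 ∧ f * c = s • (c * f)) (j) :
    ∃ s : ℂ, s ≠ 0 ∧ D.l .E j f * c = s • (c * D.l .E j f) := by
  obtain ⟨s, hs, h⟩ := h
  refine ⟨s * D.q ^ (ϖ j * (D.d j : ℤ)), mul_ne_zero hs (zpow_ne_zero _ D.q_ne), ?_⟩
  rw [← hc.lE_right, h, map_smul, hc.lE_left, smul_smul]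
theorem IsM.qcE' (hc : D.IsM ϖ η c) {f : A} (h : ∃ s : ℂ, s ≠ 0 ∧ f * c = s • (c * f)) (j) :
    ∃ s : ℂ, s ≠ 0 ∧ D.r .E j f * c = s • (c * D.r .E j f) := by
  obtain ⟨s, hs, h⟩ := h
  refine ⟨s * D.q ^ (η j * (D.d j : ℤ)), mul_ne_zero hs (zpow_ne_zero _ D.q_ne), ?_⟩
  rw [← hc.rE_right, h, map_smul, hc.rE_left, smul_smul]

theorem IsM.normal (hc : D.IsM ϖ η c) : IsNormalElem c := by
  suffices h : ∀ a : A, (∃ b, c * a = b * c) ∧ (∃ b, a * c = c * b) from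
    ⟨fun a => (h a).1, fun a => (h a).2⟩
  let S : Subalgebra ℂ A :=
    { carrier := {a | (∃ b, c * a = b * c) ∧ (∃ b, a * c = c * b)}
      mul_mem' := by
        rintro a a' ⟨⟨b, hb⟩, ⟨d, hd⟩⟩ ⟨⟨b', hb'⟩, ⟨d', hd'⟩⟩
        exact ⟨⟨b * b', by rw [← mul_assoc, hb, mul_assoc, hb', mul_assoc]⟩,
          ⟨d * d', by rw [mul_assoc, hd', ← mul_assoc, hd, mul_assoc]⟩⟩
      add_mem' := by
        rintro a a' ⟨⟨b, hb⟩, ⟨d, hd⟩⟩ ⟨⟨b', hb'⟩, ⟨d', hd'⟩⟩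
        exact ⟨⟨b + b', by rw [mul_add, add_mul, hb, hb']⟩, ⟨d + d', by rw [mul_add, add_mul, hd, hd']⟩⟩
      algebraMap_mem' := fun r => ⟨⟨algebraMap ℂ A r, (Algebra.commutes r c).symm⟩,
        ⟨algebraMap ℂ A r, Algebra.commutes r c⟩⟩ }
  suffices hS : S = ⊤ by
    intro a
    have : a ∈ S := by rw [hS]; trivial
    exact this
  rw [eq_top_iff, ← D.gen, Algebra.adjoin_le_iff]
  rintro _ ⟨i, ξ, v, rfl⟩
  have base : ∃ s : ℂ, s ≠ 0 ∧ D.cf i (D.xhi i) (D.vlo i) * c = s • (c * D.cf i (D.xhi i) (D.vlo i)) :=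
    hc.qc0 (fun j => by rw [D.r_cf, D.supp_hi_f i (D.xhi_supp i)]; simp) (lw_cf (D.vlo_wt i))
      (rw_cf (D.xhi_supp i))
  have hl : ∀ w, ∃ s : ℂ, s ≠ 0 ∧ wd (D.l .E) w (D.cf i (D.xhi i) (D.vlo i)) * c =
      s • (c * wd (D.l .E) w (D.cf i (D.xhi i) (D.vlo i))) := by
    intro w
    induction w with
    | nil => simpa using base
    | cons j w ih => rw [wd_cons]; exact hc.qcE ih j
  have hr : ∀ w' w, ∃ s : ℂ, s ≠ 0 ∧ wd (D.r .E) w' (wd (D.l .E) w (D.cf i (D.xhi i) (D.vlo i))) * c =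
      s • (c * wd (D.r .E) w' (wd (D.l .E) w (D.cf i (D.xhi i) (D.vlo i)))) := by
    intro w' w
    induction w' with
    | nil => simpa using hl w
    | cons j w ih => rw [wd_cons]; exact hc.qcE' ih j
  have hv : v ∈ spanW (D.X i .E) (Submodule.span ℂ {D.vlo i}) := by
    rw [D.spanE_top i (D.vlo_ne i) (D.vlo_wt i) (D.vlo_f i)]; trivial
  have hξ : ξ ∈ spanW (dualOp (D.X i) .E) (Submodule.span ℂ {D.xhi i}) := by
    rw [D.dual_spanE_top i (D.xhi_ne i) (D.xhi_supp i) (D.supp_hi_f i (D.xhi_supp i))]; trivial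
  suffices spanW (dualOp (D.X i) .E) (Submodule.span ℂ {D.xhi i}) ≤
    (Subalgebra.toSubmodule S).comap ((D.cf i).flip v) from this hξ
  refine spanW_le fun w g hg => ?_
  suffices spanW (D.X i .E) (Submodule.span ℂ {D.vlo i}) ≤
    (Subalgebra.toSubmodule S).comap (D.cf i (wd (dualOp (D.X i) .E) w g)) from this hv
  refine spanW_le fun w' g' hg' => ?_
  obtain ⟨a, rfl⟩ := Submodule.mem_span_singleton.1 hg
  obtain ⟨b, rfl⟩ := Submodule.mem_span_singleton.1 hg'
  simp only [map_smul, Submodule.mem_comap, LinearMap.smul_apply]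
  refine Submodule.smul_mem _ _ (Submodule.smul_mem _ _ ?_)
  rw [← r_wd_cf, ← l_wd_cf]
  obtain ⟨s, hs, h⟩ := hr w w'
  refine ⟨⟨s⁻¹ • wd (D.r .E) w (wd (D.l .E) w' (D.cf i (D.xhi i) (D.vlo i))), ?_⟩,
    ⟨s • wd (D.r .E) w (wd (D.l .E) w' (D.cf i (D.xhi i) (D.vlo i))), ?_⟩⟩
  · rw [smul_mul_assoc, h, smul_smul, inv_mul_cancel₀ hs, one_smul]
  · rw [mul_smul_comm]; exact h

/-- the minus-type coefficient -/
theorem isM_cf {i : D.I} {ξ : Module.Dual ℂ (D.V i)} {v : D.V i} (hv : v ∈ D.wt (D.X i .K) (D.hw i))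
    (hξ : D.supp i (D.act D.w0 (D.hw i)) ξ) : D.IsM (D.hw i) (D.act D.w0 (D.hw i)) (D.cf i ξ v) where
  lE j := by rw [D.l_cf, D.hi_e i hv]; simp
  rE j := by rw [D.r_cf, D.supp_low_e i hξ]; simp
  lw := lw_cf hv
  rw := rw_cf hξ

theorem cf_ne {i : D.I} {ξ : Module.Dual ℂ (D.V i)} {v : D.V i} (hξ : ξ ≠ 0) (hv : v ≠ 0) :
    D.cf i ξ v ≠ 0 := by
  intro h
  let N : Submodule ℂ (Module.Dual ℂ (D.V i)) := LinearMap.ker ((D.cf i).flip v)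
  have hN2 : N = ⊤ := by
    refine D.dual_simple i N ?_ ⟨ξ, h, hξ⟩
    intro x j ζ hζ
    have : D.cf i ζ v = 0 := hζ
    show D.cf i (ζ ∘ₗ D.X i x j) v = 0
    rw [← D.r_cf, this, map_zero]
  apply hv
  rw [← Module.forall_dual_apply_eq_zero_iff ℂ]
  intro ζ
  have : ζ ∈ N := by rw [hN2]; trivial
  have h2 : D.cf i ζ v = 0 := this
  rw [← D.eps_cf i, h2, map_zero]

end QD
open scoped TensorProduct

/-- antipode-twisted dual operators -/
noncomputable def starOp {n : ℕ} {M : Type} [AddCommGroup M] [Module ℂ M]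
    (X : G4 → Fin n → Module.End ℂ M) : G4 → Fin n → Module.End ℂ (Module.Dual ℂ M)
  | .E, i => -(X .Ki i ∘ₗ X .E i).dualMap
  | .F, i => -(X .F i ∘ₗ X .K i).dualMap
  | .K, i => (X .Ki i).dualMap
  | .Ki, i => (X .K i).dualMap

theorem Tri.star {n : ℕ} {C : CD n} {M : Type} [AddCommGroup M] [Module ℂ M]
    {X : G4 → Fin n → Module.End ℂ M} (T : Tri C X) : Tri C (starOp X) where
  kki := by intro i m; ext v; simp [starOp, T.kki]
  kik := by intro i m; ext v; simp [starOp, T.kik]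
  kk := by intro i j m; ext v; simp [starOp, T.kiki i j]
  ke := by
    intro i j m; ext v
    simp only [starOp, LinearMap.dualMap_apply, LinearMap.smul_apply, LinearMap.neg_apply,
      LinearMap.comp_apply]
    rw [T.kiki i j, T.kie i j]
    simp only [map_smul, smul_neg, smul_smul]
    rw [← zpow_add₀ C.q_ne]; simp
  kf := by
    intro i j m; ext v
    simp only [starOp, LinearMap.dualMap_apply, LinearMap.smul_apply, LinearMap.neg_apply,
      LinearMap.comp_apply]
    rw [T.kif i j]
    have : X .Ki i (X .K j v) = X .K j (X .Ki i v) := by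
      have := T.kk i j (X .Ki i v)
      rw [T.kki] at this
      rw [← T.kik i (X .K j (X .Ki i v)), this]
    rw [this]
    simp only [map_smul, smul_neg, smul_smul]
    rw [← zpow_add₀ C.q_ne]; simp
  ef := by
    intro i j m; ext v
    have hc : ∀ v, X .Ki i (X .K j v) = X .K j (X .Ki i v) := by
      intro v
      have := T.kk i j (X .Ki i v)
      rw [T.kki] at this
      rw [← T.kik i (X .K j (X .Ki i v)), this]
    simp only [starOp, LinearMap.dualMap_apply, LinearMap.sub_apply, LinearMap.neg_apply,
      LinearMap.comp_apply]
    have h1 : X .F j (X .K j (X .Ki i (X .E i v))) =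
        C.q ^ ((C.d i : ℤ) * C.a i j - (C.d i : ℤ) * C.a i i) • X .F j (X .E i (X .Ki i (X .K j v))) := by
      rw [T.kie, map_smul, T.ke, smul_smul, map_smul, ← zpow_add₀ C.q_ne, hc, C.a_symm i j]
      congr 2; ring
    have h2 : X .Ki i (X .E i (X .F j (X .K j v))) =
        C.q ^ ((C.d i : ℤ) * C.a i j - (C.d i : ℤ) * C.a i i) • X .E i (X .F j (X .Ki i (X .K j v))) := by
      rw [T.kie, T.kif, map_smul, smul_smul, ← zpow_add₀ C.q_ne]
      congr 2; ring
    rw [h1, h2]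
    simp only [neg_neg]
    rw [← map_sub, ← smul_sub, ← neg_sub (X .E i _), T.ef]
    by_cases h : i = j
    · subst h
      simp [T.kik]
      ring
    · simp [h]

theorem Tri.prod {n : ℕ} {C : CD n} {M N : Type} [AddCommGroup M] [Module ℂ M] [AddCommGroup N] [Module ℂ N]
    {X : G4 → Fin n → Module.End ℂ M} (T : Tri C X)
    {Y : G4 → Fin n → Module.End ℂ N} (S : Tri C Y) :
    Tri C (fun x i => (X x i).prodMap (Y x i)) where
  kki := by intro i m; simp [T.kki, S.kki]
  kik := by intro i m; simp [T.kik, S.kik]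
  kk := by intro i j m; simp [T.kk i j, S.kk i j]
  ke := by intro i j m; simp [T.ke i j, S.ke i j]
  kf := by intro i j m; simp [T.kf i j, S.kf i j]
  ef := by
    intro i j m
    have h1 := T.ef i j m.1
    have h2 := S.ef i j m.2
    ext
    · simp [h1]; split_ifs <;> simp
    · simp [h2]; split_ifs <;> simp

namespace QD
variable {n : ℕ} {A : Type} [Ring A] [Algebra ℂ A] {D : QD n A}

theorem star_dual {i : D.I} (N : Submodule ℂ (Module.Dual ℂ (D.V i)))
    (hN : ∀ x j, ∀ ξ ∈ N, starOp (D.X i) x j ξ ∈ N) (x j) :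
    ∀ ξ ∈ N, dualOp (D.X i) x j ξ ∈ N := by
  intro ξ hξ
  have T := D.X_tri i
  cases x
  · have : dualOp (D.X i) .E j ξ = - starOp (D.X i) .E j (starOp (D.X i) .Ki j ξ) := by
      ext v; simp [dualOp, starOp, T.kki]
    rw [this]; exact N.neg_mem (hN _ _ _ (hN _ _ _ hξ))
  · have : dualOp (D.X i) .F j ξ = - starOp (D.X i) .K j (starOp (D.X i) .F j ξ) := by
      ext v; simp [dualOp, starOp, T.kki]
    rw [this]; exact N.neg_mem (hN _ _ _ (hN _ _ _ hξ))
  · exact hN .Ki j ξ hξ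
  · exact hN .K j ξ hξ

theorem exists_theta (i i' : D.I) (h : D.hw i' = - D.act D.w0 (D.hw i)) :
    ∃ θ : D.V i' →ₗ[ℂ] Module.Dual ℂ (D.V i),
      (∀ x j z, θ (D.X i' x j z) = starOp (D.X i) x j (θ z)) ∧ θ ≠ 0 := by
  have T := (D.X_tri i').prod (D.X_tri i).star
  set P : G4 → Fin n → Module.End ℂ (D.V i' × Module.Dual ℂ (D.V i)) :=
    fun x j => (D.X i' x j).prodMap (starOp (D.X i) x j) with hP
  set u : D.V i' × Module.Dual ℂ (D.V i) := (D.vhi i', D.xlo i) with hu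
  have hxlo : ∀ j, starOp (D.X i) .K j (D.xlo i) = D.q ^ (D.hw i' j * (D.d j : ℤ)) • D.xlo i := by
    have h1 := (D.supp_iff i).1 (D.xlo_supp i)
    have h2 := (D.X_tri i).dual.ki_wt h1
    intro j
    have := h2 j
    rw [h]
    simpa [starOp, dualOp, G4.tw] using this
  have huw : u ∈ D.wt (P .K) (D.hw i') := by
    intro j
    have := D.vhi_wt i' j
    simp [hP, hu, this, hxlo j]
  have hue : ∀ j, P .E j u = 0 := by
    intro j
    have h0 := D.supp_low_e i (D.xlo_supp i) j
    have h1 : starOp (D.X i) .E j (D.xlo i) = 0 := by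
      ext v
      simp only [starOp, LinearMap.neg_apply, LinearMap.dualMap_apply, LinearMap.comp_apply,
        LinearMap.zero_apply, neg_eq_zero]
      rw [(D.X_tri i).kie, map_smul]
      have := congrArg (fun f => f (D.X i .Ki j v)) h0
      simp only [LinearMap.comp_apply, LinearMap.zero_apply] at this
      rw [this, smul_zero]
    simp [hP, hu, D.vhi_e, h1]
  set Γ := spanW (P .F) (Submodule.span ℂ {u}) with hΓ
  have hst : ∀ x j, ∀ m ∈ Γ, P x j m ∈ Γ := T.spanW_f (span_wt_stable huw)
    (span_wt_stable (μ := -D.hw i') (T.mem_wt_ki.2 (by rw [neg_neg]; exact huw)))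
    (fun j => span_zero_stable (hue j))
  have huΓ : u ∈ Γ := le_spanW _ _ (Submodule.mem_span_singleton_self u)
  have hsurj : Γ.map (LinearMap.fst ℂ _ _) = ⊤ := by
    rcases D.X_simple i' (Γ.map (LinearMap.fst ℂ _ _)) (by
      rintro x j _ ⟨m, hm, rfl⟩
      exact ⟨_, hst x j m hm, rfl⟩) with h1 | h1
    · exfalso
      have : D.vhi i' ∈ Γ.map (LinearMap.fst ℂ _ _) := ⟨u, huΓ, rfl⟩
      rw [h1] at this
      exact D.vhi_ne i' (by simpa using this)
    · exact h1
  have hgr : ∀ m ∈ Γ, D.xhi i' m.1 = m.2 (D.vlo i) := by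
    have : Γ ≤ LinearMap.ker ((D.xhi i') ∘ₗ LinearMap.fst ℂ _ _ -
        (Module.Dual.eval ℂ _ (D.vlo i)) ∘ₗ LinearMap.snd ℂ (D.V i') (Module.Dual ℂ (D.V i))) := by
      refine spanW_le ?_
      intro w g hg
      obtain ⟨c, rfl⟩ := Submodule.mem_span_singleton.1 hg
      rw [LinearMap.mem_ker]
      cases w with
      | nil => simp [hu, D.xhi_vhi, D.xlo_vlo]
      | cons j w =>
        rw [wd_cons]
        set m := wd (P .F) w (c • u)
        have h1 := congrArg (fun f => f m.1) (D.supp_hi_f i' (D.xhi_supp i') j)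
        have h2 := D.vlo_wt i j
        simp only [LinearMap.comp_apply, LinearMap.zero_apply] at h1
        simp [hP, h1, starOp, h2, D.vlo_f]
    intro m hm
    have := this hm
    rw [LinearMap.mem_ker] at this
    simpa [sub_eq_zero] using this
  have hinj : ∀ ξ, ((0 : D.V i'), ξ) ∈ Γ → ξ = 0 := by
    intro ξ hξ
    by_contra h0
    have := D.dual_simple i (Γ.comap (LinearMap.inr ℂ (D.V i') (Module.Dual ℂ (D.V i))))
      (star_dual _ (by
        intro x j ξ hξ
        have := hst x j _ hξ
        simpa [hP] using this)) ⟨ξ, hξ, h0⟩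
    have h2 : D.xlo i ∈ (Γ.comap (LinearMap.inr ℂ (D.V i') (Module.Dual ℂ (D.V i)))) := by
      rw [this]; trivial
    have := hgr _ h2
    simp [D.xlo_vlo] at this
  have hbij : Function.Bijective ((LinearMap.fst ℂ (D.V i') (Module.Dual ℂ (D.V i))).domRestrict Γ) := by
    constructor
    · rw [injective_iff_map_eq_zero]
      rintro ⟨⟨z, ξ⟩, hm⟩ h0
      have hz : z = 0 := h0
      subst hz
      have := hinj ξ hm
      subst this; rfl
    · intro z
      have : z ∈ Γ.map (LinearMap.fst ℂ _ _) := by rw [hsurj]; trivial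
      obtain ⟨m, hm, rfl⟩ := this
      exact ⟨⟨m, hm⟩, rfl⟩
  let e := LinearEquiv.ofBijective _ hbij
  have he : ∀ z, (e.symm z).1.1 = z := fun z => e.apply_symm_apply z
  have huniq : ∀ z ξ, (z, ξ) ∈ Γ → (e.symm z).1.2 = ξ := by
    intro z ξ hm
    have h1 : (e.symm z).1 - (z, ξ) ∈ Γ := Γ.sub_mem (e.symm z).2 hm
    have h2 : (e.symm z).1 - (z, ξ) = (0, (e.symm z).1.2 - ξ) := by
      ext
      · simp [he]
      · simp
    rw [h2] at h1
    exact sub_eq_zero.1 (hinj _ h1)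
  refine ⟨LinearMap.snd ℂ _ _ ∘ₗ Γ.subtype ∘ₗ e.symm.toLinearMap, ?_, ?_⟩
  · intro x j z
    simp only [LinearMap.comp_apply, LinearEquiv.coe_coe, Submodule.subtype_apply, LinearMap.snd_apply]
    apply huniq
    have := hst x j _ (e.symm z).2
    simp only [hP, LinearMap.prodMap_apply, he] at this
    exact this
  · intro h0
    have := congrArg (fun f => f (D.vhi i')) h0
    simp only [LinearMap.comp_apply, LinearEquiv.coe_coe, Submodule.subtype_apply, LinearMap.snd_apply,
      LinearMap.zero_apply] at this
    rw [huniq _ _ huΓ] at this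
    exact D.xlo_ne i this

/-- dual basis identity -/
theorem dual_swap {V P κ : Type} [Fintype κ] [AddCommGroup V] [Module ℂ V]
    [AddCommGroup P] [Module ℂ P] (b : Module.Basis κ ℂ V)
    (M : V →ₗ[ℂ] Module.Dual ℂ V →ₗ[ℂ] P) (T : Module.End ℂ V) :
    ∑ k, M (T (b k)) (b.coord k) = ∑ k, M (b k) (b.coord k ∘ₗ T) := by
  classical
  have h1 : ∀ k, T (b k) = ∑ l, b.coord l (T (b k)) • b l := fun k => (b.sum_repr _).symm
  have h2 : ∀ l, b.coord l ∘ₗ T = ∑ k, b.coord l (T (b k)) • b.coord k := by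
    intro l
    refine b.ext fun m => ?_
    simp [Finsupp.single_apply]
  have e1 : ∑ k, M (T (b k)) (b.coord k) = ∑ k, ∑ l, b.coord l (T (b k)) • M (b l) (b.coord k) := by
    refine Finset.sum_congr rfl fun k _ => ?_
    have h3 : M (T (b k)) = ∑ l, b.coord l (T (b k)) • M (b l) := by
      conv_lhs => rw [h1 k]
      simp only [map_sum, map_smul]
    rw [h3]; simp only [LinearMap.sum_apply, LinearMap.smul_apply]
  have e2 : ∑ l, M (b l) (b.coord l ∘ₗ T) = ∑ l, ∑ k, b.coord l (T (b k)) • M (b l) (b.coord k) := by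
    refine Finset.sum_congr rfl fun l _ => ?_
    rw [h2 l]
    simp
  rw [e1, e2, Finset.sum_comm]

theorem r_inv {m : A} (hE : ∀ j, D.r .E j m = 0) (hF : ∀ j, D.r .F j m = 0)
    (hK : ∀ j, D.r .K j m = m) (h0 : D.eps m = 0) : m = 0 := by
  have hKi : ∀ m, (∀ j, D.r .K j m = m) → ∀ j, D.r .Ki j m = m := by
    intro m hK j; have := D.rkik j m; rwa [hK j] at this
  let N : Submodule ℂ A := (⨅ j, LinearMap.ker (D.r .E j)) ⊓ (⨅ j, LinearMap.ker (D.r .F j)) ⊓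
    (⨅ j, LinearMap.ker (D.r .K j - 1)) ⊓ LinearMap.ker D.eps.toLinearMap
  have hN : ∀ m, m ∈ N ↔ (∀ j, D.r .E j m = 0) ∧ (∀ j, D.r .F j m = 0) ∧
    (∀ j, D.r .K j m = m) ∧ D.eps m = 0 := by
    intro m; simp [N, sub_eq_zero, and_assoc]
  have : N = ⊥ := D.sep N (by
    intro x j m hm
    rw [hN] at hm ⊢
    obtain ⟨h1, h2, h3, h4⟩ := hm
    refine ⟨fun k => ?_, fun k => ?_, fun k => ?_, ?_⟩
    · rw [← D.lr, h1, map_zero]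
    · rw [← D.lr, h2, map_zero]
    · rw [← D.lr, h3]
    · rw [D.eps_lr]
      cases x
      · simp [h1]
      · simp [h2]
      · rw [h3, h4]
      · rw [hKi _ h3, h4]) (fun m hm => ((hN m).1 hm).2.2.2)
  have hm : m ∈ N := (hN m).2 ⟨hE, hF, hK, h0⟩
  rw [this] at hm
  simpa using hm

/-- the unit lemma -/
theorem one_mem_of_cf (i : D.I) {v : D.V i} (hv : v ≠ 0) (J : Submodule ℂ A)
    (hJ : ∀ a, ∀ p ∈ J, a * p ∈ J) (hc : ∀ ξ, D.cf i ξ v ∈ J) : (1 : A) ∈ J := by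
  obtain ⟨i', hi'⟩ := D.hw_surj (- D.act D.w0 (D.hw i)) (by
    intro j
    have := D.w0_act (D.hw i) (D.hw_nonneg i) j
    simpa using this)
  obtain ⟨θ, hθ, hθ0⟩ := exists_theta i i' hi'
  have hrad : ∃ z, θ z v ≠ 0 := by
    by_contra hcon
    push Not at hcon
    have := D.dual_simple i (LinearMap.range θ) (star_dual _ (by
      rintro x j _ ⟨z, rfl⟩
      exact ⟨_, hθ x j z⟩)) (by
        by_contra h
        push Not at h
        exact hθ0 (by ext1 z; exact h _ ⟨z, rfl⟩))
    apply hv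
    rw [← Module.forall_dual_apply_eq_zero_iff ℂ]
    intro φ
    have hφ : φ ∈ LinearMap.range θ := by rw [this]; trivial
    obtain ⟨z, rfl⟩ := hφ
    exact hcon z
  obtain ⟨z, hz⟩ := hrad
  set b := Module.finBasis ℂ (D.V i)
  let M : D.V i →ₗ[ℂ] Module.Dual ℂ (D.V i) →ₗ[ℂ] A :=
    (LinearMap.mul ℂ A).compl₁₂ ((D.cf i').flip z ∘ₗ θ.flip) ((D.cf i).flip v)
  have hM : ∀ x ξ, M x ξ = D.cf i' (θ.flip x) z * D.cf i ξ v := fun x ξ => rfl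
  let Φ : A := ∑ k, M (b k) (b.coord k)
  have fE : ∀ x j, (θ.flip x) ∘ₗ D.X i' .E j = - θ.flip (D.X i .Ki j (D.X i .E j x)) := by
    intro x j; ext y; simp [hθ, starOp]
  have fF : ∀ x j, (θ.flip x) ∘ₗ D.X i' .F j = - θ.flip (D.X i .F j (D.X i .K j x)) := by
    intro x j; ext y; simp [hθ, starOp]
  have fK : ∀ x j, (θ.flip x) ∘ₗ D.X i' .K j = θ.flip (D.X i .Ki j x) := by
    intro x j; ext y; simp [hθ, starOp]
  have T := D.X_tri i
  have hΦ : Φ - D.eps Φ • 1 = 0 := by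
    apply r_inv (D := D)
    · intro j
      have h1 := dual_swap b (M ∘ₗ D.X i .Ki j) (D.X i .E j)
      simp only [LinearMap.comp_apply, hM] at h1
      rw [map_sub, map_smul, D.rE_one, smul_zero, sub_zero]
      simp only [Φ, map_sum, hM, D.rE_mul, D.r_cf, fE, fK, Finset.sum_add_distrib]
      rw [← h1]
      simp
    · intro j
      have h1 := dual_swap b M (D.X i .F j)
      have h2 := dual_swap b (M ∘ₗ D.X i .F j ∘ₗ D.X i .K j) (D.X i .Ki j)
      simp only [LinearMap.comp_apply, hM, T.kki] at h1 h2
      rw [map_sub, map_smul, D.rF_one, smul_zero, sub_zero]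
      simp only [Φ, map_sum, hM, D.rF_mul, D.r_cf, fF, Finset.sum_add_distrib]
      rw [← h1, h2]
      simp
    · intro j
      have h2 := dual_swap b (M ∘ₗ D.X i .Ki j) (D.X i .K j)
      simp only [LinearMap.comp_apply, hM, T.kik] at h2
      rw [map_sub, map_smul, D.rK_one]
      congr 1
      simp only [Φ, map_sum, hM, D.rK_mul, D.r_cf, fK]
      rw [h2]
    · simp
  have hε : D.eps Φ = θ z v := by
    simp only [Φ, map_sum, hM, map_mul, D.eps_cf, LinearMap.flip_apply]
    have h1 := congrArg (θ z) (b.sum_repr v)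
    rw [← h1, map_sum]
    refine Finset.sum_congr rfl fun k _ => ?_
    rw [map_smul, smul_eq_mul, mul_comm]; rfl
  have hΦJ : Φ ∈ J := J.sum_mem fun k _ => hJ _ _ (hc _)
  rw [sub_eq_zero.1 hΦ, hε] at hΦJ
  have := J.smul_mem (θ z v)⁻¹ hΦJ
  rwa [smul_smul, inv_mul_cancel₀ hz, one_smul] at this

end QD
open scoped TensorProduct

namespace QD
variable {n : ℕ} {A : Type} [Ring A] [Algebra ℂ A] {D : QD n A}

theorem rsw (D : QD n A) : Tri D.toCD (fun x => D.r (x.sw).tw) := D.r_tri.sw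

theorem nil_r (a : A) (x : G4) (hx : x = .E ∨ x = .F) (j) : ∃ N, (D.r x j ^ N) a = 0 := by
  refine bw_ind (D := D) (P := fun a => ∃ N, (D.r x j ^ N) a = 0) ?_ ⟨0, by simp⟩ ?_ a
  · intro g a ha
    rcases hx with rfl | rfl
    · exact pow_of_nil (nil_rE ha.2) j
    · exact pow_of_nil (nil_rF ha.2) j
  · rintro a b ⟨N, hN⟩ ⟨M, hM⟩
    refine ⟨N + M, ?_⟩
    rw [map_add]
    have h1 : (D.r x j ^ (N + M)) a = 0 := by
      rw [add_comm, pow_add, Module.End.mul_apply, hN, map_zero]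
    have h2 : (D.r x j ^ (N + M)) b = 0 := by
      rw [pow_add, Module.End.mul_apply, hM, map_zero]
    rw [h1, h2, add_zero]

/-- an element killed by `rE j` of right weight `μ` with `μ j > 0` vanishes -/
theorem rE_zero {μ : Fin n → ℤ} {z : A} (hz : z ∈ D.rw' μ) (j) (hE : D.r .E j z = 0) :
    z = 0 ∨ (μ j ≤ 0 ∧ ∀ r : ℕ, -μ j < r → (D.r .F j ^ r) z = 0) := by
  by_cases h0 : z = 0
  · exact Or.inl h0
  right
  have hz' : z ∈ D.wt (D.r .Ki) (-μ) := D.r_tri.mem_wt_ki.2 (by rw [neg_neg]; exact hz)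
  have := D.rsw.hw_dom (μ := -μ) (u := z) hz' j hE h0 (nil_r z .F (Or.inr rfl) j)
  refine ⟨by have := this.1; simp at this; exact this, fun r hr => this.2 r (by simpa using hr)⟩

structure IsF (D : QD n A) (p : Fin n) (ϖ η : Fin n → ℤ) (c e : A) : Prop extends IsM D ϖ η c where
  c0 : c ≠ 0
  dom : ∀ j, 0 ≤ ϖ j
  ηp : η p = -1
  Dc : D.r .F p c = e
  De : D.r .F p e = 0
  Fj : ∀ j, j ≠ p → D.r .F j c = 0
  e0 : e ≠ 0
  ec : e * c = D.q ^ (D.d p : ℤ) • (c * e)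
  erw : e ∈ D.rw' (η + D.al p)
  Kc : D.r .K p c = D.q ^ (-(D.d p : ℤ)) • c
  Kic : D.r .Ki p c = D.q ^ (D.d p : ℤ) • c
  Kie : D.r .Ki p e = D.q ^ (-(D.d p : ℤ)) • e

theorem al_self (D : QD n A) (p) : D.al p p = 2 := by simp [CD.al, D.a_diag]

theorem isF {p : Fin n} {ϖ η : Fin n → ℤ} {c : A} (hc : D.IsM ϖ η c) (c0 : c ≠ 0)
    (dom : ∀ j, 0 ≤ ϖ j) (hη : η = - Pi.single p 1) : D.IsF p ϖ η c (D.r .F p c) := by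
  have nz := D.nzd
  have ηp : η p = -1 := by simp [hη]
  have ηj : ∀ j, j ≠ p → η j = 0 := by intro j hj; simp [hη, hj]
  have hef := D.r_tri.ef p p c
  simp only [G4.tw, hc.rE p, map_zero, zero_sub, if_true] at hef
  have Kc : D.r .K p c = D.q ^ (-(D.d p : ℤ)) • c := by
    rw [hc.rw p, ηp]; simp
  have Kic : D.r .Ki p c = D.q ^ (D.d p : ℤ) • c := by
    rw [rw_ki hc.rw p, ηp]; simp
  have hEe : D.r .E p (D.r .F p c) = c := by
    rw [Kc, Kic, ← sub_smul, smul_smul] at hef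
    have hq : (D.q ^ (D.d p : ℤ) - D.q ^ (-(D.d p : ℤ))) ≠ 0 := by
      have := Tri.qint_ne D.toCD p (x := 1) one_ne_zero
      simpa using this
    have h2 : (D.q ^ (D.d p : ℤ) - D.q ^ (-(D.d p : ℤ)))⁻¹ * (D.q ^ (-(D.d p : ℤ)) - D.q ^ (D.d p : ℤ)) = -1 := by
      rw [← neg_sub (D.q ^ (D.d p : ℤ)), mul_neg, inv_mul_cancel₀ hq]
    rw [h2] at hef
    simpa using hef
  have e0 : D.r .F p c ≠ 0 := by intro h; rw [h] at hEe; simp at hEe; exact c0 hEe.symm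
  have De : D.r .F p (D.r .F p c) = 0 := by
    have := ((rE_zero hc.rw p (hc.rE p)).resolve_left c0).2 2 (by rw [ηp]; norm_num)
    simpa [pow_two] using this
  have erw := rw_rF hc.rw p
  have hep : (η + D.al p) p = 1 := by simp [ηp, al_self]
  refine { hc with c0 := c0, dom := dom, ηp := ηp, Dc := rfl, De := De, Fj := ?_, e0 := e0, ec := ?_, erw := erw, Kc := Kc, Kic := Kic, Kie := ?_ }
  · intro j hj
    have := ((rE_zero hc.rw j (hc.rE j)).resolve_left c0).2 1 (by rw [ηj j hj]; norm_num)
    simpa using this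
  · set e := D.r .F p c with he
    obtain ⟨e1, h1⟩ := hc.normal.2 e
    have hw1 : e1 ∈ D.rw' (η + D.al p) := by
      intro j
      have h2 := congrArg (D.r .K j) h1
      rw [D.rK_mul, D.rK_mul, hc.rw j, erw j] at h2
      rw [mul_smul_comm, smul_mul_assoc, smul_mul_assoc, h1] at h2
      have h3 := smul_right_injective A (zpow_ne_zero (η j * (D.d j : ℤ)) D.q_ne) h2
      rw [← mul_smul_comm] at h3
      exact (mul_left_cancel₀ c0 h3).symm
    have hE1 : D.r .E p e1 = D.q ^ (D.d p : ℤ) • c := by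
      have h2 := congrArg (D.r .E p) h1
      rw [hc.rE_right, hc.rE_left, hEe, ηp, ← mul_smul_comm] at h2
      have h3 := mul_left_cancel₀ c0 h2
      rw [h3, smul_smul, ← zpow_add₀ D.q_ne]; simp
    have hz : e1 - D.q ^ (D.d p : ℤ) • e = 0 := by
      have hw : e1 - D.q ^ (D.d p : ℤ) • e ∈ D.rw' (η + D.al p) :=
        Submodule.sub_mem _ hw1 (Submodule.smul_mem _ _ erw)
      rcases rE_zero hw p (by rw [map_sub, map_smul, hE1, hEe, sub_self]) with h | h
      · exact h
      · have := h.1; rw [hep] at this; omega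
    rw [h1, sub_eq_zero.1 hz, mul_smul_comm]
  · rw [rw_ki erw p, hep]; simp

namespace IsF
variable {p : Fin n} {ϖ η : Fin n → ℤ} {c e : A}

theorem D_c (h : D.IsF p ϖ η c e) (b : A) : D.r .F p (c * b) = e * D.r .Ki p b + c * D.r .F p b := by
  rw [D.rF_mul, h.Dc]
theorem D_e (h : D.IsF p ϖ η c e) (b : A) : D.r .F p (e * b) = e * D.r .F p b := by
  rw [D.rF_mul, h.De, zero_mul, zero_add]
theorem D_rc (h : D.IsF p ϖ η c e) (b : A) :
    D.r .F p (b * c) = D.q ^ (D.d p : ℤ) • (D.r .F p b * c) + b * e := by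
  rw [D.rF_mul, h.Dc, h.Kic, mul_smul_comm]
theorem D_re (h : D.IsF p ϖ η c e) (b : A) :
    D.r .F p (b * e) = D.q ^ (-(D.d p : ℤ)) • (D.r .F p b * e) := by
  rw [D.rF_mul, h.De, h.Kie, mul_smul_comm, mul_zero, add_zero]

theorem Dm_e (h : D.IsF p ϖ η c e) (m : ℕ) (b : A) : (D.r .F p ^ m) (e * b) = e * (D.r .F p ^ m) b := by
  induction m with
  | zero => simp
  | succ m ih => rw [pow_succ', Module.End.mul_apply, ih, h.D_e, Module.End.mul_apply]

theorem Dm_re (h : D.IsF p ϖ η c e) (m : ℕ) (b : A) :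
    (D.r .F p ^ m) (b * e) = (D.q ^ (-(D.d p : ℤ))) ^ m • ((D.r .F p ^ m) b * e) := by
  induction m with
  | zero => simp
  | succ m ih =>
    rw [pow_succ', Module.End.mul_apply, ih, map_smul, h.D_re, Module.End.mul_apply, smul_smul, ← pow_succ]

theorem geom_ne {t : ℂ} (ht : ∀ m : ℕ, t ^ (m + 1) ≠ 1) (m : ℕ) : ∑ i ∈ Finset.range (m + 1), t ^ i ≠ 0 := by
  intro h
  have := mul_geom_sum t (m + 1)
  rw [h, mul_zero] at this
  exact ht m (sub_eq_zero.1 this.symm)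

theorem Dm_c (h : D.IsF p ϖ η c e) {μ : Fin n → ℤ} {b : A} (hb : b ∈ D.rw' μ) (m : ℕ) :
    (D.r .F p ^ (m + 1)) (c * b) = c * (D.r .F p ^ (m + 1)) b +
      (D.q ^ (-(μ p * (D.d p : ℤ))) * ∑ i ∈ Finset.range (m + 1), (D.q ^ (-2 * (D.d p : ℤ))) ^ i) •
        (e * (D.r .F p ^ m) b) := by
  induction m with
  | zero => simp [h.D_c, rw_ki hb p, add_comm]
  | succ m ih =>
    rw [pow_succ', Module.End.mul_apply, ih, map_add, map_smul, h.D_c, h.D_e,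
      rw_ki (rw_rFpow hb p (m + 1)) p, Module.End.mul_apply,
      Finset.sum_range_succ _ (m + 1), mul_add]
    have : D.q ^ (-((μ + (m + 1) • D.al p) p * (D.d p : ℤ))) =
      D.q ^ (-(μ p * (D.d p : ℤ))) * (D.q ^ (-2 * (D.d p : ℤ))) ^ (m + 1) := by
      rw [← zpow_natCast, ← zpow_mul, ← zpow_add₀ D.q_ne]
      congr 1
      simp [al_self]; ring
    rw [this, mul_smul_comm, add_smul, pow_succ' (D.r .F p) m, Module.End.mul_apply]
    abel

theorem Dm_rc (h : D.IsF p ϖ η c e) (b : A) (m : ℕ) :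
    ∃ s : ℂ, (D.r .F p ^ (m + 1)) (b * c) = s • ((D.r .F p ^ (m + 1)) b * c) +
      ((D.q ^ (-(D.d p : ℤ))) ^ m * ∑ i ∈ Finset.range (m + 1), (D.q ^ (2 * (D.d p : ℤ))) ^ i) •
        ((D.r .F p ^ m) b * e) := by
  suffices H : (D.r .F p ^ (m + 1)) (b * c) = (D.q ^ (D.d p : ℤ)) ^ (m + 1) • ((D.r .F p ^ (m + 1)) b * c) +
      ((D.q ^ (-(D.d p : ℤ))) ^ m * ∑ i ∈ Finset.range (m + 1), (D.q ^ (2 * (D.d p : ℤ))) ^ i) •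
        ((D.r .F p ^ m) b * e) from ⟨_, H⟩
  induction m with
  | zero => simp [h.D_rc]
  | succ m ih =>
    rw [pow_succ', Module.End.mul_apply, ih, map_add, map_smul, map_smul, h.D_rc, h.D_re,
      pow_succ' _ (m + 1), Module.End.mul_apply,
      Finset.sum_range_succ _ (m + 1), mul_add, add_smul, pow_succ' (D.r .F p) m, Module.End.mul_apply,
      smul_add, smul_smul, smul_smul]
    have : (D.q ^ (-(D.d p : ℤ))) ^ (m + 1) * (D.q ^ (2 * (D.d p : ℤ))) ^ (m + 1) = (D.q ^ (D.d p : ℤ)) ^ (m + 1) := by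
      rw [← mul_pow, ← zpow_add₀ D.q_ne]; congr 2; ring
    rw [this, pow_succ (D.q ^ (-(D.d p : ℤ))) m, mul_right_comm, mul_comm (D.q ^ (D.d p : ℤ)) ((D.q ^ (D.d p : ℤ)) ^ (m + 1))]
    abel

theorem th_ne (D : QD n A) (p : Fin n) (s : ℤ) (hs : s ≠ 0) (m : ℕ) :
    ∑ i ∈ Finset.range (m + 1), (D.q ^ (s * (D.d p : ℤ))) ^ i ≠ 0 :=
  geom_ne (fun k => D.qd_ne p s hs k) m

/-- `cA` as a subspace -/
def cI (c : A) : Submodule ℂ A := LinearMap.range (LinearMap.mulLeft ℂ c)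
theorem mem_cI {c x : A} : x ∈ cI c ↔ ∃ b, c * b = x := Iff.rfl
theorem cI_right {c x : A} (h : x ∈ cI c) (a : A) : x * a ∈ cI c := by
  obtain ⟨b, rfl⟩ := h; exact ⟨b * a, by simp [mul_assoc]⟩
theorem cI_left {c x : A} (hc : IsNormalElem c) (h : x ∈ cI c) (a : A) : a * x ∈ cI c := by
  obtain ⟨b, rfl⟩ := h
  obtain ⟨a', ha⟩ := hc.2 a
  refine ⟨a' * b, ?_⟩
  simp only [LinearMap.mulLeft_apply]
  rw [← mul_assoc, ← ha, mul_assoc]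

theorem bw_e (h : D.IsF p ϖ η c e) : e ∈ D.bw (ϖ, η + D.al p) :=
  ⟨by rw [← h.Dc]; exact lw_r h.lw _ _, h.erw⟩
theorem bw_c (h : D.IsF p ϖ η c e) : c ∈ D.bw (ϖ, η) := ⟨h.lw, h.rw⟩
theorem bw_F {g} {x : A} (h : x ∈ D.bw g) : D.r .F p x ∈ D.bw (g.1, g.2 + D.al p) :=
  ⟨lw_r h.1 _ _, rw_rF h.2 _⟩

theorem G1 (h : D.IsF p ϖ η c e) (N : ℕ) : ∀ g, ∀ f ∈ D.bw g, (D.r .F p ^ (N + 1)) f = 0 →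
    ∃ g', ∃ f' ∈ D.bw g', D.r .F p f' = 0 ∧ f' - e ^ N * f ∈ cI c := by
  induction N with
  | zero => intro g f hf h0; exact ⟨g, f, hf, by simpa using h0, by simp⟩
  | succ N ih =>
    intro g f hf h0
    have key := h.Dm_c (bw_F (p := p) hf).2 N
    set θ := D.q ^ (-((g.1, g.2 + D.al p).2 p * (D.d p : ℤ))) * ∑ i ∈ Finset.range (N + 1), (D.q ^ (-2 * (D.d p : ℤ))) ^ i
    have hθ : θ ≠ 0 := mul_ne_zero (zpow_ne_zero _ D.q_ne) (th_ne D p (-2) (by norm_num) N)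
    have e1 : (D.r .F p ^ (N + 1)) (D.r .F p f) = 0 := by
      rw [← Module.End.mul_apply, ← pow_succ]; exact h0
    rw [e1, mul_zero, zero_add] at key
    set f1 := e * f - θ⁻¹ • (c * D.r .F p f) with hf1
    have hb1 : f1 ∈ D.bw ((ϖ, η + D.al p) + g) := by
      refine Submodule.sub_mem _ (bw_mul h.bw_e hf) (Submodule.smul_mem _ _ ?_)
      have := bw_mul h.bw_c (bw_F (p := p) hf)
      convert this using 2
      ext <;> simp; ring
    obtain ⟨g', f', hf', h1, h2⟩ := ih _ f1 hb1 (by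
      rw [hf1, map_sub, map_smul, key, h.Dm_e, smul_smul, inv_mul_cancel₀ hθ, one_smul,
        pow_succ, Module.End.mul_apply, sub_self])
    refine ⟨g', f', hf', h1, ?_⟩
    have : f' - e ^ (N + 1) * f = (f' - e ^ N * f1) - θ⁻¹ • (e ^ N * (c * D.r .F p f)) := by
      rw [hf1, mul_sub, mul_smul_comm, pow_succ, mul_assoc]; abel
    rw [this]
    exact Submodule.sub_mem _ h2 (Submodule.smul_mem _ _ (cI_left h.normal ⟨_, rfl⟩ _))

theorem G2 (h : D.IsF p ϖ η c e) (N : ℕ) : ∀ g, ∀ f ∈ D.bw g, (D.r .F p ^ (N + 1)) f = 0 →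
    ∃ g', ∃ f' ∈ D.bw g', D.r .F p f' = 0 ∧ f' - f * e ^ N ∈ cI c := by
  induction N with
  | zero => intro g f hf h0; exact ⟨g, f, hf, by simpa using h0, by simp⟩
  | succ N ih =>
    intro g f hf h0
    obtain ⟨s, key⟩ := h.Dm_rc (D.r .F p f) N
    set θ := (D.q ^ (-(D.d p : ℤ))) ^ N * ∑ i ∈ Finset.range (N + 1), (D.q ^ (2 * (D.d p : ℤ))) ^ i
    have hθ : θ ≠ 0 := mul_ne_zero (pow_ne_zero _ (zpow_ne_zero _ D.q_ne)) (th_ne D p 2 (by norm_num) N)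
    have e1 : (D.r .F p ^ (N + 1)) (D.r .F p f) = 0 := by
      rw [← Module.End.mul_apply, ← pow_succ]; exact h0
    rw [e1, zero_mul, smul_zero, zero_add] at key
    set κ := (D.q ^ (-(D.d p : ℤ))) ^ (N + 1)
    set f1 := f * e - (κ * θ⁻¹) • (D.r .F p f * c) with hf1
    have hb1 : f1 ∈ D.bw (g + (ϖ, η + D.al p)) := by
      refine Submodule.sub_mem _ (bw_mul hf h.bw_e) (Submodule.smul_mem _ _ ?_)
      have := bw_mul (bw_F (p := p) hf) h.bw_c
      convert this using 2
      ext <;> simp; ring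
    obtain ⟨g', f', hf', h1, h2⟩ := ih _ f1 hb1 (by
      rw [hf1, map_sub, map_smul, key, h.Dm_re, smul_smul, mul_assoc, inv_mul_cancel₀ hθ, mul_one,
        pow_succ (D.r .F p), Module.End.mul_apply, sub_self])
    refine ⟨g', f', hf', h1, ?_⟩
    have : f' - f * e ^ (N + 1) = (f' - f1 * e ^ N) - (κ * θ⁻¹) • ((D.r .F p f * c) * e ^ N) := by
      rw [hf1, sub_mul, smul_mul_assoc, pow_succ', mul_assoc]; abel
    rw [this]
    refine Submodule.sub_mem _ h2 (Submodule.smul_mem _ _ (cI_right ?_ _))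
    exact cI_left h.normal ⟨1, by simp⟩ _

theorem G3 (h : D.IsF p ϖ η c e) {μ : Fin n → ℤ} {b : A} (hb : b ∈ D.rw' μ)
    (h0 : D.r .F p (c * b) = 0) : b = 0 := by
  have nz := D.nzd
  by_contra hb0
  obtain ⟨r, hr1, hr2⟩ := Tri.exists_top (D.r .F p) hb0 (nil_r b .F (Or.inr rfl) p)
  have key := h.Dm_c hb r
  rw [pow_succ, Module.End.mul_apply, h0, map_zero, ← pow_succ, pow_succ', Module.End.mul_apply, hr2, mul_zero,
    zero_add] at key
  have := (smul_eq_zero.1 key.symm).resolve_left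
    (mul_ne_zero (zpow_ne_zero _ D.q_ne) (th_ne D p (-2) (by norm_num) r))
  rcases mul_eq_zero.1 this with h1 | h1
  · exact h.e0 h1
  · exact hr1 h1

theorem bw_of_c (h : D.IsF p ϖ η c e) {g} {b : A} (hb : c * b ∈ D.bw g) : b ∈ D.bw (g - (ϖ, η)) := by
  have nz := D.nzd
  have h1 := comp_mul (h := g - (ϖ, η)) h.bw_c b
  rw [add_sub_cancel, comp_self hb] at h1
  rw [mul_left_cancel₀ h.c0 h1]
  exact comp_mem _ _

/-- homogeneous primality, up to powers of `e` -/
theorem prime_e (h : D.IsF p ϖ η c e) {g g'} {y z : A} (hy : y ∈ D.bw g) (hz : z ∈ D.bw g')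
    (hyz : y * z ∈ cI c) : ∃ N, e ^ N * y ∈ cI c ∨ z * e ^ N ∈ cI c := by
  have nz := D.nzd
  obtain ⟨N, hN⟩ := nil_r (D := D) y .F (Or.inr rfl) p
  obtain ⟨M, hM⟩ := nil_r (D := D) z .F (Or.inr rfl) p
  obtain ⟨gy, fy, hfy, hy1, hy2⟩ := h.G1 N g y hy (by rw [pow_succ', Module.End.mul_apply, hN, map_zero])
  obtain ⟨gz, fz, hfz, hz1, hz2⟩ := h.G2 M g' z hz (by rw [pow_succ', Module.End.mul_apply, hM, map_zero])
  have hprod : fy * fz ∈ cI c := by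
    have : fy * fz = (fy - e ^ N * y) * fz + e ^ N * y * (fz - z * e ^ M) + e ^ N * (y * z) * e ^ M := by
      noncomm_ring
    rw [this]
    exact Submodule.add_mem _ (Submodule.add_mem _ (cI_right hy2 _) (cI_left h.normal hz2 _))
      (cI_right (cI_left h.normal hyz _) _)
  obtain ⟨b, hb⟩ := hprod
  simp only [LinearMap.mulLeft_apply] at hb
  have hbw : c * b ∈ D.bw (gy + gz) := by rw [hb]; exact bw_mul hfy hfz
  have hD : D.r .F p (c * b) = 0 := by rw [hb, D.rF_mul, hy1, hz1]; simp
  have := h.G3 (h.bw_of_c hbw).2 hD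
  rw [this, mul_zero] at hb
  rcases mul_eq_zero.1 hb.symm with h1 | h1
  · exact ⟨N, Or.inl (by rw [h1, zero_sub] at hy2; simpa using Submodule.neg_mem _ hy2)⟩
  · exact ⟨M, Or.inr (by rw [h1, zero_sub] at hz2; simpa using Submodule.neg_mem _ hz2)⟩

/-- primality from the Hartogs property -/
theorem prime_of_hartogs (h : D.IsF p ϖ η c e) (H : ∀ y, e * y ∈ cI c → y ∈ cI c) (y z : A)
    (hyz : y * z ∈ cI c) : y ∈ cI c ∨ z ∈ cI c := by
  have nz := D.nzd
  refine graded_prime (D := D) (cI c) (fun a p hp => cI_left h.normal hp a) (fun a p hp => cI_right hp a) ?_ ?_ y z hyz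
  · rintro g _ ⟨b, rfl⟩
    have := comp_mul (h := g - (ϖ, η)) h.bw_c b
    rw [add_sub_cancel] at this
    exact ⟨_, this.symm⟩
  · intro g g' y hy z hz hyz
    obtain ⟨N, hN | hN⟩ := h.prime_e hy hz hyz
    · left
      clear hyz
      induction N with
      | zero => simpa using hN
      | succ N ih => exact ih (H _ (by rw [← mul_assoc, ← pow_succ']; exact hN))
    · right
      clear hyz hz
      induction N generalizing z with
      | zero => simpa using hN
      | succ N ih =>
        obtain ⟨t, ht⟩ := h.normal.2 z
        have h1 : z * e - e * D.r .Ki p t ∈ cI c := by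
          have := congrArg (D.r .F p) ht
          rw [h.D_rc, h.D_c] at this
          have h2 : z * e - e * D.r .Ki p t = c * D.r .F p t - D.q ^ (D.d p : ℤ) • (D.r .F p z * c) := by
            rw [sub_eq_sub_iff_add_eq_add, add_comm (z * e), this, add_comm]
          rw [h2]
          exact Submodule.sub_mem _ ⟨_, rfl⟩ (Submodule.smul_mem _ _ (cI_left h.normal ⟨1, by simp⟩ _))
        have h2 : e * (D.r .Ki p t * e ^ N) ∈ cI c := by
          have : e * (D.r .Ki p t * e ^ N) = z * e ^ (N + 1) - (z * e - e * D.r .Ki p t) * e ^ N := by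
            rw [pow_succ']; noncomm_ring
          rw [this]
          exact Submodule.sub_mem _ hN (cI_right h1 _)
        have h3 := ih _ (H _ h2)
        obtain ⟨b, hb⟩ := h3
        simp only [LinearMap.mulLeft_apply] at hb
        have h4 : t = D.q ^ (-(D.d p : ℤ)) • (c * D.r .K p b) := by
          have := congrArg (D.r .K p) hb
          rw [D.rkki, D.rK_mul, h.Kc, smul_mul_assoc] at this
          exact this.symm
        obtain ⟨b', hb'⟩ := h.normal.1 (D.r .K p b)
        refine ⟨D.q ^ (-(D.d p : ℤ)) • b', ?_⟩
        simp only [LinearMap.mulLeft_apply]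
        apply mul_right_cancel₀ h.c0
        rw [ht, h4, hb', mul_assoc, smul_mul_assoc]

end IsF
end QD
open scoped TensorProduct

/-- a localisation of `A` at the powers of `c` -/
structure Loc (A : Type) [Ring A] [Algebra ℂ A] (c : A) where
  B : Type
  [ring : Ring B]
  [alg : Algebra ℂ B]
  j : A →ₐ[ℂ] B
  inj : Function.Injective j
  unit : IsUnit (j c)
  frac : ∀ x : B, ∃ k a, (j c) ^ k * x = j a
  univ : ∀ (T : Type) [Ring T] [Algebra ℂ T] (f : A →ₐ[ℂ] T), IsUnit (f c) →
    ∃ g : B →ₐ[ℂ] T, ∀ a, g (j a) = f a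

attribute [instance] Loc.ring Loc.alg

open OreLocalization in
theorem exists_loc {A : Type} [Ring A] [Algebra ℂ A] [NoZeroDivisors A] {c : A} (c0 : c ≠ 0)
    (hc : IsNormalElem c) : Nonempty (Loc A c) := by
  have hpow : ∀ k r, ∃ r', c ^ k * r = r' * c ^ k := by
    intro k
    induction k with
    | zero => intro r; exact ⟨r, by simp⟩
    | succ k ih =>
      intro r
      obtain ⟨r1, h1⟩ := hc.1 r
      obtain ⟨r2, h2⟩ := ih r1
      refine ⟨r2, ?_⟩
      rw [pow_succ, mul_assoc, h1, ← mul_assoc, h2, mul_assoc]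
  obtain ⟨inst⟩ := (nonempty_oreSet_iff_of_noZeroDivisors (S := Submonoid.powers c)).2 (by
    rintro r ⟨_, k, rfl⟩
    obtain ⟨r', h⟩ := hpow k r
    exact ⟨r', ⟨c ^ k, k, rfl⟩, h⟩)
  have hnum : ∀ s : Submonoid.powers c, (numeratorHom (s : A) : OreLocalization (Submonoid.powers c) A) =
      ((s : A) /ₒ (1 : Submonoid.powers c)) := fun s => rfl
  let j : A →ₐ[ℂ] OreLocalization (Submonoid.powers c) A :=
    { (numeratorRingHom : A →+* OreLocalization (Submonoid.powers c) A) with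
      commutes' := fun r => rfl }
  have hj : ∀ a, j a = numeratorHom a := fun a => rfl
  refine ⟨⟨OreLocalization (Submonoid.powers c) A, j, ?_, ?_, ?_, ?_⟩⟩
  · refine numeratorHom_inj ?_
    rintro _ ⟨k, rfl⟩ x hx
    exact (mul_eq_zero.1 hx).resolve_left (pow_ne_zero k c0)
  · exact numerator_isUnit (⟨c, 1, by simp⟩ : Submonoid.powers c)
  · intro x
    induction x using OreLocalization.ind with
    | _ r s =>
      obtain ⟨_, k, rfl⟩ := s
      refine ⟨k, r, ?_⟩
      rw [← map_pow, hj, hj]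
      exact OreLocalization.mul_cancel (r := r) (s := (⟨c ^ k, k, rfl⟩ : Submonoid.powers c))
  · intro T _ _ f hf
    have hu : ∀ s : Submonoid.powers c, IsUnit ((f : A →* T).comp (Submonoid.powers c).subtype s) := by
      rintro ⟨_, k, rfl⟩
      simpa using hf.pow k
    let g := universalHom (f : A →+* T) (IsUnit.liftRight _ hu) (fun s => by
      rw [IsUnit.coe_liftRight]; rfl)
    have hg : ∀ a, g (numeratorHom a) = f a := fun a => universalHom_commutes _ _ _
    have hcm : ∀ r : ℂ, g (algebraMap ℂ _ r) = algebraMap ℂ T r := fun r => by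
      have := hg (algebraMap ℂ A r)
      rw [AlgHom.commutes] at this
      exact this
    exact ⟨{ g with commutes' := hcm }, hg⟩

namespace Loc
variable {A : Type} [Ring A] [Algebra ℂ A] {c : A} (L : Loc A c)

theorem isUnit_pow (k) : IsUnit (L.j c ^ k) := L.unit.pow k

theorem cancel {k} {x y : L.B} (h : L.j c ^ k * x = L.j c ^ k * y) : x = y :=
  (L.isUnit_pow k).mul_left_cancel h

/-- a linear map killing `A` and semilinear for `c` vanishes -/
theorem zero_of (Θ : L.B →ₗ[ℂ] L.B) (s : ℂ) (hs : s ≠ 0) (h0 : ∀ a, Θ (L.j a) = 0)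
    (hc : ∀ x, Θ (L.j c * x) = s • (L.j c * Θ x)) (x : L.B) : Θ x = 0 := by
  obtain ⟨k, a, h⟩ := L.frac x
  have : ∀ (k : ℕ) x, Θ (L.j c ^ k * x) = s ^ k • (L.j c ^ k * Θ x) := by
    intro k
    induction k with
    | zero => simp
    | succ k ih =>
      intro x
      rw [pow_succ' (L.j c), mul_assoc, hc, ih, mul_smul_comm, smul_smul, mul_assoc, pow_succ']
  have h1 := this k x
  rw [h, h0] at h1
  have h2 := (smul_eq_zero.1 h1.symm).resolve_left (pow_ne_zero k hs)
  exact L.cancel (k := k) (by rw [h2, mul_zero])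

theorem ext_aut (κ : A →ₐ[ℂ] A) (s : ℂ) (hs : s ≠ 0) (hc : κ c = s • c) :
    ∃ g : L.B →ₐ[ℂ] L.B, ∀ a, g (L.j a) = L.j (κ a) := by
  refine L.univ L.B (L.j.comp κ) ?_
  rw [AlgHom.comp_apply, hc, map_smul]
  exact (IsUnit.smul (Units.mk0 s hs) L.unit)

/-- extension of skew derivations -/
theorem ext_der (α β : A →ₐ[ℂ] A) (Da : A →ₗ[ℂ] A) (hD : ∀ x y, Da (x * y) = Da x * β y + α x * Da y)
    (s t : ℂ) (hs : s ≠ 0) (ht : t ≠ 0) (hα : α c = s • c) (hβ : β c = t • c)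
    (α' β' : L.B →ₐ[ℂ] L.B) (hα' : ∀ a, α' (L.j a) = L.j (α a)) (hβ' : ∀ a, β' (L.j a) = L.j (β a)) :
    ∃ Db : L.B →ₗ[ℂ] L.B, (∀ a, Db (L.j a) = L.j (Da a)) ∧
      ∀ x y, Db (x * y) = Db x * β' y + α' x * Db y := by
  have hD1 : Da 1 = 0 := by
    have := hD 1 1
    simpa using this
  have u1 : IsUnit (L.j (α c)) := by
    rw [hα, map_smul]; exact (IsUnit.smul (Units.mk0 s hs) L.unit)
  have u2 : IsUnit (L.j (β c)) := by
    rw [hβ, map_smul]; exact (IsUnit.smul (Units.mk0 t ht) L.unit)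
  have halg : ∀ r : ℂ, Da (algebraMap ℂ A r) = 0 := fun r => by
    rw [Algebra.algebraMap_eq_smul_one, map_smul, hD1, smul_zero]
  let f : A →ₐ[ℂ] Matrix (Fin 2) (Fin 2) L.B :=
    { toFun := fun a => !![L.j (α a), L.j (Da a); 0, L.j (β a)]
      map_one' := by simp [hD1, Matrix.one_fin_two]
      map_mul' := fun x y => by
        simp [hD, add_comm]
      map_zero' := by ext i j; fin_cases i <;> fin_cases j <;> simp
      map_add' := fun x y => by ext i j; fin_cases i <;> fin_cases j <;> simp
      commutes' := fun r => by
        ext i j; fin_cases i <;> fin_cases j <;> simp [halg, Matrix.algebraMap_matrix_apply] }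
  have hf : ∀ a, f a = !![L.j (α a), L.j (Da a); 0, L.j (β a)] := fun a => rfl
  obtain ⟨g, hg⟩ := L.univ _ f (by
    obtain ⟨u, hu⟩ := u1
    obtain ⟨v, hv⟩ := u2
    have e1 : f c * !![(↑u⁻¹ : L.B), -(↑u⁻¹ * L.j (Da c) * ↑v⁻¹); 0, (↑v⁻¹ : L.B)] = 1 := by
      rw [hf, Matrix.mul_fin_two, Matrix.one_fin_two, ← hu, ← hv]
      simp [mul_assoc]
    have e2 : !![(↑u⁻¹ : L.B), -(↑u⁻¹ * L.j (Da c) * ↑v⁻¹); 0, (↑v⁻¹ : L.B)] * f c = 1 := by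
      rw [hf, Matrix.mul_fin_two, Matrix.one_fin_two, ← hu, ← hv]
      simp [mul_assoc]
    exact ⟨⟨f c, _, e1, e2⟩, rfl⟩)
  have key : ∀ x, g x 1 0 = 0 ∧ g x 0 0 = α' x ∧ g x 1 1 = β' x := by
    intro x
    obtain ⟨k, a, h⟩ := L.frac x
    have h1 : f (c ^ k) * g x = f a := by rw [← hg, ← map_mul, map_pow, h, hg]
    rw [hf, hf] at h1
    have e10 := congrFun (congrFun h1 1) 0
    have e00 := congrFun (congrFun h1 0) 0
    have e11 := congrFun (congrFun h1 1) 1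
    simp [Matrix.mul_apply, Fin.sum_univ_two] at e10 e00 e11
    have v1 : IsUnit (L.j (α c) ^ k) := u1.pow k
    have v2 : IsUnit (L.j (β c) ^ k) := u2.pow k
    have h10 : g x 1 0 = 0 := by
      refine v2.mul_left_cancel ?_
      rw [e10, mul_zero]
    refine ⟨h10, ?_, ?_⟩
    · rw [h10, mul_zero, add_zero] at e00
      refine v1.mul_left_cancel ?_
      rw [e00, ← hα', ← h, map_mul, map_pow, hα']
    · refine v2.mul_left_cancel ?_
      rw [e11, ← hβ', ← h, map_mul, map_pow, hβ']
  refine ⟨{ toFun := fun x => g x 0 1, map_add' := fun x y => by simp, map_smul' := fun r x => by simp }, ?_, ?_⟩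
  · intro a
    change g (L.j a) 0 1 = _
    rw [hg, hf]; simp
  · intro x y
    change g (x * y) 0 1 = g x 0 1 * _ + _ * g y 0 1
    rw [map_mul, Matrix.mul_apply, Fin.sum_univ_two, (key x).2.1, (key y).2.2, add_comm]

end Loc
open scoped TensorProduct

namespace QD
variable {n : ℕ} {A : Type} [Ring A] [Algebra ℂ A] {D : QD n A}

/-- extension of the right operators to a localisation -/
structure LOps (D : QD n A) {c : A} (L : Loc A c) where
  R : G4 → Fin n → Module.End ℂ L.B
  R_j : ∀ x i a, R x i (L.j a) = L.j (D.r x i a)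
  E_mul : ∀ i x y, R .E i (x * y) = R .E i x * y + R .K i x * R .E i y
  F_mul : ∀ i x y, R .F i (x * y) = R .F i x * R .Ki i y + x * R .F i y
  K_mul : ∀ i x y, R .K i (x * y) = R .K i x * R .K i y
  Ki_mul : ∀ i x y, R .Ki i (x * y) = R .Ki i x * R .Ki i y

theorem exists_lops {ϖ η : Fin n → ℤ} {c : A} (h : D.IsM ϖ η c) (L : Loc A c) : Nonempty (LOps D L) := by
  let kA : Fin n → A →ₐ[ℂ] A := fun i => AlgHom.ofLinearMap (D.r .K i) (D.rK_one i) (D.rK_mul i)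
  let kiA : Fin n → A →ₐ[ℂ] A := fun i => AlgHom.ofLinearMap (D.r .Ki i) (D.rKi_one i) (D.rKi_mul i)
  have hs : ∀ i, D.q ^ (η i * (D.d i : ℤ)) ≠ 0 := fun i => zpow_ne_zero _ D.q_ne
  have ht : ∀ i, D.q ^ (-(η i * (D.d i : ℤ))) ≠ 0 := fun i => zpow_ne_zero _ D.q_ne
  choose k hk using fun i => L.ext_aut (kA i) _ (hs i) (h.rw i)
  choose ki hki using fun i => L.ext_aut (kiA i) _ (ht i) (rw_ki h.rw i)
  choose e he he' using fun i => L.ext_der (kA i) (AlgHom.id ℂ A) (D.r .E i) (D.rE_mul i) _ 1 (hs i) one_ne_zero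
    (h.rw i) (by simp) (k i) (AlgHom.id ℂ L.B) (hk i) (fun a => rfl)
  choose f hf hf' using fun i => L.ext_der (AlgHom.id ℂ A) (kiA i) (D.r .F i) (D.rF_mul i) 1 _ one_ne_zero (ht i)
    (by simp) (rw_ki h.rw i) (AlgHom.id ℂ L.B) (ki i) (fun a => rfl) (hki i)
  refine ⟨⟨fun x i => match x with
    | .E => e i
    | .F => f i
    | .K => (k i).toLinearMap
    | .Ki => (ki i).toLinearMap, ?_, ?_, ?_, ?_, ?_⟩⟩
  · intro x i a
    cases x
    · exact he i a
    · exact hf i a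
    · exact hk i a
    · exact hki i a
  · exact fun i x y => he' i x y
  · exact fun i x y => hf' i x y
  · exact fun i x y => map_mul (k i) x y
  · exact fun i x y => map_mul (ki i) x y

namespace LOps
variable {c : A} {L : Loc A c} (O : LOps D L) {ϖ η : Fin n → ℤ}

theorem cK (h : D.IsM ϖ η c) (i x) : O.R .K i (L.j c * x) = D.q ^ (η i * (D.d i : ℤ)) • (L.j c * O.R .K i x) := by
  rw [O.K_mul, O.R_j, h.rw i, map_smul, smul_mul_assoc]
theorem cKi (h : D.IsM ϖ η c) (i x) : O.R .Ki i (L.j c * x) = D.q ^ (-(η i * (D.d i : ℤ))) • (L.j c * O.R .Ki i x) := by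
  rw [O.Ki_mul, O.R_j, rw_ki h.rw i, map_smul, smul_mul_assoc]
theorem cE (h : D.IsM ϖ η c) (i x) : O.R .E i (L.j c * x) = D.q ^ (η i * (D.d i : ℤ)) • (L.j c * O.R .E i x) := by
  rw [O.E_mul, O.R_j, O.R_j, h.rw i, h.rE, map_zero, zero_mul, zero_add, map_smul, smul_mul_assoc]
theorem cF (i x) : O.R .F i (L.j c * x) = L.j (D.r .F i c) * O.R .Ki i x + L.j c * O.R .F i x := by
  rw [O.F_mul, O.R_j]

theorem tri (h : D.IsM ϖ η c) : Tri D.toCD (fun x => O.R x.tw) := by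
  have hs : ∀ i, D.q ^ (η i * (D.d i : ℤ)) ≠ 0 := fun i => zpow_ne_zero _ D.q_ne
  have hst : ∀ i, D.q ^ (η i * (D.d i : ℤ)) * D.q ^ (-(η i * (D.d i : ℤ))) = 1 := fun i => by
    rw [← zpow_add₀ D.q_ne]; simp
  have kki : ∀ i m, O.R .K i (O.R .Ki i m) = m := by
    intro i m
    have := L.zero_of (O.R .K i ∘ₗ O.R .Ki i - LinearMap.id) 1 one_ne_zero (by
      intro a; simp [O.R_j, D.rkki]) (by
      intro x
      simp [O.cK h, O.cKi h, smul_smul, mul_sub]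
      rw [← zpow_neg, mul_comm, hst, one_smul]) m
    exact sub_eq_zero.1 this
  have kik : ∀ i m, O.R .Ki i (O.R .K i m) = m := by
    intro i m
    have := L.zero_of (O.R .Ki i ∘ₗ O.R .K i - LinearMap.id) 1 one_ne_zero (by
      intro a; simp [O.R_j, D.rkik]) (by
      intro x
      simp [O.cK h, O.cKi h, smul_smul, mul_sub]
      rw [← zpow_neg, hst, one_smul]) m
    exact sub_eq_zero.1 this
  have kk : ∀ i j m, O.R .K i (O.R .K j m) = O.R .K j (O.R .K i m) := by
    intro i j m
    have := L.zero_of (O.R .K i ∘ₗ O.R .K j - O.R .K j ∘ₗ O.R .K i) _ (mul_ne_zero (hs i) (hs j)) (by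
      intro a; simp [O.R_j, D.rkk i j]) (by
      intro x
      simp only [LinearMap.sub_apply, LinearMap.comp_apply, O.cK h, map_smul, smul_smul, mul_sub, smul_sub]
      rw [mul_comm]) m
    exact sub_eq_zero.1 this
  have ke : ∀ i j m, O.R .K i (O.R .F j m) = D.q ^ ((D.d i : ℤ) * D.a i j) • O.R .F j (O.R .K i m) := by
    intro i j m
    have hA := D.r_tri.ke i j
    simp only [G4.tw] at hA
    have kki' : ∀ x, O.R .K i (O.R .Ki j x) = O.R .Ki j (O.R .K i x) := by
      intro x
      have := kk j i (O.R .Ki j x)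
      rw [kki] at this
      rw [← this, kik]
    have := L.zero_of (O.R .K i ∘ₗ O.R .F j - D.q ^ ((D.d i : ℤ) * D.a i j) • (O.R .F j ∘ₗ O.R .K i)) _ (hs i) (by
      intro a
      simp only [LinearMap.sub_apply, LinearMap.comp_apply, LinearMap.smul_apply, O.R_j, hA, map_smul, sub_self]) (by
      intro x
      simp only [LinearMap.sub_apply, LinearMap.comp_apply, LinearMap.smul_apply, O.cK h, O.cF, map_smul, map_add, O.K_mul i (L.j (D.r .F j c)),
        O.R_j, hA, h.rw i, mul_sub, smul_sub, smul_mul_assoc, mul_smul_comm, kki', smul_add, smul_smul]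
      rw [mul_comm (D.q ^ (η i * (D.d i : ℤ)))]
      abel) m
    exact sub_eq_zero.1 this
  have kf : ∀ i j m, O.R .K i (O.R .E j m) = D.q ^ (-((D.d i : ℤ) * D.a i j)) • O.R .E j (O.R .K i m) := by
    intro i j m
    have hA := D.r_tri.kf i j
    simp only [G4.tw] at hA
    have := L.zero_of (O.R .K i ∘ₗ O.R .E j - D.q ^ (-((D.d i : ℤ) * D.a i j)) • (O.R .E j ∘ₗ O.R .K i)) _
      (mul_ne_zero (hs i) (hs j)) (by
      intro a
      simp only [LinearMap.sub_apply, LinearMap.comp_apply, LinearMap.smul_apply, O.R_j, hA, map_smul, sub_self]) (by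
      intro x
      simp only [LinearMap.sub_apply, LinearMap.comp_apply, LinearMap.smul_apply, O.cK h, O.cE h, map_smul,
        mul_sub, smul_sub, mul_smul_comm, smul_smul]
      congr 2 <;> ring) m
    exact sub_eq_zero.1 this
  have kie : ∀ i j m, O.R .Ki j (O.R .E i m) = D.q ^ ((D.d j : ℤ) * D.a j i) • O.R .E i (O.R .Ki j m) := by
    intro i j m
    have h := kf j i (O.R .Ki j m)
    rw [kki] at h
    have h2 := congrArg (O.R .Ki j) h
    rw [kik, map_smul] at h2
    rw [h2, smul_smul, ← zpow_add₀ D.q_ne, add_neg_cancel, zpow_zero, one_smul]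
  refine ⟨kki, kik, kk, ke, kf, ?_⟩
  intro i j m
  have hA := D.r_tri.ef i j
  have hAk := D.r_tri.ke j i c
  simp only [G4.tw] at hA hAk ⊢
  rw [h.rw j, map_smul, smul_smul, D.a_symm j i] at hAk
  set t := (D.q ^ (D.d i : ℤ) - D.q ^ (-(D.d i : ℤ)))⁻¹ with ht
  set Z : L.B →ₗ[ℂ] L.B := if i = j then t • (O.R .K i - O.R .Ki i) else 0 with hZ
  have hZm : (if i = j then t • (O.R .K i m - O.R .Ki i m) else 0) = Z m := by
    rw [hZ]; split_ifs <;> simp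
  rw [hZm]
  have := L.zero_of (O.R .F i ∘ₗ O.R .E j - O.R .E j ∘ₗ O.R .F i - Z) _ (hs j) (by
      intro a
      have := congrArg L.j (hA a)
      simp only [LinearMap.sub_apply, LinearMap.comp_apply, O.R_j]
      rw [← map_sub, this, hZ]
      split_ifs <;> simp [O.R_j]) (by
      intro x
      have hc := hA c
      rw [h.rE, map_zero, zero_sub] at hc
      have hc' : D.r .E j (D.r .F i c) = - if i = j then t • (D.r .K i c - D.r .Ki i c) else 0 := by
        rw [← hc, neg_neg]
      simp only [LinearMap.sub_apply, LinearMap.comp_apply, O.cE h, O.cF, map_smul, map_add, O.E_mul j (L.j (D.r .F i c)),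
        O.R_j, hc', hAk, kie, smul_mul_assoc, mul_smul_comm, smul_add, mul_sub, smul_sub, smul_smul]
      rw [D.a_symm i j, mul_comm (D.q ^ (η j * (D.d j : ℤ)))]
      by_cases hij : i = j
      · subst hij
        simp only [hZ, if_true, h.rw i, rw_ki h.rw i, map_smul, map_neg, map_sub, LinearMap.smul_apply, LinearMap.sub_apply,
          O.cK h, O.cKi h, neg_mul, smul_mul_assoc, sub_mul, mul_smul_comm, mul_sub, smul_sub]
        have e1 : ∀ y : L.B, D.q ^ (η i * (D.d i : ℤ)) • t • y = t • D.q ^ (η i * (D.d i : ℤ)) • y := fun y => smul_comm _ _ _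
        simp only [e1]
        abel
      · simp only [hZ, if_neg hij, neg_zero, map_zero, zero_mul, LinearMap.zero_apply, mul_zero, smul_zero]
        abel) m
  exact sub_eq_zero.1 this

end LOps
end QD
open scoped TensorProduct

namespace QD
variable {n : ℕ} {A : Type} [Ring A] [Algebra ℂ A] {D : QD n A}

namespace IsF
variable {p : Fin n} {ϖ η : Fin n → ℤ} {c e : A}

theorem fact1 (h : D.IsF p ϖ η c e) (a : A) : ∃ a', e * a - a' * e ∈ cI c := by
  obtain ⟨z, hz⟩ := h.normal.1 (D.r .K p a)
  refine ⟨z, ?_⟩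
  have := congrArg (D.r .F p) hz
  rw [h.D_rc, h.D_c, D.rkik] at this
  have h2 : e * a - z * e = D.q ^ (D.d p : ℤ) • (D.r .F p z * c) - c * D.r .F p (D.r .K p a) := by
    rw [sub_eq_sub_iff_add_eq_add, this]
  rw [h2]
  exact Submodule.sub_mem _ (Submodule.smul_mem _ _ (cI_left h.normal ⟨1, by simp⟩ _)) ⟨_, rfl⟩

theorem fact1N (h : D.IsF p ϖ η c e) (N : ℕ) (a : A) : ∃ a', e ^ N * a - a' * e ^ N ∈ cI c := by
  induction N with
  | zero => exact ⟨a, by simp⟩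
  | succ N ih =>
    obtain ⟨a1, h1⟩ := ih
    obtain ⟨a2, h2⟩ := h.fact1 a1
    refine ⟨a2, ?_⟩
    have : e ^ (N + 1) * a - a2 * e ^ (N + 1) = e * (e ^ N * a - a1 * e ^ N) + (e * a1 - a2 * e) * e ^ N := by
      rw [pow_succ']; noncomm_ring
    rw [this]
    exact Submodule.add_mem _ (cI_left h.normal h1 _) (cI_right h2 _)

theorem epow_cpow (h : D.IsF p ϖ η c e) (N k : ℕ) : ∃ s : ℂ, s ≠ 0 ∧ e ^ N * c ^ k = s • (c ^ k * e ^ N) := by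
  have hq : D.q ^ (D.d p : ℤ) ≠ 0 := zpow_ne_zero _ D.q_ne
  have h1 : ∀ N, e ^ N * c = (D.q ^ (D.d p : ℤ)) ^ N • (c * e ^ N) := by
    intro N
    induction N with
    | zero => simp
    | succ N ih =>
      rw [pow_succ', mul_assoc, ih, mul_smul_comm, ← mul_assoc, h.ec, smul_mul_assoc, smul_smul, mul_assoc, pow_succ]
  induction k with
  | zero => exact ⟨1, one_ne_zero, by simp⟩
  | succ k ih =>
    obtain ⟨s, hs, hh⟩ := ih
    refine ⟨s * (D.q ^ (D.d p : ℤ)) ^ N, mul_ne_zero hs (pow_ne_zero _ hq), ?_⟩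
    rw [pow_succ, ← mul_assoc, hh, smul_mul_assoc, mul_assoc, h1, mul_smul_comm, smul_smul, mul_assoc]

theorem fact2 (h : D.IsF p ϖ η c e) (N k : ℕ) (a : A) : ∃ M a' b, e ^ M * a = a' * e ^ N + c ^ k * b := by
  induction k with
  | zero => exact ⟨0, 0, a, by simp⟩
  | succ k ih =>
    obtain ⟨M, a', b, h1⟩ := ih
    obtain ⟨b', b'', h2⟩ := h.fact1N N b
    simp only [LinearMap.mulLeft_apply] at h2
    obtain ⟨s, -, hs⟩ := h.epow_cpow N k
    refine ⟨N + M, e ^ N * a' + s • (c ^ k * b'), s • b'', ?_⟩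
    have h3 : e ^ N * b = b' * e ^ N + c * b'' := by rw [h2]; abel
    rw [pow_add, mul_assoc, h1, mul_add, ← mul_assoc _ (c ^ k), hs, smul_mul_assoc, mul_assoc (c ^ k), h3,
      add_mul, mul_smul_comm, smul_mul_assoc, mul_add, smul_add, pow_succ c]
    simp only [mul_assoc, add_assoc]

theorem cpow_norm (h : D.IsF p ϖ η c e) (k : ℕ) (b : A) : ∃ b', c ^ k * b = b' * c ^ k := by
  induction k generalizing b with
  | zero => exact ⟨b, by simp⟩
  | succ k ih =>
    obtain ⟨r1, h1⟩ := h.normal.1 b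
    obtain ⟨r2, h2⟩ := ih r1
    exact ⟨r2, by rw [pow_succ, mul_assoc, h1, ← mul_assoc, h2, mul_assoc]⟩

variable (L : Loc A c)

def jA : Submodule ℂ L.B := LinearMap.range L.j.toLinearMap
variable {L}
theorem j_mem (a : A) : L.j a ∈ jA L := ⟨a, rfl⟩
theorem jA_mul (a : A) {x : L.B} (h : x ∈ jA L) : L.j a * x ∈ jA L := by
  obtain ⟨b, rfl⟩ := h; exact ⟨a * b, by simp⟩
theorem jA_op (O : LOps D L) (y i) {x : L.B} (h : x ∈ jA L) : O.R y i x ∈ jA L := by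
  obtain ⟨b, rfl⟩ := h
  refine ⟨D.r y i b, ?_⟩
  exact (O.R_j y i b).symm

theorem e_reg (h : D.IsF p ϖ η c e) (N : ℕ) {x : L.B} (hx : L.j e ^ N * x = 0) : x = 0 := by
  have nz := D.nzd
  obtain ⟨k, a, hk⟩ := L.frac x
  obtain ⟨s, -, hs⟩ := h.epow_cpow N k
  have : L.j (e ^ N * a) = 0 := by
    rw [map_mul, ← hk, ← mul_assoc, ← map_pow, ← map_mul, hs, map_smul, map_mul, smul_mul_assoc, mul_assoc,
      map_pow L.j e, hx, mul_zero, smul_zero]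
  have ha : a = 0 := by
    have := L.inj (this.trans (map_zero _).symm)
    exact (mul_eq_zero.1 this).resolve_left (pow_ne_zero _ h.e0)
  rw [ha, map_zero] at hk
  exact L.cancel (k := k) (by rw [hk, mul_zero])

theorem X_mono {N M : ℕ} (hNM : N ≤ M) {x : L.B} (hx : L.j e ^ N * x ∈ jA L) : L.j e ^ M * x ∈ jA L := by
  obtain ⟨k, rfl⟩ := Nat.exists_eq_add_of_le hNM
  rw [add_comm, pow_add, mul_assoc, ← map_pow L.j e k]
  exact jA_mul _ hx

/-- elements pushed into `A` by a power of `e` -/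
def XX (L : Loc A c) (e : A) : Submodule ℂ L.B where
  carrier := {x | ∃ N, L.j e ^ N * x ∈ jA L}
  add_mem' := by
    rintro x y ⟨N, hN⟩ ⟨M, hM⟩
    refine ⟨max N M, ?_⟩
    rw [mul_add]
    exact Submodule.add_mem _ (X_mono (le_max_left _ _) hN) (X_mono (le_max_right _ _) hM)
  zero_mem' := ⟨0, by simp⟩
  smul_mem' := by
    rintro r x ⟨N, hN⟩
    exact ⟨N, by rw [mul_smul_comm]; exact Submodule.smul_mem _ _ hN⟩

theorem mem_XX {x : L.B} : x ∈ XX L e ↔ ∃ N, L.j e ^ N * x ∈ jA L := Iff.rfl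

theorem XX_mul (h : D.IsF p ϖ η c e) (a : A) {x : L.B} (hx : x ∈ XX L e) : L.j a * x ∈ XX L e := by
  obtain ⟨N, hN⟩ := hx
  obtain ⟨k, b, hk⟩ := L.frac x
  obtain ⟨M, a', b1, h1⟩ := h.fact2 N k a
  obtain ⟨b2, h2⟩ := h.cpow_norm k b1
  refine ⟨M, ?_⟩
  rw [← mul_assoc, ← map_pow, ← map_mul, h1, h2, map_add, add_mul, map_mul, map_mul, mul_assoc, mul_assoc,
    map_pow, map_pow, hk]
  exact Submodule.add_mem _ (jA_mul _ hN) (jA_mul _ (j_mem _))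

theorem XX_of_e {x : L.B} (hx : L.j e * x ∈ XX L e) : x ∈ XX L e := by
  obtain ⟨N, hN⟩ := hx
  exact ⟨N + 1, by rw [pow_succ, mul_assoc]; exact hN⟩

theorem XX_K (h : D.IsF p ϖ η c e) (O : LOps D L) (i) {x : L.B} (hx : x ∈ XX L e) : O.R .K i x ∈ XX L e := by
  obtain ⟨N, hN⟩ := hx
  induction N generalizing x with
  | zero => exact ⟨0, by simp only [pow_zero, one_mul] at hN ⊢; exact jA_op O _ _ hN⟩
  | succ N ih =>
    have h1 := ih (x := L.j e * x) (by rw [← mul_assoc, ← pow_succ]; exact hN)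
    rw [O.K_mul, O.R_j, h.erw i, map_smul, smul_mul_assoc] at h1
    exact XX_of_e ((Submodule.smul_mem_iff _ (zpow_ne_zero _ D.q_ne)).1 h1)

theorem XX_Ki (h : D.IsF p ϖ η c e) (O : LOps D L) (i) {x : L.B} (hx : x ∈ XX L e) : O.R .Ki i x ∈ XX L e := by
  obtain ⟨N, hN⟩ := hx
  induction N generalizing x with
  | zero => exact ⟨0, by simp only [pow_zero, one_mul] at hN ⊢; exact jA_op O _ _ hN⟩
  | succ N ih =>
    have h1 := ih (x := L.j e * x) (by rw [← mul_assoc, ← pow_succ]; exact hN)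
    rw [O.Ki_mul, O.R_j, rw_ki h.erw i, map_smul, smul_mul_assoc] at h1
    exact XX_of_e ((Submodule.smul_mem_iff _ (zpow_ne_zero _ D.q_ne)).1 h1)

theorem XX_op (h : D.IsF p ϖ η c e) (O : LOps D L) (y i) {x : L.B} (hx : x ∈ XX L e) : O.R y i x ∈ XX L e := by
  obtain ⟨N, hN⟩ := hx
  induction N generalizing x with
  | zero => exact ⟨0, by simp only [pow_zero, one_mul] at hN ⊢; exact jA_op O _ _ hN⟩
  | succ N ih =>
    have hx : x ∈ XX L e := ⟨_, hN⟩
    have h1 := ih (x := L.j e * x) (by rw [← mul_assoc, ← pow_succ]; exact hN)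
    cases y
    · rw [O.E_mul, O.R_j, O.R_j, h.erw i, map_smul, smul_mul_assoc] at h1
      have h2 := (Submodule.add_mem_iff_right _ (h.XX_mul _ hx)).1 h1
      exact XX_of_e ((Submodule.smul_mem_iff _ (zpow_ne_zero _ D.q_ne)).1 h2)
    · rw [O.F_mul, O.R_j] at h1
      have h2 := (Submodule.add_mem_iff_right _ (h.XX_mul _ (h.XX_Ki O i hx))).1 h1
      exact XX_of_e h2
    · exact h.XX_K O i hx
    · exact h.XX_Ki O i hx

theorem pow_j (O : LOps D L) (y i) (r : ℕ) (a : A) : (O.R y i ^ r) (L.j a) = L.j ((D.r y i ^ r) a) := by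
  induction r with
  | zero => simp
  | succ r ih => rw [pow_succ', Module.End.mul_apply, ih, O.R_j, ← Module.End.mul_apply, ← pow_succ']

/-- `E`-words through powers of `c` -/
theorem wdE_c (h : D.IsF p ϖ η c e) (O : LOps D L) (w : List (Fin n)) : ∃ s : ℂ, s ≠ 0 ∧ ∀ x : L.B,
    wd (O.R .E) w (L.j c * x) = s • (L.j c * wd (O.R .E) w x) := by
  induction w with
  | nil => exact ⟨1, one_ne_zero, by simp⟩
  | cons i w ih =>
    obtain ⟨s, hs, hh⟩ := ih
    refine ⟨s * D.q ^ (η i * (D.d i : ℤ)), mul_ne_zero hs (zpow_ne_zero _ D.q_ne), fun x => ?_⟩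
    rw [wd_cons, hh, map_smul, O.cE h.toIsM, smul_smul, wd_cons]

theorem wd_j (O : LOps D L) (y) (w : List (Fin n)) (a : A) : wd (O.R y) w (L.j a) = L.j (wd (D.r y) w a) := by
  induction w with
  | nil => simp
  | cons i w ih => rw [wd_cons, ih, O.R_j, wd_cons]

theorem nilE (h : D.IsF p ϖ η c e) (O : LOps D L) (i) (x : L.B) : ∃ N, (O.R .E i ^ N) x = 0 := by
  obtain ⟨k, a, hk⟩ := L.frac x
  induction k generalizing x with
  | zero =>
    rw [pow_zero, one_mul] at hk
    obtain ⟨N, hN⟩ := nil_r (D := D) a .E (Or.inl rfl) i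
    exact ⟨N, by rw [hk, pow_j, hN, map_zero]⟩
  | succ k ih =>
    obtain ⟨N, hN⟩ := ih (L.j c * x) (by rw [← mul_assoc, ← pow_succ]; exact hk)
    refine ⟨N, ?_⟩
    obtain ⟨s, hs, hh⟩ := h.wdE_c O (List.replicate N i)
    have := hh x
    rw [wd_replicate, hN] at this
    have := (smul_eq_zero.1 this.symm).resolve_left hs
    exact L.cancel (k := 1) (by rw [pow_one, this, mul_zero])

theorem nilF (h : D.IsF p ϖ η c e) (O : LOps D L) (i) {x : L.B} (hx : x ∈ XX L e) : ∃ N, (O.R .F i ^ N) x = 0 := by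
  by_cases hi : i = p
  · subst hi
    obtain ⟨N, a, ha⟩ := hx
    have ha : L.j a = L.j e ^ N * x := ha
    obtain ⟨r, hr⟩ := nil_r (D := D) a .F (Or.inr rfl) i
    refine ⟨r, h.e_reg N ?_⟩
    have h1 : ∀ x, O.R .F i (L.j e * x) = L.j e * O.R .F i x := fun x => by
      rw [O.F_mul, O.R_j, h.De, map_zero, zero_mul, zero_add]
    have h2 : ∀ N x, O.R .F i (L.j e ^ N * x) = L.j e ^ N * O.R .F i x := by
      intro N
      induction N with
      | zero => simp
      | succ N ih => intro x; rw [pow_succ', mul_assoc, h1, ih, mul_assoc]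
    have h3 : ∀ r x, (O.R .F i ^ r) (L.j e ^ N * x) = L.j e ^ N * (O.R .F i ^ r) x := by
      intro r
      induction r with
      | zero => simp
      | succ r ih => intro x; rw [pow_succ', Module.End.mul_apply, ih, h2, Module.End.mul_apply]
    rw [← h3, ← ha, pow_j, hr, map_zero]
  · clear hx
    obtain ⟨k, a, hk⟩ := L.frac x
    have h1 : ∀ x, O.R .F i (L.j c * x) = L.j c * O.R .F i x := fun x => by
      rw [O.cF, h.Fj i hi, map_zero, zero_mul, zero_add]
    obtain ⟨r, hr⟩ := nil_r (D := D) a .F (Or.inr rfl) i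
    refine ⟨r, L.cancel (k := k) ?_⟩
    have h2 : ∀ N x, O.R .F i (L.j c ^ N * x) = L.j c ^ N * O.R .F i x := by
      intro N
      induction N with
      | zero => simp
      | succ N ih => intro x; rw [pow_succ', mul_assoc, h1, ih, mul_assoc]
    have h3 : ∀ r x, (O.R .F i ^ r) (L.j c ^ k * x) = L.j c ^ k * (O.R .F i ^ r) x := by
      intro r
      induction r with
      | zero => simp
      | succ r ih => intro x; rw [pow_succ', Module.End.mul_apply, ih, h2, Module.End.mul_apply]
    rw [← h3, hk, pow_j, hr, map_zero, mul_zero]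

end IsF
end QD
open scoped TensorProduct

theorem exists_max_wd {n : ℕ} {M : Type} [AddCommGroup M] [Module ℂ M] (F : Fin n → Module.End ℂ M) {a : M} (ha : a ≠ 0)
    (h : ∃ N : ℕ, ∀ w : List (Fin n), N ≤ w.length → wd F w a = 0) :
    ∃ w, wd F w a ≠ 0 ∧ ∀ j, F j (wd F w a) = 0 := by
  by_contra hcon
  push Not at hcon
  have : ∀ N : ℕ, ∃ w : List (Fin n), w.length = N ∧ wd F w a ≠ 0 := by
    intro N
    induction N with
    | zero => exact ⟨[], rfl, by simpa⟩
    | succ N ih =>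
      obtain ⟨w, hw, h0⟩ := ih
      obtain ⟨j, hj⟩ := hcon w h0
      exact ⟨j :: w, by simp [hw], by rwa [wd_cons]⟩
  obtain ⟨N, hN⟩ := h
  obtain ⟨w, hw, h0⟩ := this N
  exact h0 (hN w hw.ge)

namespace QD
variable {n : ℕ} {A : Type} [Ring A] [Algebra ℂ A] {D : QD n A}

/-- a stable left ideal containing a highest weight vector is everything -/
theorem one_mem_of_hw (J : Submodule ℂ A) (hJ : ∀ a, ∀ p ∈ J, a * p ∈ J) (hr : ∀ x j, ∀ p ∈ J, D.r x j p ∈ J)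
    {ν μ : Fin n → ℤ} (hν : ∀ j, 0 ≤ ν j) {a : A} (ha : a ∈ J) (a0 : a ≠ 0) (hE : ∀ j, D.l .E j a = 0)
    (hl : a ∈ D.lw ν) (hrw : a ∈ D.rw' μ) : (1 : A) ∈ J := by
  obtain ⟨w, hw0, hw⟩ := exists_max_wd (D.r .F) a0 (nil_rF hrw)
  set b := wd (D.r .F) w a with hb
  have hbJ : b ∈ J := wd_mem J (hr .F) w ha
  have hbE : ∀ j, D.l .E j b = 0 := fun j => by
    have := lr_wd (D := D) .E .F [j] w a
    simp only [wd_cons, wd_nil] at this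
    rw [hb, this, hE, map_zero]
  have hbl : b ∈ D.lw ν := lw_wr hl _ w
  have heps : D.eps b ≠ 0 := fun h0 => hw0 (sing hbl hbE hw h0)
  obtain ⟨i, hi⟩ := D.hw_surj ν hν
  have hz : b - D.eps b • D.cf i (D.xhi i) (D.vhi i) = 0 := by
    refine sing (D := D) (ν := ν) ?_ ?_ ?_ ?_
    · refine Submodule.sub_mem _ hbl (Submodule.smul_mem _ _ (lw_cf ?_))
      rw [← hi]; exact D.vhi_wt i
    · intro j
      rw [map_sub, map_smul, hbE, D.l_cf, D.vhi_e, map_zero, smul_zero, sub_zero]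
    · intro j
      rw [map_sub, map_smul, hw, D.r_cf, D.supp_hi_f i (D.xhi_supp i), map_zero, LinearMap.zero_apply, smul_zero, sub_zero]
    · rw [map_sub, map_smul, D.eps_cf, D.xhi_vhi]; simp
  have hcf : D.cf i (D.xhi i) (D.vhi i) ∈ J := by
    rw [sub_eq_zero.1 hz] at hbJ
    exact (Submodule.smul_mem_iff _ heps).1 hbJ
  refine D.one_mem_of_cf i (D.vhi_ne i) J hJ ?_
  let N : Submodule ℂ (Module.Dual ℂ (D.V i)) := J.comap ((D.cf i).flip (D.vhi i))
  have hN : N = ⊤ := by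
    refine D.dual_simple i N ?_ ⟨D.xhi i, hcf, D.xhi_ne i⟩
    intro x j ξ hξ
    have := hr x j _ hξ
    change D.r x j (D.cf i ξ (D.vhi i)) ∈ J at this
    rw [D.r_cf] at this
    exact this
  intro ξ
  have : ξ ∈ N := by rw [hN]; trivial
  exact this

namespace IsF
variable {p : Fin n} {ϖ η : Fin n → ℤ} {c e : A} {L : Loc A c}

theorem stable_le (h : D.IsF p ϖ η c e) (O : LOps D L) (L0 : Submodule ℂ L.B)
    (hL : ∀ x i, ∀ m ∈ L0, O.R x i m ∈ L0) (M : ℕ) (hM : ∀ m ∈ L0, L.j c ^ M * m ∈ jA L) : L0 ≤ jA L := by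
  have nz := D.nzd
  have T := O.tri h.toIsM
  have kki : ∀ i m, O.R .K i (O.R .Ki i m) = m := T.kki
  have kik : ∀ i m, O.R .Ki i (O.R .K i m) = m := T.kik
  let J : Submodule ℂ A :=
    { carrier := {a | ∀ m ∈ L0, L.j a * m ∈ jA L}
      add_mem' := fun {a b} ha hb m hm => by
        rw [map_add, add_mul]; exact Submodule.add_mem _ (ha m hm) (hb m hm)
      zero_mem' := fun m hm => by simp
      smul_mem' := fun r a ha m hm => by
        rw [map_smul, smul_mul_assoc]; exact Submodule.smul_mem _ _ (ha m hm) }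
  have memJ : ∀ a, a ∈ J ↔ ∀ m ∈ L0, L.j a * m ∈ jA L := fun a => Iff.rfl
  have hJ1 : ∀ a, ∀ p ∈ J, a * p ∈ J := by
    intro a p hp m hm
    rw [map_mul, mul_assoc]; exact jA_mul _ (hp m hm)
  have hK : ∀ i, ∀ p ∈ J, D.r .K i p ∈ J := by
    intro i p hp m hm
    have := jA_op O .K i (hp _ (hL .Ki i m hm))
    rwa [O.K_mul, kki, O.R_j] at this
  have hKi : ∀ i, ∀ p ∈ J, D.r .Ki i p ∈ J := by
    intro i p hp m hm
    have := jA_op O .Ki i (hp _ (hL .K i m hm))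
    rwa [O.Ki_mul, kik, O.R_j] at this
  have hr : ∀ x j, ∀ p ∈ J, D.r x j p ∈ J := by
    intro x j p hp
    cases x
    · intro m hm
      have := jA_op O .E j (hp m hm)
      rw [O.E_mul, O.R_j, O.R_j] at this
      exact (Submodule.add_mem_iff_left _ (hK j p hp _ (hL .E j m hm))).1 this
    · intro m hm
      have := jA_op O .F j (hp _ (hL .K j m hm))
      rw [O.F_mul, O.R_j, kik] at this
      exact (Submodule.add_mem_iff_left _ (hp _ (hL .F j _ (hL .K j m hm)))).1 this
    · exact hK j p hp
    · exact hKi j p hp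
  have hc : c ^ M ∈ J := by
    intro m hm; rw [map_pow]; exact hM m hm
  have hlE : ∀ M : ℕ, ∀ j, D.l .E j (c ^ M) = 0 := by
    intro M j
    induction M with
    | zero => rw [pow_zero, D.lE_one]
    | succ M ih => rw [pow_succ, D.lE_mul, ih, h.lE]; simp
  have h1 : (1 : A) ∈ J := one_mem_of_hw (D := D) J hJ1 hr (ν := M • ϖ) (μ := M • η)
    (fun j => by simpa using mul_nonneg (Int.natCast_nonneg M) (h.dom j)) hc (pow_ne_zero _ h.c0) (hlE M)
    (lw_pow h.lw M) (rw_pow h.rw M)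
  intro m hm
  have := h1 m hm
  rwa [map_one, one_mul] at this

theorem hartogs_loc (h : D.IsF p ϖ η c e) (O : LOps D L) {x : L.B} {y : A} {ν : Fin n → ℤ} (hy : y ∈ D.rw' ν)
    (hxy : L.j c * x = L.j y) (hx : x ∈ XX L e) : x ∈ jA L := by
  have T := O.tri h.toIsM
  have hkk : ∀ i j m, O.R .K i (O.R .K j m) = O.R .K j (O.R .K i m) := T.kk
  -- the weight of `x`
  have hxw : x ∈ D.wt (O.R .K) (ν - η) := by
    intro i
    have h1 := O.cK h.toIsM i x
    rw [hxy, O.R_j, hy i, map_smul, ← hxy] at h1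
    refine L.cancel (k := 1) ?_
    rw [pow_one, mul_smul_comm]
    have h2 : D.q ^ (η i * (D.d i : ℤ)) ≠ 0 := zpow_ne_zero _ D.q_ne
    have h3 := congrArg (fun z => (D.q ^ (η i * (D.d i : ℤ)))⁻¹ • z) h1
    simp only [smul_smul, inv_mul_cancel₀ h2, one_smul] at h3
    rw [← h3, ← zpow_neg, ← zpow_add₀ D.q_ne]
    congr 2
    simp only [Pi.sub_apply]; ring
  -- `E`-words
  obtain ⟨N, hN⟩ := nil_rE hy
  have hNx : ∀ w : List (Fin n), N ≤ w.length → wd (O.R .E) w x = 0 := by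
    intro w hw
    obtain ⟨s, hs, hh⟩ := h.wdE_c O w
    have h1 := hh x
    rw [hxy, wd_j, hN w hw, map_zero] at h1
    have := (smul_eq_zero.1 h1.symm).resolve_left hs
    exact L.cancel (k := 1) (by rw [pow_one, this, mul_zero])
  have hwtE : ∀ w, wd (O.R .E) w x ∈ D.wt (O.R .K) (ν - η - D.wal w) := fun w => T.wt_wf hxw w
  set G := spanW (O.R .E) (Submodule.span ℂ {x}) with hG
  have hGle : ∀ S : Submodule ℂ L.B, (∀ w, wd (O.R .E) w x ∈ S) → G ≤ S := by
    intro S hS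
    refine spanW_le ?_
    intro w g hg
    obtain ⟨r, rfl⟩ := Submodule.mem_span_singleton.1 hg
    rw [map_smul]; exact Submodule.smul_mem _ _ (hS w)
  have hGm : ∀ w, wd (O.R .E) w x ∈ G := fun w => wd_mem_spanW _ w (Submodule.mem_span_singleton_self x)
  have hGK : ∀ i, ∀ g ∈ G, O.R .K i g ∈ G := fun i =>
    hGle (G.comap (O.R .K i)) (fun w => by
      rw [Submodule.mem_comap, hwtE w i]; exact Submodule.smul_mem _ _ (hGm w))
  have hGKi : ∀ i, ∀ g ∈ G, O.R .Ki i g ∈ G := fun i =>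
    hGle (G.comap (O.R .Ki i)) (fun w => by
      have := T.ki_wt (hwtE w) i
      simp only [G4.tw] at this
      rw [Submodule.mem_comap, this]; exact Submodule.smul_mem _ _ (hGm w))
  set L0 := spanW (O.R .F) G with hL0
  have hL' := T.spanW_e (G := G) hGK hGKi (fun i => spanW_stable _ _ i)
  have hL : ∀ x i, ∀ m ∈ L0, O.R x i m ∈ L0 := by
    intro x i m hm
    have := hL' x.tw i m hm
    cases x <;> exact this
  have hxL0 : x ∈ L0 := le_spanW _ _ (by simpa using hGm [])
  have hL0X : L0 ≤ XX L e := by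
    refine spanW_le fun w g hg => wd_mem _ (fun j m hm => h.XX_op O _ _ hm) w ?_
    exact hGle (XX L e) (fun w => wd_mem _ (fun j m hm => h.XX_op O _ _ hm) w hx) hg
  -- lower bound on weights
  have hword : ∀ S : Submodule ℂ L.B, (∀ w u : List (Fin n), u.length < N → wd (O.R .F) w (wd (O.R .E) u x) ∈ S) → L0 ≤ S := by
    intro S hS
    refine spanW_le fun w g hg => ?_
    refine hGle (S.comap (wd (O.R .F) w)) (fun u => ?_) hg
    by_cases hu : u.length < N
    · exact hS w u hu
    · rw [Submodule.mem_comap, hNx u (not_lt.1 hu), map_zero]; exact Submodule.zero_mem _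
  have hwtFE : ∀ w u, wd (O.R .F) w (wd (O.R .E) u x) ∈ D.wt (O.R .K) (ν - η - D.wal u + D.wal w) :=
    fun w u => T.wt_we (hwtE u) w
  have hfin : {u : List (Fin n) | u.length < N}.Finite := List.finite_length_lt _ _
  obtain ⟨b, hb⟩ : ∃ b : ℤ, ∀ u : List (Fin n), u.length < N → b ≤ D.ph (ν - η - D.wal u) := by
    obtain ⟨b, hb⟩ := (hfin.image (fun u => D.ph (ν - η - D.wal u))).bddBelow
    exact ⟨b, fun u hu => hb ⟨u, hu, rfl⟩⟩
  have hlow : ∀ μ, (∃ m ∈ L0, m ≠ 0 ∧ m ∈ D.wt (O.R .K) μ) → b ≤ D.ph μ := by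
    rintro μ ⟨m, hm, m0, hmw⟩
    refine D.wt_mem_of_iSup (O.R .K) hkk (fun μ => b ≤ D.ph μ) hmw m0 ?_
    refine hword (⨆ μ : {μ // b ≤ D.ph μ}, D.wt (O.R .K) μ.1) (fun w u hu => ?_) hm
    refine (le_iSup (fun μ : {μ // b ≤ D.ph μ} => D.wt (O.R .K) μ.1) ⟨ν - η - D.wal u + D.wal w, ?_⟩) (hwtFE w u)
    rw [D.ph_add]
    have := D.ph_wal w
    have := hb u hu
    omega
  classical
  have hup : ∃ H : ℤ, ∀ μ, (∃ m ∈ L0, m ≠ 0 ∧ m ∈ D.wt (O.R .K) μ) → D.ph μ ≤ H := by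
    refine ⟨-(((Finset.univ.erase (1 : D.W)).card : ℤ) * b), fun μ hμ => ?_⟩
    have h1 : ∀ w : D.W, b ≤ D.ph (D.act w μ) := fun w =>
      hlow _ (T.wt_inv L0 hL' (fun m hm j => h.nilF O j (hL0X hm)) (fun m hm j => h.nilE O j m) w μ hμ)
    have h2 := D.sum_ph μ
    rw [← Finset.add_sum_erase _ _ (Finset.mem_univ (1 : D.W))] at h2
    have h3 := Finset.card_nsmul_le_sum (Finset.univ.erase (1 : D.W)) (fun w => D.ph (D.act w μ)) b (fun w _ => h1 w)
    rw [nsmul_eq_mul] at h3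
    have h4 : D.act 1 μ = μ := by rw [D.act_one]
    rw [h4] at h2
    linarith
  obtain ⟨H, hH⟩ := hup
  -- finite generation
  obtain ⟨K, hK⟩ : ∃ K : ℕ, H - b ≤ K := ⟨(H - b).toNat, Int.self_le_toNat _⟩
  have hzero : ∀ w u : List (Fin n), u.length < N → K < w.length → wd (O.R .F) w (wd (O.R .E) u x) = 0 := by
    intro w u hu hw
    by_contra h0
    have h1 := hH _ ⟨_, wd_mem_spanW _ w (hGm u), h0, hwtFE w u⟩
    rw [D.ph_add] at h1
    have := D.ph_wal w
    have := hb u hu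
    omega
  have hfin2 : {w : List (Fin n) | w.length < K + 1}.Finite := List.finite_length_lt _ _
  let f : List (Fin n) × List (Fin n) → L.B := fun t => wd (O.R .F) t.1 (wd (O.R .E) t.2 x)
  have hM : ∃ M : ℕ, ∀ t ∈ {w : List (Fin n) | w.length < K + 1} ×ˢ {u : List (Fin n) | u.length < N}, L.j c ^ M * f t ∈ jA L := by
    choose k a hk using fun t => L.frac (f t)
    obtain ⟨M, hM⟩ := ((hfin2.prod hfin).image k).bddAbove
    refine ⟨M, fun t ht => ?_⟩
    have h1 : k t ≤ M := hM ⟨t, ht, rfl⟩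
    obtain ⟨r, rfl⟩ := Nat.exists_eq_add_of_le h1
    rw [add_comm, pow_add, mul_assoc, hk, ← map_pow]
    exact jA_mul _ (j_mem _)
  obtain ⟨M, hM⟩ := hM
  refine h.stable_le O L0 hL M ?_ hxL0
  have : L0 ≤ (jA L).comap (LinearMap.mulLeft ℂ (L.j c ^ M)) := by
    refine hword _ fun w u hu => ?_
    by_cases hw : w.length < K + 1
    · exact hM (w, u) ⟨hw, hu⟩
    · rw [hzero w u hu (by omega)]; exact Submodule.zero_mem _
  exact fun m hm => this hm

theorem hartogs (h : D.IsF p ϖ η c e) (y : A) (hy : e * y ∈ cI c) : y ∈ cI c := by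
  have nz := D.nzd
  obtain ⟨L⟩ := exists_loc h.c0 h.normal
  obtain ⟨O⟩ := exists_lops h.toIsM L
  have hom : ∀ g, ∀ y ∈ D.bw g, e * y ∈ cI c → y ∈ cI c := by
    rintro g y hyg ⟨b, hb⟩
    simp only [LinearMap.mulLeft_apply] at hb
    obtain ⟨x, hx⟩ : ∃ x, L.j c * x = L.j y := by
      obtain ⟨u, hu⟩ := L.unit
      exact ⟨↑u⁻¹ * L.j y, by rw [← hu]; simp⟩
    have hq : D.q ^ (D.d p : ℤ) ≠ 0 := zpow_ne_zero _ D.q_ne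
    have hex : L.j c * (D.q ^ (D.d p : ℤ) • (L.j e * x)) = L.j c * L.j b := by
      rw [mul_smul_comm, ← mul_assoc, ← map_mul, ← smul_mul_assoc, ← map_smul, ← h.ec, map_mul, mul_assoc, hx,
        ← map_mul, ← hb, map_mul]
    have hex' : D.q ^ (D.d p : ℤ) • (L.j e * x) = L.j b := L.cancel (k := 1) (by rw [pow_one]; exact hex)
    have hxX : x ∈ XX L e := ⟨1, by
      rw [pow_one]
      refine (Submodule.smul_mem_iff _ hq).1 ?_
      rw [hex']; exact j_mem _⟩
    obtain ⟨a, ha⟩ := h.hartogs_loc O hyg.2 hx hxX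
    have ha : L.j a = x := ha
    refine ⟨a, L.inj ?_⟩
    rw [LinearMap.mulLeft_apply, map_mul, ha, hx]
  obtain ⟨s, -, hs⟩ := D.comp_sum y
  rw [hs]
  refine Submodule.sum_mem _ fun g _ => hom g _ (comp_mem _ _) ?_
  rw [← comp_mul (h := g) h.bw_e]
  obtain ⟨b, hb⟩ := hy
  simp only [LinearMap.mulLeft_apply] at hb
  rw [← hb]
  have := comp_mul (h := (ϖ, η + D.al p) + g - (ϖ, η)) h.bw_c b
  rw [add_sub_cancel] at this
  exact ⟨_, this.symm⟩

theorem prime (h : D.IsF p ϖ η c e) (y z : A) (hyz : y * z ∈ cI c) : y ∈ cI c ∨ z ∈ cI c :=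
  h.prime_of_hartogs h.hartogs y z hyz

end IsF
end QD
open scoped TensorProduct

theorem mem_span_normal {A : Type} [Ring A] {c : A} (hc : IsNormalElem c) (x : A) :
    x ∈ TwoSidedIdeal.span {c} ↔ ∃ b, c * b = x := by
  constructor
  · intro hx
    let I : TwoSidedIdeal A := TwoSidedIdeal.mk' {x | ∃ b, c * b = x} ⟨0, by simp⟩
      (by rintro _ _ ⟨b, rfl⟩ ⟨b', rfl⟩; exact ⟨b + b', by rw [mul_add]⟩)
      (by rintro _ ⟨b, rfl⟩; exact ⟨-b, by simp⟩)
      (by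
        rintro a _ ⟨b, rfl⟩
        obtain ⟨a', ha⟩ := hc.2 a
        exact ⟨a' * b, by rw [← mul_assoc, ← ha, mul_assoc]⟩)
      (by rintro _ a ⟨b, rfl⟩; exact ⟨b * a, by rw [mul_assoc]⟩)
    have hle : TwoSidedIdeal.span {c} ≤ I := by
      rw [TwoSidedIdeal.span_le]
      rintro _ rfl
      change _ ∈ I
      rw [TwoSidedIdeal.mem_mk']
      exact ⟨1, by simp⟩
    have := hle hx
    rwa [TwoSidedIdeal.mem_mk'] at this
  · rintro ⟨b, rfl⟩
    exact TwoSidedIdeal.mul_mem_right _ _ _ (TwoSidedIdeal.subset_span rfl)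

/-- nonzero normal elements generating completely prime ideals -/
structure Good {A : Type} [Ring A] (c : A) : Prop where
  ne : c ≠ 0
  normal : IsNormalElem c
  one : ¬ ∃ b, c * b = 1
  prime : ∀ y z : A, (∃ b, c * b = y * z) → (∃ b, c * b = y) ∨ ∃ b, c * b = z

theorem Good.span {A : Type} [Ring A] {c : A} (h : Good c) : TwoSidedIdeal.span {c} ≠ ⊤ ∧
    ∀ y z : A, y * z ∈ TwoSidedIdeal.span {c} → y ∈ TwoSidedIdeal.span {c} ∨ z ∈ TwoSidedIdeal.span {c} := by
  refine ⟨fun ht => h.one ?_, fun y z hyz => ?_⟩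
  · rw [← mem_span_normal h.normal, ht]; trivial
  · rw [mem_span_normal h.normal] at hyz ⊢
    rw [mem_span_normal h.normal]
    exact h.prime y z hyz

open MulOpposite in
theorem Good.of_op {A : Type} [Ring A] {c : A} (h : Good (op c)) : Good c := by
  have hn : IsNormalElem c := by
    refine ⟨fun x => ?_, fun x => ?_⟩
    · obtain ⟨y, hy⟩ := h.normal.2 (op x)
      exact ⟨y.unop, by have := congrArg unop hy; simpa using this⟩
    · obtain ⟨y, hy⟩ := h.normal.1 (op x)
      exact ⟨y.unop, by have := congrArg unop hy; simpa using this⟩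
  have key : ∀ x, (∃ b, c * b = x) ↔ ∃ b, op c * b = op x := by
    intro x
    constructor
    · rintro ⟨b, rfl⟩
      obtain ⟨y, hy⟩ := hn.1 b
      exact ⟨op y, by rw [hy, op_mul]⟩
    · rintro ⟨b, hb⟩
      obtain ⟨y, hy⟩ := hn.2 b.unop
      refine ⟨y, ?_⟩
      rw [← hy]
      have := congrArg unop hb; simpa using this
  refine ⟨fun h0 => h.ne (by rw [h0]; rfl), hn, ?_, ?_⟩
  · rw [key]; exact h.one
  · intro y z
    rw [key, key, key, op_mul]
    intro hh
    exact (h.prime _ _ hh).symm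

open MulOpposite in
theorem mem_op {A : Type} [Ring A] {c x : A} (hn : IsNormalElem c) (h : ∃ b, c * b = x) : ∃ b, op c * b = op x := by
  obtain ⟨b, rfl⟩ := h
  obtain ⟨y, hy⟩ := hn.1 b
  exact ⟨op y, by rw [hy, op_mul]⟩

namespace QD
variable {n : ℕ} {A : Type} [Ring A] [Algebra ℂ A] {D : QD n A}

/-- the data defining one of the elements -/
structure El (D : QD n A) (k : Fin n) (c : A) : Prop where
  ex : ∃ i : D.I, D.hw i = Pi.single k 1 ∧ ∃ ξ v, v ∈ D.wt (D.X i .K) (D.hw i) ∧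
    D.supp i (D.act D.w0 (D.hw i)) ξ ∧ ξ ≠ 0 ∧ v ≠ 0 ∧ c = D.cf i ξ v

namespace El
variable {k k' : Fin n} {c c' : A}

theorem isF (h : D.El k c) : ∃ p η e, D.IsF p (Pi.single k 1) η c e := by
  obtain ⟨i, hi, ξ, v, hv, hξ, ξ0, v0, rfl⟩ := h
  obtain ⟨p, hp⟩ := D.w0_fund k
  have h1 := isM_cf hv hξ
  have h2 := QD.isF (p := p) h1 (cf_ne ξ0 v0) (D.hw_nonneg i) (by rw [hi, hp])
  rw [hi] at h2
  exact ⟨p, _, _, h2⟩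

theorem eps0 (h : D.El k c) : D.eps c = 0 := by
  obtain ⟨i, hi, ξ, v, hv, hξ, ξ0, v0, rfl⟩ := h
  rw [D.eps_cf]
  refine hξ _ ?_ v hv
  rw [hi]
  obtain ⟨p, hp⟩ := D.w0_fund k
  rw [hp]
  intro h
  have := congrFun h k
  by_cases hk : k = p
  · subst hk; simp at this
  · simp [hk] at this

theorem good (h : D.El k c) : Good c := by
  obtain ⟨p, η, e, hF⟩ := h.isF
  refine ⟨hF.c0, hF.normal, ?_, ?_⟩
  · rintro ⟨b, hb⟩
    have := congrArg D.eps hb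
    rw [map_mul, h.eps0, zero_mul, map_one] at this
    exact zero_ne_one this
  · exact fun y z hyz => hF.prime y z hyz

theorem distinct (h : D.El k c) (h' : D.El k' c') (hne : k ≠ k') : ¬ ∃ b, c * b = c' := by
  rintro ⟨b, hb⟩
  have nz := D.nzd
  obtain ⟨p, η, e, hF⟩ := h.isF
  obtain ⟨p', η', e', hF'⟩ := h'.isF
  have h1 := hF.bw_of_c (b := b) (g := (Pi.single k' 1, η')) (by rw [hb]; exact hF'.bw_c)
  have hE : D.l .E k b = 0 := by
    have := hF.toIsM.lE_left k b
    rw [hb, hF'.lE] at this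
    have := (smul_eq_zero.1 this.symm).resolve_left (zpow_ne_zero _ D.q_ne)
    exact (mul_eq_zero.1 this).resolve_left hF.c0
  have hb0 : b ≠ 0 := by rintro rfl; rw [mul_zero] at hb; exact hF'.c0 hb.symm
  obtain ⟨N, hN⟩ := nil_lF h1.1
  have := (D.l_tri.hw_dom h1.1 k hE hb0 ⟨N, by
    have := hN (List.replicate N k) (by simp)
    rwa [wd_replicate] at this⟩).1
  simp [hne] at this

theorem opposite (h : D.El k c) (i : D.I) {ξ : Module.Dual ℂ (D.V i)} {v : D.V i}
    (hv : v ∈ D.wt (D.X i .K) (D.act D.w0 (D.hw i))) (hξ : D.supp i (D.hw i) ξ) (ξ0 : ξ ≠ 0) (v0 : v ≠ 0) :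
    ¬ ∃ b, c * b = D.cf i ξ v := by
  intro hb
  obtain ⟨p, η, e, hF⟩ := h.isF
  have hb : D.cf i ξ v ∈ IsF.cI c := hb
  have hl : ∀ j, ∀ m ∈ IsF.cI c, D.l .E j m ∈ IsF.cI c := by
    rintro j _ ⟨b, rfl⟩
    rw [LinearMap.mulLeft_apply, hF.toIsM.lE_left]
    exact Submodule.smul_mem _ _ ⟨_, rfl⟩
  have hr : ∀ j, ∀ m ∈ IsF.cI c, D.r .E j m ∈ IsF.cI c := by
    rintro j _ ⟨b, rfl⟩
    rw [LinearMap.mulLeft_apply, hF.toIsM.rE_left]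
    exact Submodule.smul_mem _ _ ⟨_, rfl⟩
  have h1 : ∀ ξ', D.cf i ξ' v ∈ IsF.cI c := by
    have htop := D.dual_spanE_top i ξ0 hξ (D.supp_hi_f i hξ)
    have hle : spanW (dualOp (D.X i) .E) (Submodule.span ℂ {ξ}) ≤ (IsF.cI c).comap ((D.cf i).flip v) := by
      refine spanW_le fun w g hg => ?_
      obtain ⟨t, rfl⟩ := Submodule.mem_span_singleton.1 hg
      rw [map_smul]
      refine Submodule.smul_mem _ _ ?_
      rw [Submodule.mem_comap, LinearMap.flip_apply, ← r_wd_cf]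
      exact wd_mem _ hr w hb
    intro ξ'
    exact hle (by rw [htop]; trivial)
  have := D.one_mem_of_cf i v0 (IsF.cI c) (fun a p hp => IsF.cI_left hF.normal hp a) h1
  exact h.good.one this

end El
end QD
open scoped TensorProduct

def CD.swap {n : ℕ} (C : CD n) : CD n :=
  { C with w0 := C.w0⁻¹, w0_act := C.w0_inv_act }

theorem Tri.swapC {n : ℕ} {C : CD n} {M : Type} [AddCommGroup M] [Module ℂ M]
    {X : G4 → Fin n → Module.End ℂ M} (T : Tri C X) : Tri C.swap X := ⟨T.kki, T.kik, T.kk, T.ke, T.kf, T.ef⟩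

namespace QD
variable {n : ℕ} {A : Type} [Ring A] [Algebra ℂ A] (D : QD n A)
open MulOpposite

/-- transport of an operator to the opposite algebra -/
def opEnd (f : Module.End ℂ A) : Module.End ℂ Aᵐᵒᵖ :=
  (opLinearEquiv ℂ).toLinearMap ∘ₗ f ∘ₗ (opLinearEquiv ℂ).symm.toLinearMap

theorem opEnd_apply (f : Module.End ℂ A) (x : Aᵐᵒᵖ) : opEnd f x = op (f x.unop) := rfl

theorem opTri {C : CD n} {X : G4 → Fin n → Module.End ℂ A} (T : Tri C X) : Tri C (fun x i => opEnd (X x i)) where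
  kki i m := by simp [opEnd_apply, T.kki]
  kik i m := by simp [opEnd_apply, T.kik]
  kk i j m := by simp [opEnd_apply, T.kk i j]
  ke i j m := by simp [opEnd_apply, T.ke i j]
  kf i j m := by simp only [opEnd_apply, unop_op, T.kf i j, op_smul]
  ef i j m := by
    simp only [opEnd_apply, unop_op]
    rw [← op_sub, T.ef i j]
    split_ifs <;> simp

/-- exchange of the roles of `E` and `F` -/
noncomputable def swap : QD n Aᵐᵒᵖ where
  toCD := D.toCD.swap
  I := D.I
  V := D.V
  hw i := - D.act D.w0 (D.hw i)
  hw_nonneg i j := by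
    have := D.w0_act (D.hw i) (D.hw_nonneg i) j
    simpa using this
  hw_surj μ hμ := by
    obtain ⟨i, hi⟩ := D.hw_surj (- D.act D.w0⁻¹ μ) (fun j => by simpa using D.w0_inv_act μ hμ j)
    refine ⟨i, ?_⟩
    rw [hi, map_neg, neg_neg]
    exact D.act_act_inv _ _
  X i x := D.X i x.sw
  X_tri i := (D.X_tri i).sw.swapC
  X_simple i N hN := D.X_simple i N (fun x j v hv => by
    have := hN x.sw j v hv
    cases x <;> exact this)
  X_hw i := by
    obtain ⟨v, h0, h1, h2⟩ := D.exists_low i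
    exact ⟨v, h0, (D.X_tri i).mem_wt_ki.2 (by rw [neg_neg]; exact h1), h2⟩
  l x i := opEnd (D.l x.sw i)
  r x i := opEnd (D.r x.sw i)
  l_tri := (opTri D.l_tri.sw).swapC
  r_tri := by
    have h := (opTri D.r_tri.sw).swapC
    have e : (fun (x : G4) i => opEnd (D.r x.sw.tw i)) = fun (x : G4) i => opEnd (D.r x.tw.sw i) := by
      funext x i; cases x <;> rfl
    rw [e] at h
    exact h
  lr x y i j m := by simp [opEnd_apply, D.lr]
  lE_mul i x y := by
    simp only [opEnd_apply, G4.sw, unop_mul, D.lF_mul, op_add, op_mul, op_unop]; rw [add_comm]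
  lF_mul i x y := by
    simp only [opEnd_apply, G4.sw, unop_mul, D.lE_mul, op_add, op_mul, op_unop]; rw [add_comm]
  lK_mul i x y := by
    simp only [opEnd_apply, G4.sw, unop_mul, D.lKi_mul, op_mul]
  rE_mul i x y := by
    simp only [opEnd_apply, G4.sw, unop_mul, D.rF_mul, op_add, op_mul, op_unop]; rw [add_comm]
  rF_mul i x y := by
    simp only [opEnd_apply, G4.sw, unop_mul, D.rE_mul, op_add, op_mul, op_unop]; rw [add_comm]
  rK_mul i x y := by
    simp only [opEnd_apply, G4.sw, unop_mul, D.rKi_mul, op_mul]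
  lE_one i := by simp [opEnd_apply, G4.sw, D.lF_one]
  lF_one i := by simp [opEnd_apply, G4.sw, D.lE_one]
  lK_one i := by simp [opEnd_apply, G4.sw, D.lKi_one]
  rE_one i := by simp [opEnd_apply, G4.sw, D.rF_one]
  rF_one i := by simp [opEnd_apply, G4.sw, D.rE_one]
  rK_one i := by simp [opEnd_apply, G4.sw, D.rKi_one]
  cf i := (D.cf i).compr₂ (opLinearEquiv ℂ).toLinearMap
  l_cf i x j ξ v := congrArg op (D.l_cf i x.sw j ξ v)
  r_cf i x j ξ v := congrArg op (D.r_cf i x.sw j ξ v)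
  eps :=
    { toFun := fun x => D.eps x.unop
      map_one' := by simp
      map_mul' := fun x y => by simp [mul_comm]
      map_zero' := by simp
      map_add' := fun x y => by simp
      commutes' := fun r => by simp }
  eps_cf i ξ v := D.eps_cf i ξ v
  eps_lr x j m := D.eps_lr x.sw j m.unop
  sep N hN h0 := by
    have := D.sep (N.comap (opLinearEquiv ℂ).toLinearMap) (fun x j m hm => by
      have := hN x.sw j _ hm
      cases x <;> exact this) (fun m hm => h0 _ hm)
    rw [eq_bot_iff]
    intro x hx
    have hx' : x.unop ∈ N.comap (opLinearEquiv ℂ).toLinearMap := hx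
    rw [this, Submodule.mem_bot] at hx'
    rw [Submodule.mem_bot]
    exact unop_injective hx'
  gen := by
    rw [eq_top_iff]
    rintro x -
    have hx : x.unop ∈ Algebra.adjoin ℂ {x : A | ∃ i ξ v, x = D.cf i ξ v} := by rw [D.gen]; trivial
    rw [← op_unop x]
    generalize x.unop = x at hx
    induction hx using Algebra.adjoin_induction with
    | mem x hx =>
      obtain ⟨i, ξ, v, rfl⟩ := hx
      exact Algebra.subset_adjoin ⟨i, ξ, v, rfl⟩
    | algebraMap r => exact Subalgebra.algebraMap_mem _ r
    | add x y _ _ h1 h2 => exact Subalgebra.add_mem _ h1 h2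
    | mul x y _ _ h1 h2 => exact Subalgebra.mul_mem _ h2 h1

/-- the opposite elements -/
theorem swap_El (i : D.I) {k p : Fin n} (hi : D.hw i = Pi.single k 1) (hp : D.act D.w0 (Pi.single k 1) = - Pi.single p 1)
    {ξ : Module.Dual ℂ (D.V i)} {v : D.V i}
    (hv : v ∈ D.wt (D.X i .K) (D.act D.w0 (D.hw i))) (hξ : D.supp i (D.hw i) ξ) (ξ0 : ξ ≠ 0) (v0 : v ≠ 0) :
    D.swap.El p (op (D.cf i ξ v)) := by
  refine ⟨i, ?_, ξ, v, ?_, ?_, ξ0, v0, rfl⟩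
  · change - D.act D.w0 (D.hw i) = _
    rw [hi, hp, neg_neg]
  · exact (D.X_tri i).mem_wt_ki.2 (by
      change v ∈ D.wt (D.X i .K) (- - D.act D.w0 (D.hw i))
      rw [neg_neg]; exact hv)
  · intro ν hν x hx
    have hx' : x ∈ D.wt (D.X i .Ki) ν := hx
    refine hξ (-ν) ?_ x ((D.X_tri i).mem_wt_ki.1 hx')
    intro h
    apply hν
    change ν = D.act D.w0⁻¹ (- D.act D.w0 (D.hw i))
    rw [map_neg, D.act_inv_act, ← h, neg_neg]

end QD
open scoped TensorProduct

theorem QD.final {n : ℕ} {A : Type} [Ring A] [Algebra ℂ A] (D : QD n A) (ix : Fin n → D.I)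
    (hix : ∀ i, D.hw (ix i) = Pi.single i 1)
    (ξp ξm : ∀ i, Module.Dual ℂ (D.V (ix i))) (vp vm : ∀ i, D.V (ix i))
    (hξp : ∀ i, D.supp (ix i) (D.hw (ix i)) (ξp i)) (hξp0 : ∀ i, ξp i ≠ 0)
    (hvp : ∀ i, vp i ∈ D.wt (D.X (ix i) .K) (D.act D.w0 (D.hw (ix i)))) (hvp0 : ∀ i, vp i ≠ 0)
    (hξm : ∀ i, D.supp (ix i) (D.act D.w0 (D.hw (ix i))) (ξm i)) (hξm0 : ∀ i, ξm i ≠ 0)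
    (hvm : ∀ i, vm i ∈ D.wt (D.X (ix i) .K) (D.hw (ix i))) (hvm0 : ∀ i, vm i ≠ 0)
    (P M : Fin n → A) (hP : ∀ i, P i = D.cf (ix i) (ξp i) (vp i))
    (hM : ∀ i, M i = D.cf (ix i) (ξm i) (vm i)) :
    (∀ i : Fin n, P i ≠ 0 ∧ IsNormalElem (P i) ∧ M i ≠ 0 ∧ IsNormalElem (M i)) ∧
    (∀ x : Fin n ⊕ Fin n,
      TwoSidedIdeal.span {Sum.elim P M x} ≠ ⊤ ∧
      ∀ y z : A, y * z ∈ TwoSidedIdeal.span {Sum.elim P M x} →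
        y ∈ TwoSidedIdeal.span {Sum.elim P M x} ∨ z ∈ TwoSidedIdeal.span {Sum.elim P M x}) ∧
    Function.Injective (fun x : Fin n ⊕ Fin n => TwoSidedIdeal.span {Sum.elim P M x}) := by
  have hElM : ∀ i, D.El i (M i) := fun i =>
    ⟨ix i, hix i, ξm i, vm i, hvm i, hξm i, hξm0 i, hvm0 i, hM i⟩
  choose p hp using D.w0_fund
  have hElP : ∀ i, D.swap.El (p i) (MulOpposite.op (P i)) := fun i => by
    rw [hP]; exact D.swap_El (ix i) (hix i) (hp i) (hvp i) (hξp i) (hξp0 i) (hvp0 i)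
  have pinj : ∀ i j, p i = p j → i = j := by
    intro i j h
    have h1 := hp i
    rw [h, ← hp j] at h1
    have h2 := congrArg (D.act D.w0⁻¹) h1
    rw [D.act_inv_act, D.act_inv_act] at h2
    by_contra hne
    have := congrFun h2 i
    simp [hne] at this
  have gM : ∀ i, Good (M i) := fun i => (hElM i).good
  have gP : ∀ i, Good (P i) := fun i => Good.of_op (hElP i).good
  have key : ∀ {c c' : A}, Good c → TwoSidedIdeal.span {c} = TwoSidedIdeal.span {c'} →
      ∃ b, c * b = c' := by
    intro c c' g h
    rw [← mem_span_normal g.normal, h]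
    exact TwoSidedIdeal.subset_span rfl
  refine ⟨fun i => ⟨(gP i).ne, (gP i).normal, (gM i).ne, (gM i).normal⟩, ?_, ?_⟩
  · rintro (i | i)
    · exact (gP i).span
    · exact (gM i).span
  · rintro (i | i) (j | j) h
    · congr 1
      by_contra hne
      exact (hElP i).distinct (hElP j) (fun h => hne (pinj _ _ h))
        (mem_op (gP i).normal (key (gP i) h))
    · exfalso
      have := key (gM j) h.symm
      rw [Sum.elim_inl, hP i] at this
      exact (hElM j).opposite (ix i) (hvp i) (hξp i) (hξp0 i) (hvp0 i) this
    · exfalso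
      have := key (gM i) h
      rw [Sum.elim_inl, hP j] at this
      exact (hElM i).opposite (ix j) (hvp j) (hξp j) (hξp0 j) (hvp0 j) this
    · congr 1
      by_contra hne
      exact (hElM i).distinct (hElM j) hne (key (gM i) h)
open scoped TensorProduct

theorem transc_ne {q : ℂ} (hq : Transcendental ℚ q) : q ≠ 0 := by
  rintro rfl; exact hq isAlgebraic_zero

theorem transc_root {q : ℂ} (hq : Transcendental ℚ q) (m : ℤ) (h : q ^ m = 1) : m = 0 := by
  have key : ∀ k : ℕ, q ^ k = 1 → k = 0 := by
    intro k hk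
    by_contra hne
    apply hq
    refine ⟨Polynomial.X ^ k - 1, ?_, by simp [hk]⟩
    exact Polynomial.X_pow_sub_C_ne_zero (Nat.pos_of_ne_zero hne) (1 : ℚ)
  obtain ⟨k, rfl | rfl⟩ := m.eq_nat_or_neg
  · rw [zpow_natCast] at h; simp [key k h]
  · rw [zpow_neg, zpow_natCast, inv_eq_one] at h; simp [key k h]

section Dual
variable {U : Type} [Ring U] [Algebra ℂ U]

/-- translation by right multiplication in the argument -/
noncomputable def tL (g : U) : (U →ₗ[ℂ] ℂ) →ₗ[ℂ] (U →ₗ[ℂ] ℂ) where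
  toFun f := f ∘ₗ LinearMap.mulRight ℂ g
  map_add' _ _ := rfl
  map_smul' _ _ := rfl

/-- translation by left multiplication in the argument -/
noncomputable def tR (g : U) : (U →ₗ[ℂ] ℂ) →ₗ[ℂ] (U →ₗ[ℂ] ℂ) where
  toFun f := f ∘ₗ LinearMap.mulLeft ℂ g
  map_add' _ _ := rfl
  map_smul' _ _ := rfl

theorem tL_apply (g : U) (f : U →ₗ[ℂ] ℂ) (u : U) : tL g f u = f (u * g) := rfl
theorem tR_apply (g : U) (f : U →ₗ[ℂ] ℂ) (u : U) : tR g f u = f (g * u) := rfl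

/-- convolution -/
noncomputable def cv (Δ : U →ₐ[ℂ] U ⊗[ℂ] U) (x y : U →ₗ[ℂ] ℂ) : U →ₗ[ℂ] ℂ :=
  (TensorProduct.lid ℂ ℂ).toLinearMap ∘ₗ (TensorProduct.map x y) ∘ₗ Δ.toLinearMap

variable {Δ : U →ₐ[ℂ] U ⊗[ℂ] U}

theorem pair_mulR (x y : U →ₗ[ℂ] ℂ) (a b : U) (z : U ⊗[ℂ] U) :
    TensorProduct.lid ℂ ℂ (TensorProduct.map x y (z * (a ⊗ₜ b))) =
    TensorProduct.lid ℂ ℂ (TensorProduct.map (tL a x) (tL b y) z) := by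
  induction z with
  | zero => simp
  | add s t hs ht => simp only [add_mul, map_add, hs, ht]
  | tmul s t => simp [tL_apply]

theorem pair_mulL (x y : U →ₗ[ℂ] ℂ) (a b : U) (z : U ⊗[ℂ] U) :
    TensorProduct.lid ℂ ℂ (TensorProduct.map x y ((a ⊗ₜ b) * z)) =
    TensorProduct.lid ℂ ℂ (TensorProduct.map (tR a x) (tR b y) z) := by
  induction z with
  | zero => simp
  | add s t hs ht => simp only [mul_add, map_add, hs, ht]
  | tmul s t => simp [tR_apply]

theorem tL_cv {g a b c e : U} (hg : Δ g = a ⊗ₜ b + c ⊗ₜ e) (x y : U →ₗ[ℂ] ℂ) :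
    tL g (cv Δ x y) = cv Δ (tL a x) (tL b y) + cv Δ (tL c x) (tL e y) := by
  ext u
  simp only [tL_apply, cv, LinearMap.comp_apply, AlgHom.toLinearMap_apply, map_mul, hg, mul_add,
    map_add, LinearMap.add_apply, LinearEquiv.coe_coe]
  rw [pair_mulR, pair_mulR]

theorem tR_cv {g a b c e : U} (hg : Δ g = a ⊗ₜ b + c ⊗ₜ e) (x y : U →ₗ[ℂ] ℂ) :
    tR g (cv Δ x y) = cv Δ (tR a x) (tR b y) + cv Δ (tR c x) (tR e y) := by
  ext u
  simp only [tR_apply, cv, LinearMap.comp_apply, AlgHom.toLinearMap_apply, map_mul, hg, add_mul,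
    map_add, LinearMap.add_apply, LinearEquiv.coe_coe]
  rw [pair_mulL, pair_mulL]

theorem tL_zero (x : U →ₗ[ℂ] ℂ) : tL (0 : U) x = 0 := by ext u; simp [tL_apply]
theorem tR_zero (x : U →ₗ[ℂ] ℂ) : tR (0 : U) x = 0 := by ext u; simp [tR_apply]
theorem tL_one (x : U →ₗ[ℂ] ℂ) : tL (1 : U) x = x := by ext u; simp [tL_apply]
theorem tR_one (x : U →ₗ[ℂ] ℂ) : tR (1 : U) x = x := by ext u; simp [tR_apply]
theorem tL_eps (ε : U →ₐ[ℂ] ℂ) (g : U) : tL g ε.toLinearMap = ε g • ε.toLinearMap := by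
  ext u; simp [tL_apply, mul_comm]
theorem tR_eps (ε : U →ₐ[ℂ] ℂ) (g : U) : tR g ε.toLinearMap = ε g • ε.toLinearMap := by
  ext u; simp [tR_apply]
theorem cv_zero (x : U →ₗ[ℂ] ℂ) : cv Δ 0 x = 0 := by
  simp [cv]

/-- the generators -/
def G4.el {n : ℕ} (E F : Fin n → U) (K : Fin n → Uˣ) : G4 → Fin n → U
  | .E, j => E j
  | .F, j => F j
  | .K, j => (K j : U)
  | .Ki, j => (((K j)⁻¹ : Uˣ) : U)

theorem inv_grouplike (k : Uˣ) (h : Δ (k : U) = (k : U) ⊗ₜ (k : U)) :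
    Δ ((k⁻¹ : Uˣ) : U) = ((k⁻¹ : Uˣ) : U) ⊗ₜ ((k⁻¹ : Uˣ) : U) := by
  have h1 : Δ ((k⁻¹ : Uˣ) : U) * Δ (k : U) = 1 := by rw [← map_mul]; simp
  have h2 : ((k : U) ⊗ₜ[ℂ] (k : U)) * (((k⁻¹ : Uˣ) : U) ⊗ₜ[ℂ] ((k⁻¹ : Uˣ) : U)) = 1 := by
    simp [Algebra.TensorProduct.one_def]
  rw [h] at h1
  exact left_inv_eq_right_inv h1 h2

theorem exists_end {A : Type} [Ring A] [Algebra ℂ A] {ι : A →ₗ[ℂ] (U →ₗ[ℂ] ℂ)}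
    (hι : Function.Injective ι) (T : (U →ₗ[ℂ] ℂ) →ₗ[ℂ] (U →ₗ[ℂ] ℂ))
    (h : ∀ a, ∃ b, ι b = T (ι a)) : ∃ l : Module.End ℂ A, ∀ a, ι (l a) = T (ι a) := by
  choose f hf using h
  exact ⟨{ toFun := f
           map_add' := fun x y => hι (by simp [hf])
           map_smul' := fun c x => hι (by simp [hf]) }, hf⟩

theorem exists_translate {A : Type} [Ring A] [Algebra ℂ A] {ι : A →ₗ[ℂ] (U →ₗ[ℂ] ℂ)}
    {ε : U →ₐ[ℂ] ℂ}
    (hι : Function.Injective ι) (hι1 : ι 1 = ε.toLinearMap)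
    (hιmul : ∀ x y : A, ι (x * y) = cv Δ (ι x) (ι y)) {S : Set A} (hS : Algebra.adjoin ℂ S = ⊤)
    {n : ℕ} (E F : Fin n → U) (K : Fin n → Uˣ) (t : U → (U →ₗ[ℂ] ℂ) →ₗ[ℂ] (U →ₗ[ℂ] ℂ))
    (ht1 : ∀ x, t 1 x = x) (ht0 : ∀ x, t 0 x = 0) (hte : ∀ g, t g ε.toLinearMap = ε g • ε.toLinearMap)
    (htm : ∀ (g a b c e : U), Δ g = a ⊗ₜ b + c ⊗ₜ e → ∀ x y,
      t g (cv Δ x y) = cv Δ (t a x) (t b y) + cv Δ (t c x) (t e y))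
    (hΔE : ∀ i, Δ (E i) = E i ⊗ₜ 1 + (K i : U) ⊗ₜ E i)
    (hΔF : ∀ i, Δ (F i) = F i ⊗ₜ (((K i)⁻¹ : Uˣ) : U) + 1 ⊗ₜ F i)
    (hΔK : ∀ i, Δ (K i : U) = (K i : U) ⊗ₜ (K i : U))
    (hεE : ∀ i, ε (E i) = 0) (hεF : ∀ i, ε (F i) = 0) (hεK : ∀ i, ε (K i : U) = 1)
    (hgen : ∀ g, ∀ a ∈ S, ∃ b, ι b = t g (ι a)) :
    ∃ l : G4 → Fin n → Module.End ℂ A, (∀ x j a, ι (l x j a) = t (G4.el E F K x j) (ι a)) ∧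
      (∀ i x y, l .E i (x * y) = l .E i x * y + l .K i x * l .E i y) ∧
      (∀ i x y, l .F i (x * y) = l .F i x * l .Ki i y + x * l .F i y) ∧
      (∀ i x y, l .K i (x * y) = l .K i x * l .K i y) ∧
      (∀ i, l .E i 1 = 0) ∧ (∀ i, l .F i 1 = 0) ∧ (∀ i, l .K i 1 = 1) := by
  have mE : ∀ i x y, t (E i) (cv Δ x y) = cv Δ (t (E i) x) y + cv Δ (t (K i) x) (t (E i) y) := by
    intro i x y; rw [htm _ _ _ _ _ (hΔE i), ht1]
  have mF : ∀ i x y, t (F i) (cv Δ x y) = cv Δ (t (F i) x) (t (((K i)⁻¹ : Uˣ) : U) y) + cv Δ x (t (F i) y) := by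
    intro i x y; rw [htm _ _ _ _ _ (hΔF i), ht1]
  have mK : ∀ i x y, t (K i) (cv Δ x y) = cv Δ (t (K i) x) (t (K i) y) := by
    intro i x y
    rw [htm _ (K i) (K i) 0 0 (by rw [hΔK]; simp), ht0, cv_zero, add_zero]
  have mKi : ∀ i x y, t (((K i)⁻¹ : Uˣ) : U) (cv Δ x y) =
      cv Δ (t (((K i)⁻¹ : Uˣ) : U) x) (t (((K i)⁻¹ : Uˣ) : U) y) := by
    intro i x y
    rw [htm _ (((K i)⁻¹ : Uˣ) : U) (((K i)⁻¹ : Uˣ) : U) 0 0 (by rw [inv_grouplike _ (hΔK i), TensorProduct.zero_tmul, add_zero]), ht0, cv_zero, add_zero]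
  have ex : ∀ a : A, ∀ x j, ∃ b, ι b = t (G4.el E F K x j) (ι a) := by
    intro a
    have ha : a ∈ Algebra.adjoin ℂ S := by rw [hS]; trivial
    induction ha using Algebra.adjoin_induction with
    | mem a ha => intro x j; exact hgen _ a ha
    | algebraMap c =>
      intro x j
      refine ⟨algebraMap ℂ A (ε (G4.el E F K x j) * c), ?_⟩
      rw [Algebra.algebraMap_eq_smul_one, Algebra.algebraMap_eq_smul_one, map_smul, map_smul,
        map_smul, hι1, hte, smul_smul, mul_comm]
    | add a b _ _ iha ihb =>
      intro x j
      obtain ⟨a', h1⟩ := iha x j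
      obtain ⟨b', h2⟩ := ihb x j
      exact ⟨a' + b', by rw [map_add, map_add, map_add, h1, h2]⟩
    | mul a b _ _ iha ihb =>
      intro x j
      choose fa hfa using iha
      choose fb hfb using ihb
      cases x with
      | E => exact ⟨fa .E j * b + fa .K j * fb .E j, by
          rw [map_add, hιmul, hιmul, hιmul, hfa, hfa, hfb]; exact (mE j _ _).symm⟩
      | F => exact ⟨fa .F j * fb .Ki j + a * fb .F j, by
          rw [map_add, hιmul, hιmul, hιmul, hfa, hfb, hfb]; exact (mF j _ _).symm⟩
      | K => exact ⟨fa .K j * fb .K j, by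
          rw [hιmul, hιmul, hfa, hfb]; exact (mK j _ _).symm⟩
      | Ki => exact ⟨fa .Ki j * fb .Ki j, by
          rw [hιmul, hιmul, hfa, hfb]; exact (mKi j _ _).symm⟩
  have ex2 : ∀ x j, ∃ l : Module.End ℂ A, ∀ a, ι (l a) = t (G4.el E F K x j) (ι a) :=
    fun x j => exists_end hι _ (fun a => ex a x j)
  choose l hl using ex2
  refine ⟨l, hl, ?_, ?_, ?_, ?_, ?_, ?_⟩
  · intro i x y; apply hι
    rw [map_add, hιmul, hιmul, hl, hl, hl, hl, hιmul]; exact mE i _ _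
  · intro i x y; apply hι
    rw [map_add, hιmul, hιmul, hl, hl, hl, hl, hιmul]; exact mF i _ _
  · intro i x y; apply hι
    rw [hιmul, hl, hl, hl, hιmul]; exact mK i _ _
  · intro i; apply hι
    rw [hl, hι1, hte, map_zero]; simp [G4.el, hεE]
  · intro i; apply hι
    rw [hl, hι1, hte, map_zero]; simp [G4.el, hεF]
  · intro i; apply hι
    rw [hl, hι1, hte]; simp [G4.el, hεK]

end Dual
open scoped TensorProduct

theorem UqRels.of_injective {q : ℂ} {n : ℕ} {a : Fin n → Fin n → ℤ} {d : Fin n → ℕ}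
    {U B : Type} [Ring U] [Algebra ℂ U] [Ring B] [Algebra ℂ B] (f : B →ₐ[ℂ] U)
    (hf : Function.Injective f) {E F : Fin n → B} {K : Fin n → Bˣ}
    {E' F' : Fin n → U} {K' : Fin n → Uˣ} (hE : ∀ i, f (E i) = E' i) (hF : ∀ i, f (F i) = F' i)
    (hK : ∀ i, f (K i) = K' i) (hKi : ∀ i, f (((K i)⁻¹ : Bˣ) : B) = (((K' i)⁻¹ : Uˣ) : U))
    (h : UqRels q a d U E' F' K') : UqRels q a d B E F K := by
  obtain ⟨h1, h2, h3, h4, h5, h6⟩ := h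
  refine ⟨?_, ?_, ?_, ?_, ?_, ?_⟩
  · intro i j; apply hf; simp only [map_mul, hK, h1 i j]
  · intro i j; apply hf; simp only [map_mul, map_smul, hK, hE, h2 i j]
  · intro i j; apply hf; simp only [map_mul, map_smul, hK, hF, h3 i j]
  · intro i j; apply hf
    rw [map_sub, map_mul, map_mul, hE, hF, h4 i j]
    by_cases hij : i = j
    · simp only [hij, if_true, map_smul, map_sub, hK, hKi]
    · simp only [hij, if_false, map_zero]
  · intro i j hij; apply hf
    simp only [map_sum, map_smul, map_mul, map_pow, hE, map_zero]
    exact h5 i j hij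
  · intro i j hij; apply hf
    simp only [map_sum, map_smul, map_mul, map_pow, hF, map_zero]
    exact h6 i j hij

theorem Uq_adjoin {q : ℂ} {n : ℕ} {a : Fin n → Fin n → ℤ} {d : Fin n → ℕ}
    {U : Type} [Ring U] [Algebra ℂ U]
    {E F : Fin n → U} {K : Fin n → Uˣ}
    (hrel : UqRels q a d U E F K)
    (hUuniv : ∀ (B : Type) [Ring B] [Algebra ℂ B] (E' F' : Fin n → B) (K' : Fin n → Bˣ),
      UqRels q a d B E' F' K' → ∃! φ : U →ₐ[ℂ] B,
        (∀ i, φ (E i) = E' i) ∧ (∀ i, φ (F i) = F' i) ∧ (∀ i, φ (K i : U) = (K' i : B))) :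
    Algebra.adjoin ℂ {u : U | ∃ x j, u = G4.el E F K x j} = ⊤ := by
  set S := Algebra.adjoin ℂ {u : U | ∃ x j, u = G4.el E F K x j} with hS
  have hm : ∀ x j, G4.el E F K x j ∈ S := fun x j => Algebra.subset_adjoin ⟨x, j, rfl⟩
  let K' : Fin n → Sˣ := fun j => ⟨⟨_, hm .K j⟩, ⟨_, hm .Ki j⟩, Subtype.ext (by simp [G4.el]),
    Subtype.ext (by simp [G4.el])⟩
  have h := UqRels.of_injective (q := q) (a := a) (d := d) S.val Subtype.val_injective
    (E := fun j => ⟨_, hm .E j⟩) (F := fun j => ⟨_, hm .F j⟩) (K := K')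
    (fun _ => rfl) (fun _ => rfl) (fun _ => rfl) (fun _ => rfl) hrel
  obtain ⟨φ, ⟨p1, p2, p3⟩, -⟩ := hUuniv S _ _ _ h
  have huni := (hUuniv U E F K hrel).unique (y₁ := S.val.comp φ) (y₂ := AlgHom.id ℂ U)
    ⟨fun i => by rw [AlgHom.comp_apply, p1]; rfl, fun i => by rw [AlgHom.comp_apply, p2]; rfl,
      fun i => by rw [AlgHom.comp_apply, p3]; rfl⟩ ⟨fun _ => rfl, fun _ => rfl, fun _ => rfl⟩
  rw [eq_top_iff]
  intro u _
  have := DFunLike.congr_fun huni u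
  change ((φ u : S) : U) = u at this
  rw [← this]
  exact (φ u).2

theorem mem_wtSp {q : ℂ} {n : ℕ} {d : Fin n → ℕ}
    {U : Type} [Ring U] [Algebra ℂ U] {K : Fin n → Uˣ}
    {Vc : Type} [AddCommGroup Vc] [Module ℂ Vc] {ρ : U →ₐ[ℂ] Module.End ℂ Vc}
    {μ : Fin n → ℤ} {v : Vc} : v ∈ wtSp q d K ρ μ ↔
      ∀ i, ρ (K i : U) v = q ^ (μ i * (d i : ℤ)) • v := by
  simp [wtSp, Submodule.mem_iInf, sub_eq_zero]
theorem normal_elements_completely_prime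
    -- the deformation parameter: a transcendental complex number
    (q : ℂ) (hq : Transcendental ℚ q)
    -- Cartan data of the complex semisimple Lie algebra 𝔤 of rank n
    (n : ℕ) (hn : 0 < n) (a : Fin n → Fin n → ℤ) (d : Fin n → ℕ)
    (ha_diag : ∀ i, a i i = 2) (ha_off : ∀ i j, i ≠ j → a i j ≤ 0)
    (ha_zero : ∀ i j, a i j = 0 ↔ a j i = 0)
    (hd_pos : ∀ i, 0 < d i)
    (ha_symm : ∀ i j, (d i : ℤ) * a i j = (d j : ℤ) * a j i)
    -- the quantised enveloping algebra U = U_q(𝔤): carries elements E i, F i and units K i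
    -- satisfying the defining relations, and is universal for these relations
    (U : Type) [Ring U] [Algebra ℂ U]
    (E F : Fin n → U) (K : Fin n → Uˣ)
    (hrel : UqRels q a d U E F K)
    (hUuniv : ∀ (B : Type) [Ring B] [Algebra ℂ B] (E' F' : Fin n → B) (K' : Fin n → Bˣ),
      UqRels q a d B E' F' K' → ∃! φ : U →ₐ[ℂ] B,
        (∀ i, φ (E i) = E' i) ∧ (∀ i, φ (F i) = F' i) ∧ (∀ i, φ (K i : U) = (K' i : B)))
    -- the Hopf algebra structure of U_q(𝔤)
    (Δ : U →ₐ[ℂ] U ⊗[ℂ] U) (ε : U →ₐ[ℂ] ℂ)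
    (hΔE : ∀ i, Δ (E i) = E i ⊗ₜ 1 + (K i : U) ⊗ₜ E i)
    (hΔF : ∀ i, Δ (F i) = F i ⊗ₜ (((K i)⁻¹ : Uˣ) : U) + 1 ⊗ₜ F i)
    (hΔK : ∀ i, Δ (K i : U) = (K i : U) ⊗ₜ (K i : U))
    (hεE : ∀ i, ε (E i) = 0) (hεF : ∀ i, ε (F i) = 0) (hεK : ∀ i, ε (K i : U) = 1)
    -- the Weyl group W, acting faithfully on the weight lattice P = ℤⁿ (coordinates taken in
    -- the basis of fundamental weights ϖ i), generated by the simple reflections s i, with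
    -- longest element w₀ (characterised by: w₀ maps dominant weights to antidominant ones)
    (W : Type) [Group W] [Finite W] (σ : W →* Multiplicative (AddAut (Fin n → ℤ)))
    (hσinj : Function.Injective σ)
    (s : Fin n → W) (hsgen : Subgroup.closure (Set.range s) = ⊤)
    (hs : ∀ i (μ : Fin n → ℤ), σ (s i) μ = fun k => μ k - μ i * a k i)
    (w₀ : W) (hw₀ : ∀ μ : Fin n → ℤ, (∀ i, 0 ≤ μ i) → ∀ i, σ w₀ μ i ≤ 0)
    -- the simple finite-dimensional modules V(λ) of highest weight λ = ∑ c i ϖ i ∈ P⁺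
    (V : (Fin n → ℕ) → Type) [∀ c, AddCommGroup (V c)] [∀ c, Module ℂ (V c)]
    (ρ : ∀ c, U →ₐ[ℂ] Module.End ℂ (V c))
    (hfd : ∀ c, FiniteDimensional ℂ (V c))
    (hsimple : ∀ c (N : Submodule ℂ (V c)), (∀ (u : U), ∀ v ∈ N, ρ c u v ∈ N) → N = ⊥ ∨ N = ⊤)
    (hhw : ∀ c, ∃ v : V c, v ≠ 0 ∧ v ∈ wtSp q d K (ρ c) (fun i => (c i : ℤ)) ∧
      ∀ i, ρ c (E i) v = 0)
    (hwtsum : ∀ c, (⨆ μ : Fin n → ℤ, wtSp q d K (ρ c) μ) = ⊤)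
    (hextremal : ∀ c (w : W),
      Module.finrank ℂ (wtSp q d K (ρ c) (σ w (fun i => (c i : ℤ)))) = 1)
    -- the quantised coordinate ring A = O_q(G): an algebra of linear forms on U (via the
    -- injection ι into the dual space, multiplication being convolution through Δ),
    -- generated by the coordinate functions cf c ξ v = c^λ_{ξ,v} : u ↦ ξ (u · v)
    (A : Type) [Ring A] [Algebra ℂ A]
    (ι : A →ₗ[ℂ] (U →ₗ[ℂ] ℂ)) (hιinj : Function.Injective ι)
    (hι1 : ι 1 = ε.toLinearMap)
    (hιmul : ∀ x y : A, ι (x * y) =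
      (TensorProduct.lid ℂ ℂ).toLinearMap ∘ₗ (TensorProduct.map (ι x) (ι y)) ∘ₗ Δ.toLinearMap)
    (cf : ∀ c : Fin n → ℕ, Module.Dual ℂ (V c) → V c → A)
    (hcf : ∀ c ξ v u, ι (cf c ξ v) u = ξ (ρ c u v))
    (hAgen : Algebra.adjoin ℂ {x : A | ∃ c ξ v, x = cf c ξ v} = ⊤)
    -- choices of the (essentially unique) coordinate functions c^{ϖ_i}_{-ϖ_i, w₀ϖ_i} and
    -- c^{ϖ_i}_{-w₀ϖ_i, ϖ_i}, for i = 1, …, n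
    (ξp ξm : ∀ i : Fin n, Module.Dual ℂ (V (Pi.single i 1)))
    (vp vm : ∀ i : Fin n, V (Pi.single i 1))
    (hξp : ∀ i, inDualWt q d K (ρ (Pi.single i 1)) (fun k => -((Pi.single i 1 : Fin n → ℕ) k : ℤ)) (ξp i) ∧ ξp i ≠ 0)
    (hvp : ∀ i, vp i ∈ wtSp q d K (ρ (Pi.single i 1)) (σ w₀ (fun k => ((Pi.single i 1 : Fin n → ℕ) k : ℤ))) ∧ vp i ≠ 0)
    (hξm : ∀ i, inDualWt q d K (ρ (Pi.single i 1)) (-(σ w₀ (fun k => ((Pi.single i 1 : Fin n → ℕ) k : ℤ)))) (ξm i) ∧ ξm i ≠ 0)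
    (hvm : ∀ i, vm i ∈ wtSp q d K (ρ (Pi.single i 1)) (fun k => ((Pi.single i 1 : Fin n → ℕ) k : ℤ)) ∧ vm i ≠ 0) :
    -- the 2n coordinate functions are nonzero normal elements generating pairwise distinct
    -- completely prime ideals of O_q(G)
    (∀ i : Fin n, cf (Pi.single i 1) (ξp i) (vp i) ≠ 0 ∧
        IsNormalElem (cf (Pi.single i 1) (ξp i) (vp i)) ∧
        cf (Pi.single i 1) (ξm i) (vm i) ≠ 0 ∧
        IsNormalElem (cf (Pi.single i 1) (ξm i) (vm i))) ∧
    (∀ x : Fin n ⊕ Fin n,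
      TwoSidedIdeal.span {Sum.elim (fun i => cf (Pi.single i 1) (ξp i) (vp i)) (fun i => cf (Pi.single i 1) (ξm i) (vm i)) x} ≠ ⊤ ∧
      ∀ y z : A, y * z ∈ TwoSidedIdeal.span {Sum.elim (fun i => cf (Pi.single i 1) (ξp i) (vp i)) (fun i => cf (Pi.single i 1) (ξm i) (vm i)) x} →
        y ∈ TwoSidedIdeal.span {Sum.elim (fun i => cf (Pi.single i 1) (ξp i) (vp i)) (fun i => cf (Pi.single i 1) (ξm i) (vm i)) x} ∨ z ∈ TwoSidedIdeal.span {Sum.elim (fun i => cf (Pi.single i 1) (ξp i) (vp i)) (fun i => cf (Pi.single i 1) (ξm i) (vm i)) x}) ∧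
    Function.Injective (fun x : Fin n ⊕ Fin n => TwoSidedIdeal.span {Sum.elim (fun i => cf (Pi.single i 1) (ξp i) (vp i)) (fun i => cf (Pi.single i 1) (ξm i) (vm i)) x}) := by
  obtain ⟨r1, r2, r3, r4, -, -⟩ := id hrel
  have hadj := Uq_adjoin hrel hUuniv
  letI : Fintype W := Fintype.ofFinite W
  let C : CD n :=
    { q := q, q_ne := transc_ne hq, q_root := transc_root hq, a := a, d := d, d_pos := hd_pos
      a_diag := ha_diag, a_symm := ha_symm, W := W
      act := fun w => ((Multiplicative.toAdd (σ w) : AddAut (Fin n → ℤ)) : (Fin n → ℤ) ≃+ (Fin n → ℤ)).toAddMonoidHom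
      act_one := fun μ => by simp only [map_one]; rfl
      act_mul := fun v w μ => by simp only [map_mul]; rfl
      s := s, s_gen := hsgen, s_act := hs, w0 := w₀, w0_act := hw₀ }
  have hιmul' : ∀ x y : A, ι (x * y) = cv Δ (ι x) (ι y) := hιmul
  obtain ⟨l, hl, lE, lF, lK, lE1, lF1, lK1⟩ := exists_translate hιinj hι1 hιmul' hAgen E F K tL tL_one
    tL_zero (tL_eps ε) (fun g a b c e h x y => tL_cv h x y) hΔE hΔF hΔK hεE hεF hεK (by
      rintro g _ ⟨c, ξ, v, rfl⟩
      exact ⟨cf c ξ (ρ c g v), by ext u; rw [tL_apply, hcf, hcf, map_mul]; rfl⟩)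
  obtain ⟨r, hr, rE, rF, rK, rE1, rF1, rK1⟩ := exists_translate hιinj hι1 hιmul' hAgen E F K tR tR_one
    tR_zero (tR_eps ε) (fun g a b c e h x y => tR_cv h x y) hΔE hΔF hΔK hεE hεF hεK (by
      rintro g _ ⟨c, ξ, v, rfl⟩
      exact ⟨cf c (ξ ∘ₗ ρ c g) v, by ext u; rw [tR_apply, hcf, hcf, map_mul]; rfl⟩)
  have hl' : ∀ x j m u, ι (l x j m) u = ι m (u * G4.el E F K x j) := fun x j m u => by
    rw [hl]; rfl
  have hr' : ∀ x j m u, ι (r x j m) u = ι m (G4.el E F K x j * u) := fun x j m u => by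
    rw [hr]; rfl
  have hcf_ext : ∀ {m m' : A}, (∀ u, ι m u = ι m' u) → m = m' := fun h =>
    hιinj (LinearMap.ext h)
  let cfL : ∀ c, Module.Dual ℂ (V c) →ₗ[ℂ] V c →ₗ[ℂ] A := fun c => LinearMap.mk₂ ℂ (cf c)
    (fun x y v => hcf_ext fun u => by simp [hcf]) (fun t x v => hcf_ext fun u => by simp [hcf])
    (fun x v w => hcf_ext fun u => by simp [hcf]) (fun t x v => hcf_ext fun u => by simp [hcf])
  have hΔ1 : Δ 1 = (1 : U) ⊗ₜ[ℂ] (1 : U) := by rw [map_one]; rfl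
  let D : QD n A :=
    { toCD := C
      I := Fin n → ℕ
      V := V
      vfd := hfd
      hw := fun c i => (c i : ℤ)
      hw_nonneg := fun c j => Int.natCast_nonneg _
      hw_surj := fun μ h => ⟨fun i => (μ i).toNat, by ext i; simp [h i]⟩
      X := fun c x j => ρ c (G4.el E F K x j)
      X_tri := fun c =>
        { kki := fun i m => by
            change (ρ c _ * ρ c _) m = m
            rw [← map_mul]; simp [G4.el]
          kik := fun i m => by
            change (ρ c _ * ρ c _) m = m
            rw [← map_mul]; simp [G4.el]
          kk := fun i j m => by
            change (ρ c _ * ρ c _) m = (ρ c _ * ρ c _) m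
            rw [← map_mul, ← map_mul]; simp only [G4.el, r1 i j]
          ke := fun i j m => by
            change (ρ c _ * ρ c _) m = _ • (ρ c _ * ρ c _) m
            rw [← map_mul, ← map_mul]; simp only [G4.el, r2 i j, map_smul, LinearMap.smul_apply]; rfl
          kf := fun i j m => by
            change (ρ c _ * ρ c _) m = _ • (ρ c _ * ρ c _) m
            rw [← map_mul, ← map_mul]; simp only [G4.el, r3 i j, map_smul, LinearMap.smul_apply]; rfl
          ef := fun i j m => by
            change (ρ c _ * ρ c _) m - (ρ c _ * ρ c _) m = _
            rw [← map_mul, ← map_mul, ← LinearMap.sub_apply, ← map_sub]; simp only [G4.el, r4 i j]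
            split_ifs with h
            · simp only [map_smul, LinearMap.smul_apply, map_sub, LinearMap.sub_apply]; rfl
            · simp }
      X_simple := fun c N hN => by
        apply hsimple c N
        intro u
        have hu : u ∈ Algebra.adjoin ℂ {u : U | ∃ x j, u = G4.el E F K x j} := by
          rw [hadj]; trivial
        induction hu using Algebra.adjoin_induction with
        | mem u hu => obtain ⟨x, j, rfl⟩ := hu; exact hN x j
        | algebraMap t =>
          intro v hv
          rw [AlgHom.commutes]
          exact N.smul_mem t hv
        | add u u' _ _ h h' =>
          intro v hv
          rw [map_add]
          exact N.add_mem (h v hv) (h' v hv)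
        | mul u u' _ _ h h' =>
          intro v hv
          rw [map_mul]
          exact h _ (h' v hv)
      X_hw := fun c => by
        obtain ⟨v, h0, h1, h2⟩ := hhw c
        exact ⟨v, h0, mem_wtSp.1 h1, h2⟩
      l := l
      r := r
      l_tri :=
        { kki := fun i m => hcf_ext fun u => by
            rw [hl', hl', mul_assoc]; simp [G4.el]
          kik := fun i m => hcf_ext fun u => by
            rw [hl', hl', mul_assoc]; simp [G4.el]
          kk := fun i j m => hcf_ext fun u => by
            rw [hl', hl', hl', hl', mul_assoc, mul_assoc]; simp only [G4.el, r1 i j]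
          ke := fun i j m => hcf_ext fun u => by
            rw [map_smul, LinearMap.smul_apply, hl', hl', hl', hl', mul_assoc, mul_assoc]
            simp only [G4.el, r2 i j, mul_smul_comm, map_smul]; rfl
          kf := fun i j m => hcf_ext fun u => by
            rw [map_smul, LinearMap.smul_apply, hl', hl', hl', hl', mul_assoc, mul_assoc]
            simp only [G4.el, r3 i j, mul_smul_comm, map_smul]; rfl
          ef := fun i j m => hcf_ext fun u => by
            rw [map_sub, LinearMap.sub_apply, hl', hl', hl', hl', mul_assoc, mul_assoc, ← map_sub,
              ← mul_sub]
            simp only [G4.el, r4 i j]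
            split_ifs with h
            · rw [mul_smul_comm, map_smul, map_smul, LinearMap.smul_apply, map_sub,
                LinearMap.sub_apply, hl', hl', mul_sub, map_sub]; rfl
            · simp }
      r_tri :=
        { kki := fun i m => hcf_ext fun u => by
            simp only [G4.tw]
            rw [hr', hr', ← mul_assoc]; simp [G4.el]
          kik := fun i m => hcf_ext fun u => by
            simp only [G4.tw]
            rw [hr', hr', ← mul_assoc]; simp [G4.el]
          kk := fun i j m => hcf_ext fun u => by
            simp only [G4.tw]
            rw [hr', hr', hr', hr', ← mul_assoc, ← mul_assoc]; simp only [G4.el, r1 i j]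
          ke := fun i j m => hcf_ext fun u => by
            simp only [G4.tw]
            rw [map_smul, LinearMap.smul_apply, hr', hr', hr', hr', ← mul_assoc, ← mul_assoc]
            simp only [G4.el, r3 i j, smul_mul_assoc, map_smul, smul_smul]
            change _ = (q ^ _ * q ^ _) • _
            rw [← zpow_add₀ (transc_ne hq)]
            change _ = q ^ ((d i : ℤ) * a i j + -((d i : ℤ) * a i j)) • _
            rw [add_neg_cancel, zpow_zero, one_smul]
          kf := fun i j m => hcf_ext fun u => by
            simp only [G4.tw]
            rw [map_smul, LinearMap.smul_apply, hr', hr', hr', hr', ← mul_assoc, ← mul_assoc]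
            simp only [G4.el, r2 i j, smul_mul_assoc, map_smul, smul_smul]
            change _ = (q ^ _ * q ^ _) • _
            rw [← zpow_add₀ (transc_ne hq)]
            change _ = q ^ (-((d i : ℤ) * a i j) + ((d i : ℤ) * a i j)) • _
            rw [neg_add_cancel, zpow_zero, one_smul]
          ef := fun i j m => hcf_ext fun u => by
            simp only [G4.tw]
            rw [map_sub, LinearMap.sub_apply, hr', hr', hr', hr', ← mul_assoc, ← mul_assoc, ← map_sub,
              ← sub_mul]
            simp only [G4.el, r4 j i]
            by_cases h : i = j
            · subst h
              rw [if_pos rfl, if_pos rfl, smul_mul_assoc, map_smul, map_smul, LinearMap.smul_apply,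
                map_sub, LinearMap.sub_apply, hr', hr', sub_mul, map_sub]; rfl
            · simp [h, Ne.symm h] }
      lr := fun x y i j m => hcf_ext fun u => by
        rw [hl', hr', hr', hl', mul_assoc]
      lE_mul := lE, lF_mul := lF, lK_mul := lK, rE_mul := rE, rF_mul := rF, rK_mul := rK
      lE_one := lE1, lF_one := lF1, lK_one := lK1, rE_one := rE1, rF_one := rF1, rK_one := rK1
      cf := cfL
      l_cf := fun c x j ξ v => hcf_ext fun u => by
        change ι (l x j (cf c ξ v)) u = ι (cf c ξ _) u
        rw [hl', hcf, hcf, map_mul]; rfl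
      r_cf := fun c x j ξ v => hcf_ext fun u => by
        change ι (r x j (cf c ξ v)) u = ι (cf c _ v) u
        rw [hr', hcf, hcf, map_mul]; rfl
      eps := AlgHom.ofLinearMap (LinearMap.applyₗ (1 : U) ∘ₗ ι)
        (by simp [hι1]) (fun x y => by
          simp [hιmul, hΔ1])
      eps_cf := fun c ξ v => by
        change ι (cf c ξ v) 1 = ξ v
        rw [hcf, map_one]; rfl
      eps_lr := fun x j m => by
        change ι (l x j m) 1 = ι (r x j m) 1
        rw [hl', hr', one_mul, mul_one]
      sep := fun N hN h0 => by
        rw [eq_bot_iff]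
        intro m hm
        have key : ∀ u : U, ∀ m ∈ N, ∃ m' ∈ N, ι m' = tL u (ι m) := by
          intro u
          have hu : u ∈ Algebra.adjoin ℂ {u : U | ∃ x j, u = G4.el E F K x j} := by
            rw [hadj]; trivial
          induction hu using Algebra.adjoin_induction with
          | mem u hu =>
            obtain ⟨x, j, rfl⟩ := hu
            exact fun m hm => ⟨_, hN x j m hm, hl x j m⟩
          | algebraMap t =>
            intro m hm
            refine ⟨t • m, N.smul_mem t hm, ?_⟩
            ext u
            rw [map_smul, tL_apply, Algebra.algebraMap_eq_smul_one, mul_smul_comm, mul_one, map_smul]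
            rfl
          | add u u' _ _ h h' =>
            intro m hm
            obtain ⟨m1, h1, e1⟩ := h m hm
            obtain ⟨m2, h2, e2⟩ := h' m hm
            refine ⟨m1 + m2, N.add_mem h1 h2, ?_⟩
            ext u
            rw [map_add, e1, e2, LinearMap.add_apply, tL_apply, tL_apply, tL_apply, mul_add, map_add]
          | mul u u' _ _ h h' =>
            intro m hm
            obtain ⟨m1, h1, e1⟩ := h' m hm
            obtain ⟨m2, h2, e2⟩ := h m1 h1
            refine ⟨m2, h2, ?_⟩
            ext u
            rw [e2, tL_apply, e1, tL_apply, tL_apply, mul_assoc]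
        rw [Submodule.mem_bot]
        refine hcf_ext fun u => ?_
        obtain ⟨m', hm', e⟩ := key u m hm
        have h1 : ι m' 1 = 0 := h0 m' hm'
        rw [e, tL_apply, one_mul] at h1
        rw [h1, map_zero, LinearMap.zero_apply]
      gen := hAgen }
  have hsing : ∀ i, (fun k => ((Pi.single i 1 : Fin n → ℕ) k : ℤ)) = Pi.single i 1 := by
    intro i; ext k
    by_cases h : k = i
    · subst h; simp
    · simp [h]
  exact D.final (fun i => Pi.single i 1) hsing ξp ξm vp vm
    (fun i ν hν x hx => (hξp i).1 ν (fun h => hν (by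
      rw [h]; ext k; exact neg_neg _)) x (mem_wtSp.2 hx))
    (fun i => (hξp i).2)
    (fun i => mem_wtSp.1 (hvp i).1) (fun i => (hvp i).2)
    (fun i ν hν x hx => (hξm i).1 ν (fun h => hν (by
      rw [h, neg_neg]; rfl)) x (mem_wtSp.2 hx))
    (fun i => (hξm i).2)
    (fun i => mem_wtSp.1 (hvm i).1) (fun i => (hvm i).2) _ _ (fun i => rfl) (fun i => rfl)
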